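/- arXiv:1111.2207 — 2 statements merged into one kernel-verified Lean document; each statement's English description precedes it below -/
import Mathlib

section
/- Assume (SA). Assume in addition that (i) there exist c ∈ (0,1) and α > 2 with c|x|^{−α} ≤ ρ(x) ≤ (1/c)|x|^{−α} for all |x| > 1, and (ii) there exists M > 0 such that u ↦ f(u)/u is nondecreasing on [M, +∞) and there exists C > 0 with f(u)/u ≤ C/Φ(u)² for all u ≥ M, where Φ(u) = ∫_u^{+∞} dt/√(F(t) − F(u)). Then every unbounded solution u of (E) satisfies lim_{|x|→+∞} u(x) = +∞. -/
open MeasureTheory Filter Set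

noncomputable def laplacian {D : ℕ} (u : EuclideanSpace ℝ (Fin D) → ℝ)
    (x : EuclideanSpace ℝ (Fin D)) : ℝ :=
  ∑ i, fderiv ℝ (fun y => fderiv ℝ u y (EuclideanSpace.single i 1)) x (EuclideanSpace.single i 1)

theorem nonpos_of_isLocalMax_of_hasDerivAt {φ φ' : ℝ → ℝ} {s : ℝ}
    (h₁ : ∀ t, HasDerivAt φ (φ' t) t) (h₂ : HasDerivAt φ' s 0) (hmax : IsLocalMax φ 0) :
    s ≤ 0 := by
  by_contra! hs
  have hd : deriv φ = φ' := funext fun t => (h₁ t).deriv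
  have hmin : IsLocalMin φ 0 := by
    refine isLocalMin_of_deriv_deriv_pos ?_ hmax.deriv_eq_zero (h₁ 0).continuousAt
    rw [hd, h₂.deriv]
    exact hs
  have hconst : φ =ᶠ[nhds 0] fun _ => φ 0 := by
    filter_upwards [hmin, hmax] with t h1 h2 using le_antisymm h2 h1
  have hz : φ' =ᶠ[nhds 0] fun _ => 0 := by
    filter_upwards [hconst.eventuallyEq_nhds] with t ht
    exact (h₁ t).unique ((hasDerivAt_const t (φ 0)).congr_of_eventuallyEq ht)
  have := h₂.unique ((hasDerivAt_const (0 : ℝ) (0 : ℝ)).congr_of_eventuallyEq hz)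
  exact hs.ne' this

section Euclidean

variable {D : ℕ} {u : EuclideanSpace ℝ (Fin D) → ℝ}

theorem hasDerivAt_comp_line (hu : ContDiff ℝ 1 u) (x v : EuclideanSpace ℝ (Fin D)) (t : ℝ) :
    HasDerivAt (fun s : ℝ => u (x + s • v)) (fderiv ℝ u (x + t • v) v) t := by
  have h1 : HasDerivAt (fun s : ℝ => x + s • v) v t := by
    simpa using ((hasDerivAt_id t).smul_const v).const_add x
  exact ((hu.differentiable one_ne_zero) (x + t • v)).hasFDerivAt.comp_hasDerivAt t h1

theorem contDiff_fderiv_apply (hu : ContDiff ℝ 2 u) (v : EuclideanSpace ℝ (Fin D)) :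
    ContDiff ℝ 1 fun y => fderiv ℝ u y v :=
  (hu.fderiv_right (m := 1) (by norm_num)).clm_apply contDiff_const

theorem continuous_laplacian (hu : ContDiff ℝ 2 u) : Continuous (laplacian u) := by
  unfold laplacian
  refine continuous_finsetSum _ fun i _ => ?_
  exact ((contDiff_fderiv_apply hu _).continuous_fderiv one_ne_zero).clm_apply continuous_const

theorem laplacian_le_of_isLocalMax (hu : ContDiff ℝ 2 u) {a : ℝ} {x p : EuclideanSpace ℝ (Fin D)}
    (hmax : IsLocalMax (fun y => u y - a * ‖y - x‖ ^ 2) p) : laplacian u p ≤ 2 * D * a := by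
  have key : ∀ i : Fin D, fderiv ℝ (fun y => fderiv ℝ u y (EuclideanSpace.single i 1)) p
      (EuclideanSpace.single i 1) ≤ 2 * a := by
    intro i
    set e : EuclideanSpace ℝ (Fin D) := EuclideanSpace.single i 1 with he
    have hne : ‖e‖ = 1 := by simp [he]
    set b := inner ℝ (p - x) e
    have hnorm : ∀ t : ℝ, ‖p + t • e - x‖ ^ 2 = ‖p - x‖ ^ 2 + 2 * t * b + t ^ 2 := by
      intro t
      rw [show p + t • e - x = (p - x) + t • e by abel, norm_add_sq_real, inner_smul_right,
        norm_smul, hne]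
      simp only [Real.norm_eq_abs, mul_one, sq_abs]
      ring
    have h1 : ∀ t : ℝ, HasDerivAt (fun s : ℝ => u (p + s • e) - a * ‖p + s • e - x‖ ^ 2)
        (fderiv ℝ u (p + t • e) e - a * (2 * b + 2 * t)) t := by
      intro t
      simp_rw [hnorm]
      have hq : HasDerivAt (fun s : ℝ => ‖p - x‖ ^ 2 + 2 * s * b + s ^ 2) (2 * b + 2 * t) t := by
        have := ((((hasDerivAt_id t).const_mul 2).mul_const b).const_add (‖p - x‖ ^ 2)).add
          ((hasDerivAt_id t).pow 2)
        refine this.congr_deriv ?_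
        norm_num
      exact (hasDerivAt_comp_line (hu.of_le one_le_two) p e t).sub (hq.const_mul a)
    have h2 : HasDerivAt (fun t : ℝ => fderiv ℝ u (p + t • e) e - a * (2 * b + 2 * t))
        (fderiv ℝ (fun y => fderiv ℝ u y e) p e - a * 2) 0 := by
      have h3 := hasDerivAt_comp_line (contDiff_fderiv_apply hu e) p e 0
      rw [zero_smul, add_zero] at h3
      have hq : HasDerivAt (fun s : ℝ => 2 * b + 2 * s) 2 0 := by
        simpa using ((hasDerivAt_id (0 : ℝ)).const_mul 2).const_add (2 * b)
      exact h3.sub (hq.const_mul a)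
    have hm : IsLocalMax (fun s : ℝ => u (p + s • e) - a * ‖p + s • e - x‖ ^ 2) 0 := by
      have hc : ContinuousAt (fun s : ℝ => p + s • e) 0 := by fun_prop
      have hp : IsLocalMax (fun y => u y - a * ‖y - x‖ ^ 2) (p + (0 : ℝ) • e) := by simpa using hmax
      exact IsLocalMax.comp_continuous (g := fun s : ℝ => p + s • e) hp hc
    have := nonpos_of_isLocalMax_of_hasDerivAt h1 h2 hm
    linarith
  calc laplacian u p ≤ ∑ _i : Fin D, 2 * a := Finset.sum_le_sum fun i _ => key i
    _ = 2 * D * a := by simp; ring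

theorem exists_sphere_ge_of_lt_laplacian (hu : ContDiff ℝ 2 u) {a d : ℝ} (ha : 0 ≤ a) (hd : 0 ≤ d)
    {x : EuclideanSpace ℝ (Fin D)}
    (h : ∀ y ∈ Metric.closedBall x d, u x ≤ u y → 2 * D * a < laplacian u y) :
    ∃ y, dist y x = d ∧ u x + a * d ^ 2 ≤ u y := by
  have hcont : ContinuousOn (fun y => u y - a * ‖y - x‖ ^ 2) (Metric.closedBall x d) := by
    have := hu.continuous
    fun_prop
  obtain ⟨p, hp, hpmax⟩ := (isCompact_closedBall x d).exists_isMaxOn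
    ⟨x, Metric.mem_closedBall_self hd⟩ hcont
  have hxp : u x ≤ u p - a * ‖p - x‖ ^ 2 := by
    simpa using hpmax (Metric.mem_closedBall_self hd)
  have hnn : 0 ≤ a * ‖p - x‖ ^ 2 := by positivity
  have hdist : dist p x = d := by
    refine le_antisymm hp ?_
    by_contra! hlt
    have hloc : IsLocalMax (fun y => u y - a * ‖y - x‖ ^ 2) p :=
      hpmax.isLocalMax (Metric.closedBall_mem_nhds_of_mem hlt)
    exact (laplacian_le_of_isLocalMax hu hloc).not_gt (h p hp (by linarith))
  refine ⟨p, hdist, ?_⟩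
  rw [← dist_eq_norm, hdist] at hxp
  linarith

end Euclidean

section Bump

variable {D : ℕ} {u : EuclideanSpace ℝ (Fin D) → ℝ}

/-- The radial weight `(1 - ‖y‖²)₊`, supported in the closed unit ball. -/
noncomputable def parabolicBump {D : ℕ} (y : EuclideanSpace ℝ (Fin D)) : ℝ := max (1 - ‖y‖ ^ 2) 0

theorem parabolicBump_nonneg (y : EuclideanSpace ℝ (Fin D)) : 0 ≤ parabolicBump y :=
  le_max_right _ _

theorem parabolicBump_le_one (y : EuclideanSpace ℝ (Fin D)) : parabolicBump y ≤ 1 :=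
  max_le (by nlinarith [sq_nonneg ‖y‖]) zero_le_one

theorem parabolicBump_eq_zero {y : EuclideanSpace ℝ (Fin D)} (hy : 1 ≤ ‖y‖) :
    parabolicBump y = 0 :=
  max_eq_right (by nlinarith)

theorem continuous_parabolicBump : Continuous (parabolicBump (D := D)) := by
  unfold parabolicBump
  fun_prop

theorem hasCompactSupport_parabolicBump : HasCompactSupport (parabolicBump (D := D)) := by
  refine HasCompactSupport.intro (isCompact_closedBall 0 1) fun y hy => parabolicBump_eq_zero ?_
  rw [mem_closedBall_zero_iff, not_le] at hy
  exact hy.le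

theorem integral_parabolicBump_pos :
    0 < ∫ y : EuclideanSpace ℝ (Fin D), parabolicBump y := by
  refine continuous_parabolicBump.integral_pos_of_hasCompactSupport_nonneg_nonzero
    hasCompactSupport_parabolicBump parabolicBump_nonneg (x := 0) ?_
  simp [parabolicBump]

theorem integrable_mul_parabolicBump {g : EuclideanSpace ℝ (Fin D) → ℝ} (hg : Continuous g) :
    Integrable fun y => g y * parabolicBump y :=
  (hg.mul continuous_parabolicBump).integrable_of_hasCompactSupport
    hasCompactSupport_parabolicBump.mul_left

theorem hasDerivAt_max_zero_sq (s : ℝ) :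
    HasDerivAt (fun t : ℝ => max t 0 ^ 2) (2 * max s 0) s := by
  rcases lt_trichotomy s 0 with h | h | h
  · rw [max_eq_right h.le, mul_zero]
    refine (hasDerivAt_const s (0 : ℝ)).congr_of_eventuallyEq ?_
    filter_upwards [Iio_mem_nhds h] with t ht
    simp [max_eq_right (mem_Iio.1 ht).le]
  · subst h
    rw [max_self, mul_zero]
    rw [hasDerivAt_iff_isLittleO_nhds_zero]
    have : (fun h : ℝ => max (0 + h) 0 ^ 2 - max (0 : ℝ) 0 ^ 2 - h • (0 : ℝ)) =O[nhds 0]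
        fun h : ℝ => h ^ 2 := by
      refine Asymptotics.IsBigO.of_bound 1 (Eventually.of_forall fun h => ?_)
      simp only [zero_add, max_self, smul_zero, sub_zero, norm_pow, one_mul, ne_eq,
        OfNat.ofNat_ne_zero, not_false_eq_true, zero_pow]
      gcongr
      rw [Real.norm_eq_abs, Real.norm_eq_abs, abs_of_nonneg (le_max_right _ _)]
      exact max_le (le_abs_self h) (abs_nonneg h)
    exact this.trans_isLittleO (by simpa using Asymptotics.isLittleO_pow_id one_lt_two)
  · rw [max_eq_left h.le]
    have : HasDerivAt (fun t : ℝ => t ^ 2) (2 * s) s := by simpa using hasDerivAt_pow 2 s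
    refine this.congr_of_eventuallyEq ?_
    filter_upwards [Ioi_mem_nhds h] with t ht
    simp only [max_eq_left (mem_Ioi.1 ht).le]

theorem hasFDerivAt_parabolicBump_sq (y : EuclideanSpace ℝ (Fin D)) :
    HasFDerivAt (fun z => parabolicBump z ^ 2)
      ((2 * parabolicBump y) • -((2 : ℕ) • innerSL ℝ y : EuclideanSpace ℝ (Fin D) →L[ℝ] ℝ)) y := by
  have h1 : HasFDerivAt (fun z : EuclideanSpace ℝ (Fin D) => 1 - ‖z‖ ^ 2)
      (-((2 : ℕ) • innerSL ℝ y : EuclideanSpace ℝ (Fin D) →L[ℝ] ℝ)) y := ((hasStrictFDerivAt_norm_sq y).hasFDerivAt).const_sub 1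
  exact (hasDerivAt_max_zero_sq (1 - ‖y‖ ^ 2)).comp_hasFDerivAt y h1

theorem fderiv_parabolicBump_sq_single (y : EuclideanSpace ℝ (Fin D)) (i : Fin D) :
    fderiv ℝ (fun z => parabolicBump z ^ 2) y (EuclideanSpace.single i 1) =
      -4 * (y i * parabolicBump y) := by
  rw [(hasFDerivAt_parabolicBump_sq y).fderiv]
  simp [EuclideanSpace.inner_single_right]
  ring

/-- Integration by parts against the weight. -/
theorem integral_fderiv_mul_parabolicBump (hu : ContDiff ℝ 2 u) (x : EuclideanSpace ℝ (Fin D))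
    (t : ℝ) :
    ∫ y, fderiv ℝ u (x + t • y) y * parabolicBump y =
      t / 4 * ∫ y, laplacian u (x + t • y) * parabolicBump y ^ 2 := by
  set e : Fin D → EuclideanSpace ℝ (Fin D) := fun i => EuclideanSpace.single i 1 with he
  have hline : ContDiff ℝ 1 fun y : EuclideanSpace ℝ (Fin D) => x + t • y := by fun_prop
  have hcg : ∀ i, Continuous fun y => fderiv ℝ u (x + t • y) (e i) := fun i =>
    ((contDiff_fderiv_apply hu (e i)).comp hline).continuous
  have hcgg : ∀ i, Continuous fun y =>
      fderiv ℝ (fun z => fderiv ℝ u z (e i)) (x + t • y) (e i) := fun i =>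
    (((contDiff_fderiv_apply hu (e i)).continuous_fderiv one_ne_zero).comp
      hline.continuous).clm_apply continuous_const
  have hd : ∀ i y, HasFDerivAt (fun y => fderiv ℝ u (x + t • y) (e i))
      ((fderiv ℝ (fun z => fderiv ℝ u z (e i)) (x + t • y)).comp
        (t • ContinuousLinearMap.id ℝ _)) y := by
    intro i y
    have h1 := ((contDiff_fderiv_apply hu (e i)).differentiable one_ne_zero
      (x + t • y)).hasFDerivAt
    have h2 : HasFDerivAt (fun y : EuclideanSpace ℝ (Fin D) => x + t • y)
        (t • ContinuousLinearMap.id ℝ _) y := ((hasFDerivAt_id y).const_smul t).const_add x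
    exact h1.comp y h2
  have hd' : ∀ i y, fderiv ℝ (fun y => fderiv ℝ u (x + t • y) (e i)) y (e i) =
      t * fderiv ℝ (fun z => fderiv ℝ u z (e i)) (x + t • y) (e i) := by
    intro i y
    rw [(hd i y).fderiv]
    simp
  have hsplit : ∀ y : EuclideanSpace ℝ (Fin D), fderiv ℝ u (x + t • y) y * parabolicBump y =
      ∑ i, fderiv ℝ u (x + t • y) (e i) * (y i * parabolicBump y) := by
    intro y
    have hlin : ∀ L : EuclideanSpace ℝ (Fin D) →L[ℝ] ℝ, L y = ∑ i, y i * L (e i) := by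
      intro L
      conv_lhs => rw [← (EuclideanSpace.basisFun (Fin D) ℝ).sum_repr y]
      simp [he]
    rw [hlin, Finset.sum_mul]
    exact Finset.sum_congr rfl fun i _ => by ring
  have hI1 : ∀ i, Integrable fun y : EuclideanSpace ℝ (Fin D) =>
      fderiv ℝ u (x + t • y) (e i) * (y i * parabolicBump y) := by
    intro i
    have : Continuous fun y : EuclideanSpace ℝ (Fin D) => fderiv ℝ u (x + t • y) (e i) * y i :=
      (hcg i).mul (by fun_prop)
    simpa only [mul_assoc] using integrable_mul_parabolicBump this
  have hsq : ∀ {g : EuclideanSpace ℝ (Fin D) → ℝ}, Continuous g →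
      Integrable fun y => g y * parabolicBump y ^ 2 := by
    intro g hg
    have := integrable_mul_parabolicBump (hg.mul continuous_parabolicBump)
    simpa only [Pi.mul_apply, mul_assoc, ← pow_two] using this
  have hparts : ∀ i, ∫ y, fderiv ℝ u (x + t • y) (e i) * (y i * parabolicBump y) =
      t / 4 * ∫ y, fderiv ℝ (fun z => fderiv ℝ u z (e i)) (x + t • y) (e i) *
        parabolicBump y ^ 2 := by
    intro i
    have := integral_mul_fderiv_eq_neg_fderiv_mul_of_integrable (μ := volume)
      (f := fun y => fderiv ℝ u (x + t • y) (e i)) (g := fun y => parabolicBump y ^ 2) (v := e i)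
      ?_ ?_ (hsq (hcg i)) (fun y _ => (hd i y).differentiableAt)
      (fun y _ => (hasFDerivAt_parabolicBump_sq y).differentiableAt)
    · have hg' : ∀ y, fderiv ℝ (fun z => parabolicBump z ^ 2) y (e i) =
          -4 * (y i * parabolicBump y) := fun y => fderiv_parabolicBump_sq_single y i
      simp only [hd', hg', mul_assoc, mul_left_comm _ (-4 : ℝ), integral_const_mul] at this
      linarith
    · simp only [hd', mul_assoc]
      exact (hsq (hcgg i)).const_mul t
    · simp only [he, fderiv_parabolicBump_sq_single, mul_left_comm _ (-4 : ℝ)]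
      exact (hI1 i).const_mul _
  simp_rw [hsplit]
  rw [integral_finsetSum _ fun i _ => hI1 i]
  simp_rw [hparts, ← Finset.mul_sum]
  rw [← integral_finsetSum _ fun i _ => hsq (hcgg i)]
  simp_rw [← Finset.sum_mul]
  rfl

theorem hasDerivAt_integral_parabolicBump (hu : ContDiff ℝ 2 u) (x : EuclideanSpace ℝ (Fin D))
    (t₀ : ℝ) :
    HasDerivAt (fun t : ℝ => ∫ y, u (x + t • y) * parabolicBump y)
      (t₀ / 4 * ∫ y, laplacian u (x + t₀ • y) * parabolicBump y ^ 2) t₀ := by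
  rw [← integral_fderiv_mul_parabolicBump hu x t₀]
  have hcd : Continuous fun p : ℝ × EuclideanSpace ℝ (Fin D) =>
      fderiv ℝ u (x + p.1 • p.2) p.2 :=
    ((hu.continuous_fderiv two_ne_zero).comp (by fun_prop)).clm_apply continuous_snd
  obtain ⟨B, hB⟩ := ((isCompact_closedBall t₀ 1).prod
    (isCompact_closedBall (0 : EuclideanSpace ℝ (Fin D)) 1)).exists_bound_of_continuousOn
    hcd.continuousOn
  refine (hasDerivAt_integral_of_dominated_loc_of_deriv_le
    (F' := fun t y => fderiv ℝ u (x + t • y) y * parabolicBump y)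
    (bound := fun y => B * parabolicBump y) (Metric.closedBall_mem_nhds t₀ one_pos)
    (Eventually.of_forall fun t => ?_) ?_ ?_ (Eventually.of_forall fun y t ht => ?_) ?_
    (Eventually.of_forall fun y t _ => ?_)).2
  · exact (integrable_mul_parabolicBump
      (hu.continuous.comp (by fun_prop))).aestronglyMeasurable
  · exact integrable_mul_parabolicBump (hu.continuous.comp (by fun_prop))
  · exact (integrable_mul_parabolicBump
      (hcd.comp (continuous_const.prodMk continuous_id))).aestronglyMeasurable
  · rw [norm_mul, Real.norm_of_nonneg (parabolicBump_nonneg y)]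
    rcases le_or_gt ‖y‖ 1 with hy | hy
    · exact mul_le_mul_of_nonneg_right (hB (t, y) ⟨ht, by simpa using hy⟩)
        (parabolicBump_nonneg y)
    · simp [parabolicBump_eq_zero hy.le]
  · exact integrable_mul_parabolicBump continuous_const
  · exact (hasDerivAt_comp_line (hu.of_le one_le_two) x y t).mul_const _

/-- Mean value inequality for subharmonic functions. -/
theorem mean_le_mean (hu : ContDiff ℝ 2 u) (hlap : ∀ x, 0 ≤ laplacian u x)
    (x : EuclideanSpace ℝ (Fin D)) {r : ℝ} (hr : 0 ≤ r) :
    u x * ∫ y : EuclideanSpace ℝ (Fin D), parabolicBump y ≤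
      ∫ y, u (x + r • y) * parabolicBump y := by
  have hmono : MonotoneOn (fun t : ℝ => ∫ y, u (x + t • y) * parabolicBump y) (Icc 0 r) := by
    refine monotoneOn_of_deriv_nonneg (convex_Icc 0 r)
      (fun t _ => (hasDerivAt_integral_parabolicBump hu x t).continuousAt.continuousWithinAt)
      (fun t _ => (hasDerivAt_integral_parabolicBump hu x
        t).differentiableAt.differentiableWithinAt) fun t ht => ?_
    rw [interior_Icc] at ht
    rw [(hasDerivAt_integral_parabolicBump hu x t).deriv]
    exact mul_nonneg (by linarith [ht.1])
      (integral_nonneg fun y => mul_nonneg (hlap _) (sq_nonneg _))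
  have := hmono (left_mem_Icc.2 hr) (right_mem_Icc.2 hr) hr
  simpa [integral_const_mul] using this

/-- Reverse mean value inequality for nonnegative functions with `Δu ≤ K u`. -/
theorem mean_le_exp_mul (hu : ContDiff ℝ 2 u) (hupos : ∀ x, 0 ≤ u x)
    (x : EuclideanSpace ℝ (Fin D)) {r K : ℝ} (hr : 0 ≤ r) (hK : 0 ≤ K)
    (hlap : ∀ y ∈ Metric.closedBall x r, laplacian u y ≤ K * u y) :
    ∫ y, u (x + r • y) * parabolicBump y ≤
      Real.exp (K * r ^ 2 / 4) * (u x * ∫ y : EuclideanSpace ℝ (Fin D), parabolicBump y) := by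
  set m : ℝ → ℝ := fun t => ∫ y, u (x + t • y) * parabolicBump y with hm
  have hm0 : ∀ t, 0 ≤ m t := fun t =>
    integral_nonneg fun y => mul_nonneg (hupos _) (parabolicBump_nonneg y)
  have hderiv : ∀ t, HasDerivAt (fun t => m t * Real.exp (-(K * r / 4) * t))
      ((t / 4 * ∫ y, laplacian u (x + t • y) * parabolicBump y ^ 2) *
        Real.exp (-(K * r / 4) * t) +
        m t * (Real.exp (-(K * r / 4) * t) * -(K * r / 4))) t := fun t =>
    (hasDerivAt_integral_parabolicBump hu x t).mul
      (by simpa using ((hasDerivAt_id t).const_mul (-(K * r / 4))).exp)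
  have hanti : AntitoneOn (fun t => m t * Real.exp (-(K * r / 4) * t)) (Icc 0 r) := by
    refine antitoneOn_of_deriv_nonpos (convex_Icc 0 r)
      (fun t _ => (hderiv t).continuousAt.continuousWithinAt)
      (fun t _ => (hderiv t).differentiableAt.differentiableWithinAt) fun t ht => ?_
    rw [interior_Icc] at ht
    rw [(hderiv t).deriv]
    have hle : ∫ y, laplacian u (x + t • y) * parabolicBump y ^ 2 ≤ K * m t := by
      rw [hm, ← integral_const_mul]
      refine integral_mono ?_ ?_ fun y => ?_
      · have := integrable_mul_parabolicBump
          (((continuous_laplacian hu).comp (by fun_prop : Continuous fun y => x + t • y)).mul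
            continuous_parabolicBump)
        simpa only [Pi.mul_apply, Function.comp_apply, mul_assoc, ← pow_two] using this
      · exact (integrable_mul_parabolicBump (hu.continuous.comp (by fun_prop))).const_mul K
      · rcases le_or_gt ‖y‖ 1 with hy | hy
        · have hmem : x + t • y ∈ Metric.closedBall x r := by
            rw [mem_closedBall_iff_norm, add_sub_cancel_left, norm_smul, Real.norm_eq_abs,
              abs_of_pos ht.1]
            nlinarith [ht.1, ht.2, norm_nonneg y]
          have h1 := hlap _ hmem
          have h2 := parabolicBump_nonneg y
          have h3 := parabolicBump_le_one y
          have h4 : 0 ≤ K * u (x + t • y) := mul_nonneg hK (hupos _)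
          calc laplacian u (x + t • y) * parabolicBump y ^ 2
              ≤ K * u (x + t • y) * parabolicBump y ^ 2 := by gcongr
            _ ≤ K * u (x + t • y) * parabolicBump y := by
                gcongr
                nlinarith
            _ = _ := by ring
        · simp [parabolicBump_eq_zero hy.le]
    have h5 : t / 4 * ∫ y, laplacian u (x + t • y) * parabolicBump y ^ 2 ≤
        m t * (K * r / 4) := by
      calc t / 4 * ∫ y, laplacian u (x + t • y) * parabolicBump y ^ 2
          ≤ t / 4 * (K * m t) := mul_le_mul_of_nonneg_left hle (by linarith [ht.1])
        _ ≤ r / 4 * (K * m t) :=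
            mul_le_mul_of_nonneg_right (by linarith [ht.2]) (mul_nonneg hK (hm0 t))
        _ = _ := by ring
    nlinarith [Real.exp_pos (-(K * r / 4) * t)]
  have h := hanti (left_mem_Icc.2 hr) (right_mem_Icc.2 hr) hr
  have h0 : m 0 = u x * ∫ y : EuclideanSpace ℝ (Fin D), parabolicBump y := by
    simp [hm, integral_const_mul]
  simp only [mul_zero, Real.exp_zero, mul_one, h0] at h
  calc m r = Real.exp (K * r ^ 2 / 4) * (m r * Real.exp (-(K * r / 4) * r)) := by
        rw [mul_left_comm, ← Real.exp_add]
        ring_nf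
        simp
    _ ≤ _ := by gcongr

/-- A local Harnack inequality. -/
theorem harnack_ball (hu : ContDiff ℝ 2 u) (hupos : ∀ x, 0 ≤ u x)
    (hlap0 : ∀ x, 0 ≤ laplacian u x) {x y : EuclideanSpace ℝ (Fin D)} {r K : ℝ}
    (hr : 0 < r) (hK : 0 ≤ K) (hxy : dist y x ≤ r / 4)
    (hlap : ∀ y ∈ Metric.closedBall x r, laplacian u y ≤ K * u y) :
    u y ≤ 2 * 4 ^ D * Real.exp (K * r ^ 2 / 4) * u x := by
  have h1 := mean_le_mean hu hlap0 y (by positivity : 0 ≤ r / 4)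
  have h2 := mean_le_exp_mul hu hupos x hr.le hK hlap
  have hI := integral_parabolicBump_pos (D := D)
  have hscale : ∀ (z : EuclideanSpace ℝ (Fin D)) {s : ℝ}, 0 < s →
      ∫ w, u (z + s • w) * parabolicBump w =
        (s ^ D)⁻¹ * ∫ w, u w * parabolicBump (s⁻¹ • (w - z)) := by
    intro z s hs
    have e1 := Measure.integral_comp_smul_of_nonneg (volume : Measure (EuclideanSpace ℝ (Fin D)))
      (fun w => u (z + w) * parabolicBump (s⁻¹ • w)) s (hR := hs.le)
    have e2 := integral_add_left_eq_self (μ := (volume : Measure (EuclideanSpace ℝ (Fin D))))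
      (fun w => u w * parabolicBump (s⁻¹ • (w - z))) z
    simp only [add_sub_cancel_left] at e2
    simp only [inv_smul_smul₀ hs.ne', e2, finrank_euclideanSpace_fin, smul_eq_mul] at e1
    exact e1
  have hint : ∀ (z : EuclideanSpace ℝ (Fin D)) {s : ℝ}, 0 < s →
      Integrable fun w => u w * parabolicBump (s⁻¹ • (w - z)) := by
    intro z s hs
    have e1 := integrable_mul_parabolicBump
      (hu.continuous.comp (by fun_prop : Continuous fun w => z + s • w))
    have e2 := (e1.comp_smul (inv_ne_zero hs.ne')).comp_sub_right z
    simpa [Function.comp_def, smul_inv_smul₀ hs.ne'] using e2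
  rw [hscale y (by positivity)] at h1
  rw [hscale x hr] at h2
  have h3 : ∫ w, u w * parabolicBump ((r / 4)⁻¹ • (w - y)) ≤
      2 * ∫ w, u w * parabolicBump (r⁻¹ • (w - x)) := by
    rw [← integral_const_mul]
    refine integral_mono (hint y (by positivity)) ((hint x hr).const_mul 2) fun w => ?_
    have key : parabolicBump ((r / 4)⁻¹ • (w - y)) ≤ 2 * parabolicBump (r⁻¹ • (w - x)) := by
      rcases le_or_gt (r / 4) ‖w - y‖ with hw | hw
      · rw [parabolicBump_eq_zero]
        · linarith [parabolicBump_nonneg (r⁻¹ • (w - x))]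
        · rw [norm_smul, norm_inv, Real.norm_of_nonneg (by positivity : 0 ≤ r / 4),
            ← div_eq_inv_mul, one_le_div (by positivity)]
          exact hw
      · have hwx : ‖w - x‖ ≤ r / 2 := by
          rw [dist_eq_norm] at hxy
          have := norm_add_le (w - y) (y - x)
          rw [sub_add_sub_cancel] at this
          linarith
        have hwx' : ‖r⁻¹ • (w - x)‖ ≤ 1 / 2 := by
          rw [norm_smul, norm_inv, Real.norm_of_nonneg hr.le, ← div_eq_inv_mul, div_le_iff₀ hr]
          linarith
        have : 1 - ‖r⁻¹ • (w - x)‖ ^ 2 ≤ parabolicBump (r⁻¹ • (w - x)) := le_max_left _ _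
        have h1 := parabolicBump_le_one ((r / 4)⁻¹ • (w - y))
        nlinarith [norm_nonneg (r⁻¹ • (w - x))]
    calc u w * parabolicBump ((r / 4)⁻¹ • (w - y))
        ≤ u w * (2 * parabolicBump (r⁻¹ • (w - x))) := mul_le_mul_of_nonneg_left key (hupos w)
      _ = _ := by ring
  have h4 : (((r / 4) ^ D)⁻¹ : ℝ) = 4 ^ D * (r ^ D)⁻¹ := by
    rw [div_pow, inv_div, div_eq_mul_inv]
  rw [h4] at h1
  refine le_of_mul_le_mul_right ?_ hI
  calc u y * ∫ y : EuclideanSpace ℝ (Fin D), parabolicBump y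
      ≤ 4 ^ D * (r ^ D)⁻¹ * ∫ w, u w * parabolicBump ((r / 4)⁻¹ • (w - y)) := h1
    _ ≤ 4 ^ D * (r ^ D)⁻¹ * (2 * ∫ w, u w * parabolicBump (r⁻¹ • (w - x))) := by gcongr
    _ = 2 * 4 ^ D * ((r ^ D)⁻¹ * ∫ w, u w * parabolicBump (r⁻¹ • (w - x))) := by ring
    _ ≤ 2 * 4 ^ D * (Real.exp (K * r ^ 2 / 4) *
          (u x * ∫ y : EuclideanSpace ℝ (Fin D), parabolicBump y)) := by gcongr
    _ = _ := by ring

end Bump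

section KellerOsserman

variable {f F : ℝ → ℝ} {M : ℝ}

theorem sub_eq_intervalIntegral (hF : ∀ s, F s = ∫ t in (0 : ℝ)..s, f t)
    (hf : ContinuousOn f (Ici 0)) {a b : ℝ} (ha : 0 ≤ a) (hb : 0 ≤ b) :
    F b - F a = ∫ t in a..b, f t := by
  have hint : ∀ {c : ℝ}, 0 ≤ c → IntervalIntegrable f volume 0 c := fun hc =>
    (hf.mono (by rw [uIcc_of_le hc]; exact Icc_subset_Ici_self)).intervalIntegrable
  rw [hF, hF, intervalIntegral.integral_interval_sub_left (hint hb) (hint ha)]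

theorem primitive_sub_pos (hF : ∀ s, F s = ∫ t in (0 : ℝ)..s, f t)
    (hf : ContinuousOn f (Ici 0)) (hfpos : ∀ t, 0 < t → 0 < f t) {a b : ℝ} (ha : 0 ≤ a)
    (hab : a < b) : 0 < F b - F a := by
  rw [sub_eq_intervalIntegral hF hf ha (ha.trans hab.le)]
  refine intervalIntegral.intervalIntegral_pos_of_pos_on ?_
    (fun t ht => hfpos t (ha.trans_lt ht.1)) hab
  refine (hf.mono ?_).intervalIntegrable
  rw [uIcc_of_le hab.le]
  exact fun t ht => ha.trans ht.1

theorem monotoneOn_of_div (hM : 0 < M) (hfpos : ∀ t, 0 < t → 0 < f t)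
    (hmono : MonotoneOn (fun u => f u / u) (Ici M)) : MonotoneOn f (Ici M) := by
  intro s hs t ht hst
  have hs0 : 0 < s := hM.trans_le hs
  have ht0 : 0 < t := hM.trans_le ht
  have h := hmono hs ht hst
  have h0 : 0 ≤ f t / t := (div_pos (hfpos t ht0) ht0).le
  calc f s = f s / s * s := by field_simp
    _ ≤ f t / t * t := mul_le_mul h hst hs0.le h0
    _ = f t := by field_simp

theorem primitive_sub_le (hF : ∀ s, F s = ∫ t in (0 : ℝ)..s, f t)
    (hf : ContinuousOn f (Ici 0)) (hM : 0 < M) (hfpos : ∀ t, 0 < t → 0 < f t)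
    (hmono : MonotoneOn (fun u => f u / u) (Ici M)) {m t b : ℝ} (hm : M ≤ m) (hmt : m ≤ t)
    (htb : t ≤ b) : F t - F m ≤ b ^ 2 * (f b / b) := by
  have hm0 : 0 < m := hM.trans_le hm
  have hfm := monotoneOn_of_div hM hfpos hmono
  have hb0 : 0 < b := by linarith
  rw [sub_eq_intervalIntegral hF hf hm0.le (hm0.le.trans hmt)]
  have hint : IntervalIntegrable f volume m t := by
    refine (hf.mono ?_).intervalIntegrable
    rw [uIcc_of_le hmt]
    exact fun s hs => hm0.le.trans hs.1
  calc ∫ s in m..t, f s ≤ ∫ _s in m..t, f b :=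
        intervalIntegral.integral_mono_on hmt hint intervalIntegrable_const fun s hs =>
          hfm (hm.trans hs.1) (hm.trans (hmt.trans htb)) (hs.2.trans htb)
    _ = (t - m) * f b := by simp
    _ ≤ b * f b := by
        have := hfpos b hb0
        gcongr
        linarith
    _ = b ^ 2 * (f b / b) := by field_simp

/-- A dyadic sum controlled by the Keller–Osserman integral. -/
theorem sum_dyadic_le (hF : ∀ s, F s = ∫ t in (0 : ℝ)..s, f t)
    (hf : ContinuousOn f (Ici 0)) (hM : 0 < M) (hfpos : ∀ t, 0 < t → 0 < f t)
    (hmono : MonotoneOn (fun u => f u / u) (Ici M)) {m : ℝ} (hm : M ≤ m)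
    (hint : IntegrableOn (fun t => 1 / √(F t - F m)) (Ioi m)) (n : ℕ) :
    ∑ k ∈ Finset.range n, 1 / √(f (2 ^ (k + 1) * m) / (2 ^ (k + 1) * m)) ≤
      2 * ∫ t in Ioi m, 1 / √(F t - F m) := by
  have hm0 : 0 < m := hM.trans_le hm
  have hge : ∀ k : ℕ, m ≤ 2 ^ k * m := fun k =>
    le_mul_of_one_le_left hm0.le (one_le_pow₀ one_le_two)
  have hstep : ∀ k : ℕ, 2 ^ k * m ≤ 2 ^ (k + 1) * m := fun k => by
    rw [pow_succ]; nlinarith [hge k]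
  have hii : ∀ {a b : ℝ}, m ≤ a → m ≤ b →
      IntervalIntegrable (fun t => 1 / √(F t - F m)) volume a b := by
    intro a b ha hb
    rw [intervalIntegrable_iff]
    exact hint.mono_set fun t ht => lt_of_le_of_lt (le_min ha hb) ht.1
  have hpiece : ∀ k : ℕ, 1 / √(f (2 ^ (k + 1) * m) / (2 ^ (k + 1) * m)) ≤
      2 * ∫ t in (2 ^ k * m)..(2 ^ (k + 1) * m), 1 / √(F t - F m) := by
    intro k
    set b := 2 ^ (k + 1) * m with hb
    have hb0 : 0 < b := by positivity
    have hab : b - 2 ^ k * m = b / 2 := by rw [hb, pow_succ]; ring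
    have hle : ∫ _t in (2 ^ k * m)..b, 1 / (b * √(f b / b)) ≤
        ∫ t in (2 ^ k * m)..b, 1 / √(F t - F m) := by
      refine intervalIntegral.integral_mono_on_of_le_Ioo (hstep k) intervalIntegrable_const
        (hii (hge k) (hge (k + 1))) fun t ht => ?_
      have hmt : m < t := (hge k).trans_lt ht.1
      refine one_div_le_one_div_of_le
        (Real.sqrt_pos.2 (primitive_sub_pos hF hf hfpos hm0.le hmt)) ?_
      rw [← Real.sqrt_sq hb0.le, ← Real.sqrt_mul (sq_nonneg b), Real.sqrt_sq hb0.le]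
      exact Real.sqrt_le_sqrt (primitive_sub_le hF hf hM hfpos hmono hm hmt.le ht.2.le)
    rw [intervalIntegral.integral_const, hab, smul_eq_mul] at hle
    have h2 : b / 2 * (1 / (b * √(f b / b))) = 1 / √(f b / b) / 2 := by
      have : √(f b / b) ≠ 0 := (Real.sqrt_pos.2 (div_pos (hfpos b hb0) hb0)).ne'
      field_simp
    linarith
  calc ∑ k ∈ Finset.range n, 1 / √(f (2 ^ (k + 1) * m) / (2 ^ (k + 1) * m))
      ≤ ∑ k ∈ Finset.range n,
          2 * ∫ t in (2 ^ k * m)..(2 ^ (k + 1) * m), 1 / √(F t - F m) :=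
        Finset.sum_le_sum fun k _ => hpiece k
    _ = 2 * ∫ t in m..(2 ^ n * m), 1 / √(F t - F m) := by
        rw [← Finset.mul_sum, intervalIntegral.sum_integral_adjacent_intervals
          (a := fun k => 2 ^ k * m) fun k _ => hii (hge k) (hge (k + 1))]
        simp
    _ ≤ 2 * ∫ t in Ioi m, 1 / √(F t - F m) := by
        rw [intervalIntegral.integral_of_le (hge n)]
        have := setIntegral_mono_set hint
          (Eventually.of_forall fun t => by positivity)
          (Ioc_subset_Ioi_self : Ioc m (2 ^ n * m) ⊆ Ioi m).eventuallyLE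
        linarith

/-- The Keller–Osserman estimate in a ball. -/
theorem keller_osserman_bound {D : ℕ} (hD : 0 < D) {u : EuclideanSpace ℝ (Fin D) → ℝ}
    (hu : ContDiff ℝ 2 u) (hM : 0 < M) (hfpos : ∀ t, 0 < t → 0 < f t)
    (hmono : MonotoneOn (fun u => f u / u) (Ici M)) {x : EuclideanSpace ℝ (Fin D)} {r b A : ℝ}
    (hr : 0 < r) (hb : 0 < b) (hx : M ≤ u x)
    (hlap : ∀ y ∈ Metric.closedBall x r, M ≤ u y → b * f (u y) ≤ laplacian u y)
    (hsum : ∀ n, ∑ k ∈ Finset.range n, 1 / √(f (2 ^ k * u x) / (2 ^ k * u x)) ≤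
      A / √(f (u x) / u x)) :
    b * r ^ 2 * (f (u x) / u x) ≤ 4 * D * A ^ 2 := by
  set m := u x with hmdef
  have hm0 : 0 < m := hM.trans_le hx
  have hD' : (0 : ℝ) < D := by exact_mod_cast hD
  set g : ℕ → ℝ := fun k => f (2 ^ k * m) / (2 ^ k * m) with hg
  have hgpos : ∀ k, 0 < g k := fun k => div_pos (hfpos _ (by positivity)) (by positivity)
  have hge : ∀ k : ℕ, m ≤ 2 ^ k * m := fun k =>
    le_mul_of_one_le_left hm0.le (one_le_pow₀ one_le_two)
  set d : ℕ → ℝ := fun k => √(4 * D / b) * (1 / √(g k)) with hd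
  have hdpos : ∀ k, 0 < d k := fun k => by
    have := Real.sqrt_pos.2 (hgpos k)
    have : 0 < √(4 * D / b) := Real.sqrt_pos.2 (by positivity)
    positivity
  have hdsq : ∀ k, d k ^ 2 = 4 * D / (b * g k) := by
    intro k
    have := hgpos k
    rw [hd]
    simp only
    rw [mul_pow, div_pow, Real.sq_sqrt (by positivity), Real.sq_sqrt this.le]
    field_simp
  have hdsum : ∀ n, ∑ k ∈ Finset.range n, d k ≤ √(4 * D / b) * (A / √(f m / m)) := by
    intro n
    rw [hd, ← Finset.mul_sum]
    exact mul_le_mul_of_nonneg_left (hsum n) (Real.sqrt_nonneg _)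
  by_contra! hcon
  have hgm : 0 < f m / m := div_pos (hfpos m hm0) hm0
  have hlt : √(4 * D / b) * (A / √(f m / m)) ≤ r := by
    refine abs_le_of_sq_le_sq' ?_ hr.le |>.2
    rw [mul_pow, div_pow, Real.sq_sqrt (by positivity), Real.sq_sqrt hgm.le, div_mul_div_comm,
      div_le_iff₀ (by positivity)]
    nlinarith
  have hseq : ∀ n : ℕ, ∃ y, dist y x ≤ ∑ k ∈ Finset.range n, d k ∧ 2 ^ n * m ≤ u y := by
    intro n
    induction n with
    | zero => exact ⟨x, by simp, by simp [hmdef]⟩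
    | succ n ih =>
      obtain ⟨y, hy, huy⟩ := ih
      have huy0 : 0 < u y := lt_of_lt_of_le (by positivity) huy
      have ha0 : 0 ≤ b * g n * u y / (4 * D) := by
        have := hgpos n
        positivity
      have hstrict : ∀ z ∈ Metric.closedBall y (d n), u y ≤ u z →
          2 * D * (b * g n * u y / (4 * D)) < laplacian u z := by
        intro z hz hyz
        have hzx : z ∈ Metric.closedBall x r := by
          rw [Metric.mem_closedBall] at hz ⊢
          have h1 := hdsum (n + 1)
          rw [Finset.sum_range_succ] at h1
          linarith [dist_triangle z y x]
        have hMz : 2 ^ n * m ≤ u z := huy.trans hyz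
        have hMn : M ≤ 2 ^ n * m := hx.trans (hge n)
        have huz0 : 0 < u z := huy0.trans_le hyz
        have h1 : g n ≤ f (u z) / u z := hmono hMn (hMn.trans hMz) hMz
        have h2 : g n * u y ≤ f (u z) := by
          calc g n * u y ≤ f (u z) / u z * u z :=
                mul_le_mul h1 hyz huy0.le (div_pos (hfpos _ huz0) huz0).le
            _ = f (u z) := by field_simp
        have h3 := hlap z hzx (hMn.trans hMz)
        have h4 : 2 * D * (b * g n * u y / (4 * D)) = b * (g n * u y) / 2 := by
          field_simp
          ring
        have h5 : 0 < b * (g n * u y) := mul_pos hb (mul_pos (hgpos n) huy0)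
        have h6 : b * (g n * u y) ≤ b * f (u z) := by gcongr
        rw [h4]
        linarith
      obtain ⟨z, hz, huz⟩ := exists_sphere_ge_of_lt_laplacian hu ha0 (hdpos n).le hstrict
      refine ⟨z, ?_, ?_⟩
      · rw [Finset.sum_range_succ]
        linarith [dist_triangle z y x]
      · have : b * g n * u y / (4 * D) * d n ^ 2 = u y := by
          rw [hdsq]
          have := (hgpos n).ne'
          field_simp
        rw [this] at huz
        rw [pow_succ]
        linarith
  obtain ⟨B, hB⟩ := (isCompact_closedBall x r).bddAbove_image hu.continuous.continuousOn
  obtain ⟨n, hn⟩ := pow_unbounded_of_one_lt (B / m) one_lt_two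
  obtain ⟨y, hy, huy⟩ := hseq n
  have hyB : u y ≤ B := hB (mem_image_of_mem u ((hy.trans (hdsum n)).trans hlt))
  rw [div_lt_iff₀ hm0] at hn
  linarith

end KellerOsserman

section Sphere

variable {D : ℕ} {u : EuclideanSpace ℝ (Fin D) → ℝ} {A R₀ : ℝ}

theorem harnack_of_inner_eq_zero (hA : 0 ≤ A)
    (hloc : ∀ x y, R₀ < ‖x‖ → dist y x ≤ ‖x‖ / 8 → u y ≤ A * u x)
    {x z : EuclideanSpace ℝ (Fin D)} (hx : 2 * R₀ < ‖x‖) (hxz : ‖z‖ = ‖x‖)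
    (hinner : inner ℝ x z = 0) : u z ≤ A ^ 32 * u x := by
  set p : ℕ → EuclideanSpace ℝ (Fin D) := fun j => x + (j / 32 : ℝ) • (z - x) with hp
  have hdiff : ‖z - x‖ ^ 2 = 2 * ‖x‖ ^ 2 := by
    rw [norm_sub_sq_real, real_inner_comm, hinner, hxz]
    ring
  have hdiff' : ‖z - x‖ ≤ 2 * ‖x‖ :=
    le_of_sq_le_sq (by nlinarith [sq_nonneg ‖x‖]) (by positivity)
  have hpn : ∀ j, ‖x‖ / 2 ≤ ‖p j‖ := by
    intro j
    have h1 : ‖p j‖ ^ 2 = ((1 - (j / 32 : ℝ)) ^ 2 + (j / 32 : ℝ) ^ 2) * ‖x‖ ^ 2 := by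
      have : p j = (1 - (j / 32 : ℝ)) • x + (j / 32 : ℝ) • z := by
        rw [hp]
        module
      rw [this, norm_add_sq_real, inner_smul_left, inner_smul_right, hinner, norm_smul, norm_smul,
        hxz, mul_pow, mul_pow, Real.norm_eq_abs, Real.norm_eq_abs, sq_abs, sq_abs]
      ring
    refine le_of_sq_le_sq ?_ (norm_nonneg _)
    rw [h1]
    nlinarith [mul_nonneg (sq_nonneg (1 - 2 * (j / 32 : ℝ))) (sq_nonneg ‖x‖), sq_nonneg ‖x‖]
  have hstep : ∀ j, u (p (j + 1)) ≤ A * u (p j) := by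
    intro j
    refine hloc _ _ (by linarith [hpn j]) ?_
    have : p (j + 1) - p j = (1 / 32 : ℝ) • (z - x) := by
      simp only [hp]
      push_cast
      module
    rw [dist_eq_norm, this, norm_smul]
    norm_num
    linarith [hpn j]
  have hall : ∀ j, u (p j) ≤ A ^ j * u x := by
    intro j
    induction j with
    | zero => simp [hp]
    | succ j ih =>
      calc u (p (j + 1)) ≤ A * u (p j) := hstep j
        _ ≤ A * (A ^ j * u x) := mul_le_mul_of_nonneg_left ih hA
        _ = A ^ (j + 1) * u x := by ring
  simpa [hp] using hall 32

theorem exists_norm_eq_inner_eq_zero (hD : 3 ≤ D) (x y : EuclideanSpace ℝ (Fin D)) {R : ℝ}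
    (hR : 0 ≤ R) : ∃ z, ‖z‖ = R ∧ inner ℝ x z = 0 ∧ inner ℝ z y = 0 := by
  classical
  set S := Submodule.span ℝ ({x, y} : Set (EuclideanSpace ℝ (Fin D))) with hS
  have hrank : Module.finrank ℝ S ≤ 2 := by
    have h1 := finrank_span_finset_le_card (R := ℝ) ({x, y} : Finset (EuclideanSpace ℝ (Fin D)))
    rw [Finset.coe_pair] at h1
    exact h1.trans Finset.card_le_two
  have hadd := S.finrank_add_finrank_orthogonal
  rw [finrank_euclideanSpace_fin] at hadd
  have hne : Sᗮ ≠ ⊥ := by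
    intro h
    rw [h, finrank_bot] at hadd
    omega
  obtain ⟨w, hw, hw0⟩ := Submodule.exists_mem_ne_zero_of_ne_bot hne
  have hwn : ‖w‖ ≠ 0 := norm_ne_zero_iff.2 hw0
  rw [Submodule.mem_orthogonal] at hw
  have hxw := hw x (Submodule.subset_span (by simp))
  have hyw := hw y (Submodule.subset_span (by simp))
  refine ⟨(R / ‖w‖) • w, ?_, ?_, ?_⟩
  · rw [norm_smul, Real.norm_of_nonneg (by positivity), div_mul_cancel₀ _ hwn]
  · rw [inner_smul_right, hxw, mul_zero]
  · rw [inner_smul_left, real_inner_comm, hyw, mul_zero]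

theorem harnack_sphere (hD : 3 ≤ D) (hA : 0 ≤ A)
    (hloc : ∀ x y, R₀ < ‖x‖ → dist y x ≤ ‖x‖ / 8 → u y ≤ A * u x)
    {x y : EuclideanSpace ℝ (Fin D)} (hx : 2 * R₀ < ‖x‖) (hxy : ‖y‖ = ‖x‖) :
    u y ≤ A ^ 64 * u x := by
  obtain ⟨z, hz, hxz, hzy⟩ := exists_norm_eq_inner_eq_zero hD x y (norm_nonneg x)
  calc u y ≤ A ^ 32 * u z := harnack_of_inner_eq_zero hA hloc (hz ▸ hx) (hxy.trans hz.symm) hzy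
    _ ≤ A ^ 32 * (A ^ 32 * u x) := by
        gcongr
        exact harnack_of_inner_eq_zero hA hloc hx hz hxz
    _ = _ := by ring

theorem tendsto_atTop_of_harnack_sphere (hu : ContDiff ℝ 2 u)
    (hlap : ∀ x, 0 < laplacian u x) (hA : 0 < A)
    (hsphere : ∀ x y, R₀ < ‖x‖ → ‖y‖ = ‖x‖ → u y ≤ A * u x)
    (hunbdd : ¬ ∃ B, ∀ x, u x ≤ B) : Tendsto u (cocompact _) atTop := by
  push Not at hunbdd
  refine tendsto_atTop.2 fun B => ?_
  obtain ⟨x₁, hx₁⟩ := hunbdd (max (A * B) (u 0))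
  filter_upwards [(tendsto_norm_cocompact_atTop (E := EuclideanSpace ℝ (Fin D))).eventually_gt_atTop
    (max R₀ ‖x₁‖)] with x hx
  obtain ⟨y, hy, hmax⟩ := (isCompact_closedBall (0 : EuclideanSpace ℝ (Fin D)) ‖x‖).exists_isMaxOn
    ⟨0, by simp⟩ hu.continuous.continuousOn
  have hyx : ‖y‖ = ‖x‖ := by
    refine le_antisymm (by simpa using hy) ?_
    by_contra! hlt
    have hloc : IsLocalMax u y := hmax.isLocalMax (Metric.closedBall_mem_nhds_of_mem (by simpa))
    have := laplacian_le_of_isLocalMax hu (a := 0) (x := 0) (p := y) (by simpa using hloc)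
    linarith [hlap y]
  have h1 : u x₁ ≤ u y := hmax (by simpa using ((le_max_right _ _).trans_lt hx).le)
  have h2 := hsphere x y ((le_max_left _ _).trans_lt hx) hyx
  have h3 := (le_max_left (A * B) (u 0)).trans_lt hx₁
  exact le_of_mul_le_mul_left (by linarith) hA

end Sphere

theorem exists_linear_bound {f : ℝ → ℝ} (hf : ContDiffOn ℝ 1 f (Ici 0)) (hf0 : f 0 = 0) {M : ℝ}
    (hM : 0 ≤ M) : ∃ L, 0 ≤ L ∧ ∀ t ∈ Icc 0 M, f t ≤ L * t := by
  obtain ⟨K, hK⟩ := ((hf.locallyLipschitzOn (convex_Ici 0)).mono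
    (Icc_subset_Ici_self : Icc 0 M ⊆ Ici 0)).exists_lipschitzOnWith_of_compact isCompact_Icc
  refine ⟨K, K.2, fun t ht => ?_⟩
  have := hK.dist_le_mul t ht 0 ⟨le_rfl, hM⟩
  rw [hf0, Real.dist_eq, Real.dist_eq, sub_zero, sub_zero, abs_of_nonneg ht.1] at this
  exact (le_abs_self _).trans this

theorem sum_dyadic_le_of_bound {f F Φ : ℝ → ℝ} {M C : ℝ}
    (hF : ∀ s, F s = ∫ t in (0 : ℝ)..s, f t) (hf : ContinuousOn f (Ici 0)) (hM : 0 < M)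
    (hfpos : ∀ t, 0 < t → 0 < f t) (hmono : MonotoneOn (fun u => f u / u) (Ici M))
    (hΦ : ∀ u, Φ u = ∫ t in Ioi u, 1 / √(F t - F u)) (hC : 0 < C)
    (hbound : ∀ u, M ≤ u → f u / u ≤ C / Φ u ^ 2) {m : ℝ} (hm : M ≤ m) (n : ℕ) :
    ∑ k ∈ Finset.range n, 1 / √(f (2 ^ k * m) / (2 ^ k * m)) ≤
      (1 + 2 * √C) / √(f m / m) := by
  have hm0 : 0 < m := hM.trans_le hm
  have hg : 0 < f m / m := div_pos (hfpos m hm0) hm0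
  have hsg : 0 < √(f m / m) := Real.sqrt_pos.2 hg
  have hb := hbound m hm
  have hne : Φ m ≠ 0 := by
    intro h
    rw [h] at hb
    simp only [ne_eq, OfNat.ofNat_ne_zero, not_false_eq_true, zero_pow, div_zero] at hb
    exact hb.not_gt hg
  have hint : IntegrableOn (fun t => 1 / √(F t - F m)) (Ioi m) := by
    by_contra h
    exact hne ((hΦ m).trans (integral_undef h))
  have hΦ0 : 0 ≤ Φ m := by
    rw [hΦ]
    exact integral_nonneg fun t => by positivity
  have hΦle : Φ m ≤ √C / √(f m / m) := by
    rw [le_div_iff₀ (by positivity)]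
    refine Real.le_sqrt_of_sq_le ?_
    rw [mul_pow, Real.sq_sqrt hg.le, mul_comm]
    rwa [le_div_iff₀ (by positivity)] at hb
  have hsum := sum_dyadic_le hF hf hM hfpos hmono hm hint
  rw [← hΦ] at hsum
  cases n with
  | zero => simp only [Finset.range_zero, Finset.sum_empty]; positivity
  | succ n =>
    rw [Finset.sum_range_succ']
    simp only [pow_zero, one_mul]
    have := hsum n
    rw [add_div, mul_div_assoc]
    linarith

/-- A solution satisfies `Δu ≤ K ‖x‖⁻² u` outside a ball. -/
theorem exists_laplacian_le_inv_sq {D : ℕ} (hD : 0 < D) {f F Φ : ℝ → ℝ}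
    {ρ u : EuclideanSpace ℝ (Fin D) → ℝ} {M C c α : ℝ}
    (hF : ∀ s, F s = ∫ t in (0 : ℝ)..s, f t) (hf : ContDiffOn ℝ 1 f (Ici 0)) (hf0 : f 0 = 0)
    (hfpos : ∀ t, 0 < t → 0 < f t) (hc : 0 < c) (hα : 2 < α)
    (hρdecay : ∀ x : EuclideanSpace ℝ (Fin D), 1 < ‖x‖ →
      c * ‖x‖ ^ (-α) ≤ ρ x ∧ ρ x ≤ (1 / c) * ‖x‖ ^ (-α))
    (hΦ : ∀ u : ℝ, Φ u = ∫ t in Ioi u, 1 / √(F t - F u)) (hM : 0 < M)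
    (hmono : MonotoneOn (fun u => f u / u) (Ici M)) (hC : 0 < C)
    (hbound : ∀ u, M ≤ u → f u / u ≤ C / Φ u ^ 2)
    (hu : ContDiff ℝ 2 u) (hupos : ∀ x, 0 < u x) (huel : ∀ x, laplacian u x = ρ x * f (u x)) :
    ∃ K, 0 ≤ K ∧ ∀ x, 2 < ‖x‖ → laplacian u x ≤ K / ‖x‖ ^ 2 * u x := by
  obtain ⟨L, hL, hfL⟩ := exists_linear_bound hf hf0 hM.le
  set A : ℝ := 1 + 2 * √C
  set q : ℝ := (3 / 2 : ℝ) ^ (-α) with hq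
  have hq0 : 0 < q := Real.rpow_pos_of_pos (by norm_num) _
  refine ⟨max (L / c) (16 * D * A ^ 2 / (c ^ 2 * q)), le_max_of_le_left (by positivity),
    fun x hx => ?_⟩
  have hx0 : 0 < ‖x‖ := by linarith
  have hux := hupos x
  have hRα : 0 < ‖x‖ ^ (-α) := Real.rpow_pos_of_pos hx0 _
  have hρx := (hρdecay x (by linarith)).2
  rw [huel]
  rcases le_total (u x) M with h | h
  · have h1 : f (u x) ≤ L * u x := hfL _ ⟨hux.le, h⟩
    have h2 : ‖x‖ ^ (-α) ≤ 1 / ‖x‖ ^ 2 := by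
      have := Real.rpow_le_rpow_of_exponent_le (by linarith : 1 ≤ ‖x‖) (by linarith : -α ≤ -2)
      refine this.trans_eq ?_
      rw [Real.rpow_neg hx0.le, one_div]
      norm_cast
    calc ρ x * f (u x) ≤ (1 / c * (1 / ‖x‖ ^ 2)) * (L * u x) := by
          refine mul_le_mul (hρx.trans ?_) h1 (hfpos _ hux).le (by positivity)
          gcongr
      _ = L / c / ‖x‖ ^ 2 * u x := by field_simp
      _ ≤ _ := by
          gcongr
          exact le_max_left _ _
  · have hb : ∀ y ∈ Metric.closedBall x (‖x‖ / 2), c * (q * ‖x‖ ^ (-α)) ≤ ρ y := by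
      intro y hy
      rw [mem_closedBall_iff_norm] at hy
      have h1 : ‖y‖ ≤ 3 / 2 * ‖x‖ := by linarith [norm_le_norm_add_norm_sub' y x]
      have h2 : ‖x‖ / 2 ≤ ‖y‖ := by linarith [norm_le_norm_add_norm_sub y x]
      refine le_trans ?_ (hρdecay y (by linarith)).1
      rw [hq, ← Real.mul_rpow (by norm_num) hx0.le]
      exact mul_le_mul_of_nonneg_left
        (Real.rpow_le_rpow_of_nonpos (by linarith) h1 (by linarith)) hc.le
    have hb0 : 0 < c * (q * ‖x‖ ^ (-α)) := by positivity
    have hko := keller_osserman_bound hD hu hM hfpos hmono (x := x) (half_pos hx0) hb0 h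
      (fun y hy hMy => by
        rw [huel]
        exact mul_le_mul_of_nonneg_right (hb y hy) (hfpos _ (hupos y)).le)
      (sum_dyadic_le_of_bound hF hf.continuousOn hM hfpos hmono hΦ hC hbound h)
    have hg : 0 < f (u x) / u x := div_pos (hfpos _ hux) hux
    have h1 : ρ x * (f (u x) / u x) ≤ 16 * D * A ^ 2 / (c ^ 2 * q) / ‖x‖ ^ 2 := by
      calc ρ x * (f (u x) / u x) ≤ 1 / c * ‖x‖ ^ (-α) * (f (u x) / u x) := by gcongr
        _ = 4 * (c * (q * ‖x‖ ^ (-α)) * (‖x‖ / 2) ^ 2 * (f (u x) / u x)) /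
              (c ^ 2 * q) / ‖x‖ ^ 2 := by
            field_simp
            ring
        _ ≤ 4 * (4 * D * A ^ 2) / (c ^ 2 * q) / ‖x‖ ^ 2 := by gcongr
        _ = _ := by ring
    calc ρ x * f (u x) = ρ x * (f (u x) / u x) * u x := by field_simp
      _ ≤ 16 * D * A ^ 2 / (c ^ 2 * q) / ‖x‖ ^ 2 * u x := by gcongr
      _ ≤ _ := by
          gcongr
          exact le_max_right _ _

/-- Under (SA) plus the growth assumptions (i) on `ρ` and (ii) on `f`,
every unbounded solution of `Δu = ρ f(u)`, `u > 0` tends to `+∞` at infinity. -/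
theorem stmt2 (D : ℕ) (hD : 3 ≤ D)
    (f : ℝ → ℝ) (ρ : EuclideanSpace ℝ (Fin D) → ℝ)
    (F : ℝ → ℝ) (hF : ∀ s, F s = ∫ t in (0:ℝ)..s, f t)
    (hf : ContDiffOn ℝ 1 f (Ici 0)) (hf0 : f 0 = 0)
    (hfpos : ∀ t : ℝ, 0 < t → 0 < f t)
    (hKO : ∃ b : ℝ, 0 < b ∧ IntegrableOn (fun s => 1 / Real.sqrt (F s)) (Ici b))
    (hρ : ContDiff ℝ 1 ρ) (hρpos : ∀ x, 0 < ρ x)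
    (hHρ : Tendsto (fun x : EuclideanSpace ℝ (Fin D) =>
      ∫ y : EuclideanSpace ℝ (Fin D), ‖x - y‖ ^ (2 - (D:ℝ)) * ρ y) (cocompact _) (nhds 0))
    -- (i) two-sided power decay of ρ
    (c α : ℝ) (hc : c ∈ Ioo (0:ℝ) 1) (hα : 2 < α)
    (hρdecay : ∀ x : EuclideanSpace ℝ (Fin D), 1 < ‖x‖ →
      c * ‖x‖ ^ (-α) ≤ ρ x ∧ ρ x ≤ (1/c) * ‖x‖ ^ (-α))
    -- (ii) monotonicity of f(u)/u and the bound f(u)/u ≤ C/Φ(u)²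
    (Φ : ℝ → ℝ) (hΦ : ∀ u : ℝ, Φ u = ∫ t in Ioi u, 1 / Real.sqrt (F t - F u))
    (M : ℝ) (hM : 0 < M)
    (hmono : MonotoneOn (fun u => f u / u) (Ici M))
    (C : ℝ) (hC : 0 < C)
    (hbound : ∀ u : ℝ, M ≤ u → f u / u ≤ C / (Φ u) ^ 2)
    -- u is an unbounded solution
    (u : EuclideanSpace ℝ (Fin D) → ℝ)
    (hu : ContDiff ℝ 2 u) (hupos : ∀ x, 0 < u x)
    (huel : ∀ x, laplacian u x = ρ x * f (u x))
    (hunbdd : ¬ ∃ C' : ℝ, ∀ x, u x ≤ C') :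
    Tendsto u (cocompact _) atTop := by
  obtain ⟨K, hK, hlapK⟩ := exists_laplacian_le_inv_sq (by omega) hF hf hf0 hfpos hc.1 hα hρdecay
    hΦ hM hmono hC hbound hu hupos huel
  have hlap : ∀ x, 0 < laplacian u x := fun x => by
    rw [huel]
    exact mul_pos (hρpos x) (hfpos _ (hupos x))
  set A : ℝ := 2 * 4 ^ D * Real.exp (K / 4)
  have hA0 : 0 < A := by positivity
  have hloc : ∀ x y : EuclideanSpace ℝ (Fin D), 4 < ‖x‖ → dist y x ≤ ‖x‖ / 8 →
      u y ≤ A * u x := by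
    intro x y hx hxy
    have hx0 : 0 < ‖x‖ := by linarith
    have := harnack_ball hu (fun x => (hupos x).le) (fun x => (hlap x).le) (x := x) (y := y)
      (r := ‖x‖ / 2) (K := K / (‖x‖ / 2) ^ 2) (by positivity) (by positivity) (by linarith)
      fun z hz => by
        rw [mem_closedBall_iff_norm] at hz
        have h2 : ‖x‖ / 2 ≤ ‖z‖ := by linarith [norm_le_norm_add_norm_sub z x]
        have huz := hupos z
        refine (hlapK z (by linarith)).trans ?_
        gcongr
    rwa [div_mul_cancel₀ _ (by positivity)] at this
  exact tendsto_atTop_of_harnack_sphere hu hlap (by positivity : 0 < A ^ 64)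
    (fun x y hx hxy => harnack_sphere hD hA0.le hloc hx hxy) hunbdd
end

section
/- Assume (SA) and that there exists α > 2 such that ρ(x) = |x|^{−α} for all |x| ≥ 1. Then any two entire large solutions u₁, u₂ of (E) satisfy lim_{|x|→+∞} [u₁(x) − u₂(x)] = 0. -/
open MeasureTheory Filter Set

open Topology

/-- The second derivative of a real function is nonpositive at a local maximum. -/
lemma second_deriv_nonpos_of_isLocalMax {φ φ' : ℝ → ℝ} {c t : ℝ} (hmax : IsLocalMax φ t)
    (h1 : ∀ᶠ s in 𝓝 t, HasDerivAt φ (φ' s) s) (h2 : HasDerivAt φ' c t) : c ≤ 0 := by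
  by_contra! hc
  have hd : deriv φ =ᶠ[𝓝 t] φ' := h1.mono fun s hs => hs.deriv
  have hmin : IsLocalMin φ t := isLocalMin_of_deriv_deriv_pos
    (by rw [hd.deriv_eq, h2.deriv]; exact hc) hmax.deriv_eq_zero h1.self_of_nhds.continuousAt
  have hconst : φ =ᶠ[𝓝 t] fun _ => φ t := by
    filter_upwards [hmin, hmax] with s hs hs' using le_antisymm hs' hs
  have hd0 : φ' =ᶠ[𝓝 t] fun _ => 0 := by
    filter_upwards [hd, hconst.eventuallyEq_nhds] with s hs hs'
    rw [← hs, hs'.deriv_eq, deriv_const]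
  have := h2.congr_of_eventuallyEq hd0.symm
  exact hc.ne' (this.unique (hasDerivAt_const t 0))

section Radial

variable {D : ℕ} {u : EuclideanSpace ℝ (Fin D) → ℝ} {x : EuclideanSpace ℝ (Fin D)}

lemma norm_add_smul_single_sq (x : EuclideanSpace ℝ (Fin D)) (i : Fin D) (τ : ℝ) :
    ‖x + τ • EuclideanSpace.single i (1 : ℝ)‖ ^ 2 = ‖x‖ ^ 2 + 2 * τ * x i + τ ^ 2 := by
  rw [norm_add_sq_real, real_inner_smul_right, norm_smul, EuclideanSpace.inner_single_right]
  simp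
  ring

lemma hasDerivAt_line (x : EuclideanSpace ℝ (Fin D)) (i : Fin D) (τ : ℝ) :
    HasDerivAt (fun s : ℝ => x + s • EuclideanSpace.single i (1 : ℝ))
      (EuclideanSpace.single i 1) τ := by
  simpa using ((hasDerivAt_id τ).smul_const (EuclideanSpace.single i (1 : ℝ))).const_add x

/-- A function of `log ‖x‖` touching `u` from below has the smaller Laplacian. -/
lemma radial_le_laplacian_of_isLocalMax (hu : ContDiff ℝ 2 u) (hx : x ≠ 0) {h W₂ : ℝ}
    {W W₁ : ℝ → ℝ} (hW : ∀ᶠ t in 𝓝 (Real.log ‖x‖ + h), HasDerivAt W (W₁ t) t)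
    (hW₁ : HasDerivAt W₁ W₂ (Real.log ‖x‖ + h))
    (hmax : IsLocalMax (fun y => W (Real.log ‖y‖ + h) - u y) x) :
    (W₂ + ((D : ℝ) - 2) * W₁ (Real.log ‖x‖ + h)) / ‖x‖ ^ 2 ≤ laplacian u x := by
  have hr : 0 < ‖x‖ ^ 2 := by positivity
  set t := Real.log ‖x‖ + h with ht
  have key : ∀ i : Fin D, W₂ * (x i / ‖x‖ ^ 2) ^ 2
      + W₁ t * ((‖x‖ ^ 2 - 2 * x i ^ 2) / (‖x‖ ^ 2) ^ 2)
      - fderiv ℝ (fun y => fderiv ℝ u y (EuclideanSpace.single i 1)) x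
        (EuclideanSpace.single i 1) ≤ 0 := by
    intro i
    set n : ℝ → ℝ := fun τ => ‖x‖ ^ 2 + 2 * τ * x i + τ ^ 2 with hn
    have hn0 : n 0 = ‖x‖ ^ 2 := by simp [hn]
    have hnd : ∀ τ, HasDerivAt n (2 * (x i + τ)) τ := by
      intro τ
      have := (((hasDerivAt_id τ).const_mul 2).mul_const (x i)).const_add (‖x‖ ^ 2) |>.add
        (hasDerivAt_pow 2 τ)
      refine this.congr_deriv ?_
      push_cast; ring
    have hnpos : ∀ᶠ τ in 𝓝 (0 : ℝ), 0 < n τ :=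
      (hnd 0).continuousAt.eventually_const_lt (by rw [hn0]; exact hr)
    set l : ℝ → ℝ := fun τ => Real.log (n τ) / 2 + h with hl
    have hl0 : l 0 = t := by
      simp only [hl, hn0, Real.log_pow, ht]; push_cast; ring
    have hld : ∀ τ, 0 < n τ → HasDerivAt l ((x i + τ) / n τ) τ := by
      intro τ hτ
      have := (((hnd τ).log hτ.ne').div_const 2).add_const h
      refine this.congr_deriv ?_
      ring
    have hlc : ContinuousAt l 0 := (hld 0 (by rw [hn0]; exact hr)).continuousAt
    have hlW : ∀ᶠ τ in 𝓝 (0 : ℝ), HasDerivAt W (W₁ (l τ)) (l τ) := by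
      exact hlc.tendsto.eventually (p := fun s => HasDerivAt W (W₁ s) s) (by rw [hl0]; exact hW)
    have hlog : ∀ τ, Real.log ‖x + τ • EuclideanSpace.single i (1 : ℝ)‖ + h = l τ := by
      intro τ
      simp only [hl, hn, ← norm_add_smul_single_sq, Real.log_pow]; push_cast; ring
    have hcont : Tendsto (fun s : ℝ => x + s • EuclideanSpace.single i (1 : ℝ)) (𝓝 0) (𝓝 x) := by
      simpa using (hasDerivAt_line x i 0).continuousAt.tendsto
    have hloc : IsLocalMax (fun τ : ℝ => W (l τ) - u (x + τ • EuclideanSpace.single i (1 : ℝ)))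
        0 := by
      have := hcont.eventually hmax
      filter_upwards [this] with τ hτ
      simpa [← hlog] using hτ
    have hdu : Differentiable ℝ u := hu.differentiable (by norm_num)
    have hdu2 : Differentiable ℝ (fun y => fderiv ℝ u y (EuclideanSpace.single i (1 : ℝ))) := by
      have : Differentiable ℝ (fderiv ℝ u) :=
        (hu.fderiv_right (m := 1) (by norm_num)).differentiable (by norm_num)
      fun_prop
    have h1 : ∀ᶠ τ in 𝓝 (0 : ℝ), HasDerivAt
        (fun τ : ℝ => W (l τ) - u (x + τ • EuclideanSpace.single i (1 : ℝ)))
        (W₁ (l τ) * ((x i + τ) / n τ) - fderiv ℝ u (x + τ • EuclideanSpace.single i (1 : ℝ))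
          (EuclideanSpace.single i 1)) τ := by
      filter_upwards [hnpos, hlW] with τ hτ hτ'
      exact (hτ'.comp τ (hld τ hτ)).sub
        ((hdu _).hasFDerivAt.comp_hasDerivAt τ (hasDerivAt_line x i τ))
    refine second_deriv_nonpos_of_isLocalMax hloc h1 ?_
    have hW₁' : HasDerivAt W₁ W₂ (l 0) := by rw [hl0]; exact hW₁
    have hb : HasDerivAt (fun τ : ℝ => (x i + τ) / n τ)
        ((‖x‖ ^ 2 - 2 * x i ^ 2) / (‖x‖ ^ 2) ^ 2) 0 := by
      have := ((hasDerivAt_id (0 : ℝ)).const_add (x i)).div (hnd 0) (by rw [hn0]; exact hr.ne')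
      refine this.congr_deriv ?_
      simp only [id, hn0, add_zero]; ring
    have ha := (hW₁'.comp (0 : ℝ) (hld 0 (by rw [hn0]; exact hr))).mul hb
    have hdu2' : HasFDerivAt (fun y => fderiv ℝ u y (EuclideanSpace.single i (1 : ℝ)))
        (fderiv ℝ (fun y => fderiv ℝ u y (EuclideanSpace.single i (1 : ℝ))) x)
        (x + (0 : ℝ) • EuclideanSpace.single i (1 : ℝ)) := by
      simpa using (hdu2 x).hasFDerivAt
    refine (ha.sub (hdu2'.comp_hasDerivAt 0 (hasDerivAt_line x i 0))).congr_deriv ?_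
    simp only [Function.comp, hl0, hn0, add_zero]; ring
  have hsum := Finset.sum_nonpos fun i (_ : i ∈ Finset.univ) => key i
  rw [Finset.sum_sub_distrib, sub_nonpos] at hsum
  refine le_trans (le_of_eq ?_) hsum
  have hxs : ∑ i, x i ^ 2 = ‖x‖ ^ 2 := by
    rw [EuclideanSpace.norm_sq_eq]; simp
  rw [Finset.sum_add_distrib, ← Finset.mul_sum, ← Finset.mul_sum]
  simp only [div_pow]
  rw [← Finset.sum_div, ← Finset.sum_div, Finset.sum_sub_distrib, ← Finset.mul_sum, hxs]
  simp
  field_simp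

lemma laplacian_neg (u : EuclideanSpace ℝ (Fin D) → ℝ) (x : EuclideanSpace ℝ (Fin D)) :
    laplacian (fun y => -u y) x = -laplacian u x := by
  simp only [laplacian, ← Finset.sum_neg_distrib]
  refine Finset.sum_congr rfl fun i _ => ?_
  have : (fun y => fderiv ℝ (fun z => -u z) y (EuclideanSpace.single i (1 : ℝ)))
      = fun y => -(fderiv ℝ u y (EuclideanSpace.single i (1 : ℝ))) := by
    funext y; rw [fderiv_fun_neg]; rfl
  rw [this, fderiv_fun_neg]; rfl

/-- A function of `log ‖x‖` touching `u` from above has the larger Laplacian. -/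
lemma laplacian_le_radial_of_isLocalMin (hu : ContDiff ℝ 2 u) (hx : x ≠ 0) {h W₂ : ℝ}
    {W W₁ : ℝ → ℝ} (hW : ∀ᶠ t in 𝓝 (Real.log ‖x‖ + h), HasDerivAt W (W₁ t) t)
    (hW₁ : HasDerivAt W₁ W₂ (Real.log ‖x‖ + h))
    (hmin : IsLocalMin (fun y => W (Real.log ‖y‖ + h) - u y) x) :
    laplacian u x ≤ (W₂ + ((D : ℝ) - 2) * W₁ (Real.log ‖x‖ + h)) / ‖x‖ ^ 2 := by
  have := radial_le_laplacian_of_isLocalMax (u := fun y => -u y) hu.neg hx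
    (W := fun t => -W t) (W₁ := fun t => -W₁ t) (h := h) (W₂ := -W₂)
    (hW.mono fun t ht => ht.neg) hW₁.neg ?_
  · rw [laplacian_neg] at this
    have e : (-W₂ + ((D : ℝ) - 2) * -W₁ (Real.log ‖x‖ + h)) / ‖x‖ ^ 2
      = -((W₂ + ((D : ℝ) - 2) * W₁ (Real.log ‖x‖ + h)) / ‖x‖ ^ 2) := by ring
    rw [e] at this
    linarith
  · filter_upwards [hmin] with y hy
    linarith

end Radial

/-- `w'' + a w' = exp (-γ t) f(w)` at the point `t`, written as a first order system with
`q = exp (a t) w'`. -/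
def IsRadialSol (a γ : ℝ) (f w q : ℝ → ℝ) (t : ℝ) : Prop :=
  HasDerivAt w (Real.exp (-(a * t)) * q t) t ∧
    HasDerivAt q (Real.exp ((a - γ) * t) * f (w t)) t

/-- Entire large solutions whose weight is `‖x‖ ^ (-(γ + 2))` outside the unit ball. -/
structure IsLargeSol {D : ℕ} (γ : ℝ) (f : ℝ → ℝ) (u : EuclideanSpace ℝ (Fin D) → ℝ) : Prop where
  smooth : ContDiff ℝ 2 u
  pos : ∀ x, 0 < u x
  lap_pos : ∀ x, 0 < laplacian u x
  eq : ∀ x, 1 ≤ ‖x‖ → laplacian u x = ‖x‖ ^ (-(γ + 2)) * f (u x)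
  lim : Tendsto u (cocompact _) atTop

section Sliding

variable {D : ℕ} {u : EuclideanSpace ℝ (Fin D) → ℝ} {x : EuclideanSpace ℝ (Fin D)}
  {γ : ℝ} {f w q : ℝ → ℝ}

lemma IsRadialSol.hasDerivAt_deriv {a t : ℝ} (h : IsRadialSol a γ f w q t) :
    HasDerivAt (fun s => Real.exp (-(a * s)) * q s)
      (Real.exp (-(γ * t)) * f (w t) - a * (Real.exp (-(a * t)) * q t)) t := by
  have h1 : HasDerivAt (fun s => Real.exp (-(a * s))) (Real.exp (-(a * t)) * (-a)) t := by
    have := (((hasDerivAt_id t).const_mul a).neg).exp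
    simpa using this
  refine (h1.mul h.2).congr_deriv ?_
  have : Real.exp (-(γ * t)) = Real.exp (-(a * t)) * Real.exp ((a - γ) * t) := by
    rw [← Real.exp_add]; congr 1; ring
  rw [this]; ring

lemma IsRadialSol.weight_eq (hx : x ≠ 0) (h : ℝ) :
    Real.exp (-(γ * (Real.log ‖x‖ + h))) / ‖x‖ ^ 2
      = Real.exp (-(γ * h)) * ‖x‖ ^ (-(γ + 2)) := by
  have hr : 0 < ‖x‖ := norm_pos_iff.2 hx
  have h2 : ‖x‖ ^ 2 = Real.exp (2 * Real.log ‖x‖) := by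
    rw [two_mul, Real.exp_add, Real.exp_log hr]; ring
  rw [h2, Real.rpow_def_of_pos hr, ← Real.exp_sub, ← Real.exp_add]
  congr 1; ring

lemma IsLargeSol.not_isLocalMax (hu : IsLargeSol γ f u) (hγ : 0 < γ)
    (hf : ∀ t, 0 < t → 0 < f t) (hx : 1 ≤ ‖x‖) {h : ℝ} (hh : h < 0)
    (hw : ∀ᶠ t in 𝓝 (Real.log ‖x‖ + h), IsRadialSol ((D : ℝ) - 2) γ f w q t)
    (he : w (Real.log ‖x‖ + h) = u x) :
    ¬ IsLocalMax (fun y => w (Real.log ‖y‖ + h) - u y) x := by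
  intro hmax
  have hx0 : x ≠ 0 := norm_pos_iff.1 (by linarith)
  have := radial_le_laplacian_of_isLocalMax hu.smooth hx0 (hw.mono fun t ht => ht.1)
    hw.self_of_nhds.hasDerivAt_deriv hmax
  rw [hu.eq x hx, sub_add_cancel, he, mul_div_right_comm, IsRadialSol.weight_eq hx0,
    mul_assoc] at this
  have hp : 0 < ‖x‖ ^ (-(γ + 2)) * f (u x) :=
    mul_pos (Real.rpow_pos_of_pos (by linarith) _) (hf _ (hu.pos x))
  have h1 : 1 < Real.exp (-(γ * h)) := Real.one_lt_exp_iff.2 (by nlinarith)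
  nlinarith

lemma IsLargeSol.not_isLocalMin (hu : IsLargeSol γ f u) (hγ : 0 < γ)
    (hf : ∀ t, 0 < t → 0 < f t) (hx : 1 ≤ ‖x‖) {h : ℝ} (hh : 0 < h)
    (hw : ∀ᶠ t in 𝓝 (Real.log ‖x‖ + h), IsRadialSol ((D : ℝ) - 2) γ f w q t)
    (he : w (Real.log ‖x‖ + h) = u x) :
    ¬ IsLocalMin (fun y => w (Real.log ‖y‖ + h) - u y) x := by
  intro hmin
  have hx0 : x ≠ 0 := norm_pos_iff.1 (by linarith)
  have := laplacian_le_radial_of_isLocalMin hu.smooth hx0 (hw.mono fun t ht => ht.1)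
    hw.self_of_nhds.hasDerivAt_deriv hmin
  rw [hu.eq x hx, sub_add_cancel, he, mul_div_right_comm, IsRadialSol.weight_eq hx0,
    mul_assoc] at this
  have hp : 0 < ‖x‖ ^ (-(γ + 2)) * f (u x) :=
    mul_pos (Real.rpow_pos_of_pos (by linarith) _) (hf _ (hu.pos x))
  have h1 : Real.exp (-(γ * h)) < 1 := Real.exp_lt_one_iff.2 (by nlinarith)
  nlinarith

lemma IsLargeSol.exists_lt (hu : IsLargeSol γ f u) (K : ℝ) :
    ∃ T : ℝ, ∀ x, Real.exp T ≤ ‖x‖ → K < u x := by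
  have := hu.lim.eventually_gt_atTop K
  rw [← Metric.cobounded_eq_cocompact, ← comap_norm_atTop, eventually_comap] at this
  obtain ⟨R, hR⟩ := eventually_atTop.1 this
  refine ⟨Real.log (max R 1), fun x hx => hR ‖x‖ ?_ x rfl⟩
  rw [Real.exp_log (by positivity)] at hx
  exact (le_max_left _ _).trans hx

lemma isCompact_shell (T N : ℝ) :
    IsCompact {y : EuclideanSpace ℝ (Fin D) | Real.exp T ≤ ‖y‖ ∧ ‖y‖ ≤ Real.exp N} := by
  refine (isCompact_closedBall (0 : EuclideanSpace ℝ (Fin D)) (Real.exp N)).of_isClosed_subset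
    ((isClosed_le continuous_const continuous_norm).inter
      (isClosed_le continuous_norm continuous_const)) fun y hy => ?_
  simpa using hy.2

lemma log_norm_mem_Icc {T N : ℝ} {y : EuclideanSpace ℝ (Fin D)}
    (hy : Real.exp T ≤ ‖y‖ ∧ ‖y‖ ≤ Real.exp N) : Real.log ‖y‖ ∈ Icc T N := by
  have h0 : 0 < ‖y‖ := (Real.exp_pos T).trans_le hy.1
  exact ⟨(Real.le_log_iff_exp_le h0).2 hy.1, (Real.log_le_iff_le_exp h0).2 hy.2⟩

lemma continuousOn_comp_log_norm {T N : ℝ} (hw : ContinuousOn w (Icc T N)) :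
    ContinuousOn (fun y : EuclideanSpace ℝ (Fin D) => w (Real.log ‖y‖))
      {y | Real.exp T ≤ ‖y‖ ∧ ‖y‖ ≤ Real.exp N} := by
  refine hw.comp (ContinuousOn.log continuous_norm.continuousOn fun y hy => ?_)
    fun y hy => log_norm_mem_Icc hy
  exact ((Real.exp_pos T).trans_le hy.1).ne'

lemma log_norm_exp_smul (h : ℝ) (hx : x ≠ 0) :
    Real.log ‖Real.exp h • x‖ = Real.log ‖x‖ + h := by
  rw [norm_smul, Real.norm_eq_abs, Real.abs_exp, Real.log_mul (Real.exp_pos h).ne'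
    (norm_pos_iff.2 hx).ne', Real.log_exp, add_comm]

lemma exp_le_norm_iff (T : ℝ) (hx : x ≠ 0) : Real.exp T ≤ ‖x‖ ↔ T ≤ Real.log ‖x‖ :=
  (Real.le_log_iff_exp_le (norm_pos_iff.2 hx)).symm

lemma norm_le_exp_iff (T : ℝ) (hx : x ≠ 0) : ‖x‖ ≤ Real.exp T ↔ Real.log ‖x‖ ≤ T :=
  (Real.log_le_iff_le_exp (norm_pos_iff.2 hx)).symm

lemma eventually_log_norm_add_mem (hx : x ≠ 0) {h a b : ℝ} (hm : Real.log ‖x‖ + h ∈ Ioo a b) :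
    ∀ᶠ y in 𝓝 x, y ≠ 0 ∧ Real.log ‖y‖ + h ∈ Ioo a b := by
  have hc : ContinuousAt (fun y : EuclideanSpace ℝ (Fin D) => Real.log ‖y‖ + h) x :=
    (continuous_norm.continuousAt.log (norm_pos_iff.2 hx).ne').add continuousAt_const
  exact (continuousAt_id.eventually_ne hx).and (hc.eventually (isOpen_Ioo.mem_nhds hm))

/-- Sliding comparison with a radial solution lying below `u` on the boundary of a shell. -/
lemma IsLargeSol.radial_le (hu : IsLargeSol γ f u) (hγ : 0 < γ) (hf : ∀ t, 0 < t → 0 < f t)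
    {T N : ℝ} (hT0 : 0 ≤ T) (hTN : T ≤ N) (hwc : ContinuousOn w (Icc T N))
    (hw : ∀ t ∈ Ioo T N, IsRadialSol ((D : ℝ) - 2) γ f w q t)
    (hT : ∀ x, Real.exp T ≤ ‖x‖ → w T < u x) (hN : ∀ x, Real.exp N ≤ ‖x‖ → w N < u x)
    {x₀ : EuclideanSpace ℝ (Fin D)} (hx₀ : Real.log ‖x₀‖ ∈ Icc T N) (hx₀' : x₀ ≠ 0) :
    w (Real.log ‖x₀‖) ≤ u x₀ := by
  by_contra! hlt
  set S := {y : EuclideanSpace ℝ (Fin D) | Real.exp T ≤ ‖y‖ ∧ ‖y‖ ≤ Real.exp N} with hS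
  have hSne : ∀ y ∈ S, y ≠ 0 := fun y hy => norm_pos_iff.1 ((Real.exp_pos T).trans_le hy.1)
  have hSmem : ∀ y, y ≠ 0 → Real.log ‖y‖ ∈ Icc T N → y ∈ S := fun y hy h =>
    ⟨(exp_le_norm_iff T hy).2 h.1, (norm_le_exp_iff N hy).2 h.2⟩
  obtain ⟨tm, -, htm⟩ := isCompact_Icc.exists_isMaxOn (nonempty_Icc.2 hTN) hwc
  obtain ⟨T', hT'⟩ := hu.exists_lt (w tm)
  set H := max (T' - T) 1 with hH
  have hH0 : 0 < H := lt_of_lt_of_le one_pos (le_max_right _ _)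
  have hucont : Continuous u := hu.smooth.continuous
  have hFc : ContinuousOn (fun p : ℝ × EuclideanSpace ℝ (Fin D) =>
      u (Real.exp p.1 • p.2) - w (Real.log ‖p.2‖)) (Icc 0 H ×ˢ S) := by
    refine ContinuousOn.sub (Continuous.continuousOn (by fun_prop)) ?_
    exact (continuousOn_comp_log_norm hwc).comp continuousOn_snd fun p hp => hp.2
  set C := (Icc (0 : ℝ) H ×ˢ S) ∩ (fun p : ℝ × EuclideanSpace ℝ (Fin D) =>
      u (Real.exp p.1 • p.2) - w (Real.log ‖p.2‖)) ⁻¹' (Iic 0) with hC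
  have hcpt : IsCompact (Icc (0 : ℝ) H ×ˢ S) := isCompact_Icc.prod (isCompact_shell T N)
  have hCc : IsCompact C := hcpt.of_isClosed_subset
    (hFc.preimage_isClosed_of_isClosed hcpt.isClosed isClosed_Iic) inter_subset_left
  have hinc : ∀ h y, 0 ≤ h → h < H → y ∈ S → u (Real.exp h • y) < w (Real.log ‖y‖) →
      ∃ h', h < h' ∧ (h', y) ∈ C := by
    intro h y h0 h1 hy hlt
    have hc : ContinuousAt (fun s : ℝ => u (Real.exp s • y)) h :=
      Continuous.continuousAt (by fun_prop)
    have he : ∀ᶠ s in 𝓝[>] h, u (Real.exp s • y) < w (Real.log ‖y‖) :=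
      (hc.eventually_lt_const hlt).filter_mono nhdsWithin_le_nhds
    obtain ⟨s, hs1, hs2, hs3⟩ := (he.and (Ioo_mem_nhdsGT h1)).exists
    exact ⟨s, hs2, ⟨⟨(h0.trans_lt hs2).le, hs3.le⟩, hy⟩, sub_nonpos.2 hs1.le⟩
  obtain ⟨h₁, hh₁, hC₁⟩ := hinc 0 x₀ le_rfl hH0 (hSmem _ hx₀' hx₀) (by simpa using hlt)
  obtain ⟨⟨h, y⟩, hyC, hmax⟩ := hCc.exists_isMaxOn ⟨_, hC₁⟩ continuousOn_fst
  have hh0 : 0 < h := hh₁.trans_le (hmax hC₁)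
  obtain ⟨⟨⟨-, hhH⟩, hyS⟩, hle⟩ := hyC
  have hle' : u (Real.exp h • y) ≤ w (Real.log ‖y‖) := sub_nonpos.1 hle
  simp only at hhH hyS
  have hy0 := hSne y hyS
  have hyI := log_norm_mem_Icc hyS
  have hsm0 : ∀ s : ℝ, Real.exp s • y ≠ 0 := fun s => smul_ne_zero (Real.exp_pos s).ne' hy0
  have hhH' : h < H := by
    refine lt_of_le_of_ne hhH fun e => ?_
    have := hT' (Real.exp h • y) ((exp_le_norm_iff _ (hsm0 h)).2 (by
      rw [log_norm_exp_smul h hy0, e]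
      linarith [hyI.1, le_max_left (T' - T) 1]))
    exact absurd (this.trans_le hle') (not_lt.2 (htm hyI))
  have hyT : T < Real.log ‖y‖ := by
    refine lt_of_le_of_ne hyI.1 fun e => ?_
    have := hT (Real.exp h • y) ((exp_le_norm_iff _ (hsm0 h)).2 (by
      rw [log_norm_exp_smul h hy0]; linarith))
    rw [e] at this; linarith
  have hyN : Real.log ‖y‖ < N := by
    refine lt_of_le_of_ne hyI.2 fun e => ?_
    have := hN (Real.exp h • y) ((exp_le_norm_iff _ (hsm0 h)).2 (by
      rw [log_norm_exp_smul h hy0]; linarith))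
    rw [← e] at this; linarith
  set x := Real.exp h • y with hx
  have hx0 : x ≠ 0 := hsm0 h
  have hlx : Real.log ‖x‖ + -h = Real.log ‖y‖ := by rw [hx, log_norm_exp_smul h hy0]; ring
  have hnear : ∀ᶠ z in 𝓝 x, w (Real.log ‖z‖ + -h) - u z ≤ 0 := by
    filter_upwards [eventually_log_norm_add_mem hx0 (h := -h) (a := T) (b := N)
      (by rw [hlx]; exact ⟨hyT, hyN⟩)] with z ⟨hz0, hz⟩
    by_contra! hpos
    have hz' : Real.exp (-h) • z ≠ 0 := smul_ne_zero (Real.exp_pos _).ne' hz0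
    obtain ⟨h', hh', hm⟩ := hinc h (Real.exp (-h) • z) hh0.le hhH'
      (hSmem _ hz' (by rw [log_norm_exp_smul _ hz0]; exact Ioo_subset_Icc_self hz)) (by
        rw [smul_smul, ← Real.exp_add, log_norm_exp_smul _ hz0]; simp; linarith)
    exact absurd (hmax hm) (not_le.2 hh')
  have hxe : w (Real.log ‖x‖ + -h) = u x := by
    have := hnear.self_of_nhds
    rw [hlx] at this ⊢; linarith
  refine hu.not_isLocalMax (q := q) hγ hf (x := x) ?_ (neg_lt_zero.2 hh0) ?_ hxe ?_
  · rw [← Real.exp_zero, exp_le_norm_iff _ hx0]; linarith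
  · rw [hlx]
    exact (isOpen_Ioo.mem_nhds ⟨hyT, hyN⟩ : Ioo T N ∈ 𝓝 (Real.log ‖y‖)) |> fun h =>
      Filter.mem_of_superset h hw
  · filter_upwards [hnear] with z hz
    rw [hxe, sub_self]; exact hz

/-- Sliding comparison with a radial solution lying above `u` on the boundary of a shell. -/
lemma IsLargeSol.le_radial (hu : IsLargeSol γ f u) (hγ : 0 < γ) (hf : ∀ t, 0 < t → 0 < f t)
    {T N : ℝ} (hT0 : 0 ≤ T) (hwc : ContinuousOn w (Icc T N))
    (hw : ∀ t ∈ Ioo T N, IsRadialSol ((D : ℝ) - 2) γ f w q t)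
    (hlow : ∀ t ∈ Ioc T N, w T < w t)
    (hT : ∀ x, ‖x‖ ≤ Real.exp T → u x ≤ w T) (hN : ∀ x, ‖x‖ ≤ Real.exp N → u x < w N)
    {x₀ : EuclideanSpace ℝ (Fin D)} (hx₀ : Real.log ‖x₀‖ ∈ Icc T N) (hx₀' : x₀ ≠ 0) :
    u x₀ ≤ w (Real.log ‖x₀‖) := by
  by_contra! hlt
  set S := {y : EuclideanSpace ℝ (Fin D) | Real.exp T ≤ ‖y‖ ∧ ‖y‖ ≤ Real.exp N} with hS
  have hSne : ∀ y ∈ S, y ≠ 0 := fun y hy => norm_pos_iff.1 ((Real.exp_pos T).trans_le hy.1)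
  have hSmem : ∀ y, y ≠ 0 → Real.log ‖y‖ ∈ Icc T N → y ∈ S := fun y hy h =>
    ⟨(exp_le_norm_iff T hy).2 h.1, (norm_le_exp_iff N hy).2 h.2⟩
  have hucont : Continuous u := hu.smooth.continuous
  have hFc : ContinuousOn (fun p : ℝ × EuclideanSpace ℝ (Fin D) =>
      u (Real.exp (-p.1) • p.2) - w (Real.log ‖p.2‖)) (Icc 0 (N - T) ×ˢ S) := by
    refine ContinuousOn.sub (Continuous.continuousOn (by fun_prop)) ?_
    exact (continuousOn_comp_log_norm hwc).comp continuousOn_snd fun p hp => hp.2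
  set C := ((Icc (0 : ℝ) (N - T) ×ˢ S) ∩ (fun p : ℝ × EuclideanSpace ℝ (Fin D) =>
      u (Real.exp (-p.1) • p.2) - w (Real.log ‖p.2‖)) ⁻¹' (Ici 0)) ∩
      {p | Real.exp T ≤ ‖Real.exp (-p.1) • p.2‖} with hC
  have hcpt : IsCompact (Icc (0 : ℝ) (N - T) ×ˢ S) := isCompact_Icc.prod (isCompact_shell T N)
  have hCc : IsCompact C := hcpt.of_isClosed_subset
    ((hFc.preimage_isClosed_of_isClosed hcpt.isClosed isClosed_Ici).inter
      (isClosed_le continuous_const (by fun_prop))) (inter_subset_left.trans inter_subset_left)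
  have hinc : ∀ h y, 0 ≤ h → y ∈ S → T < Real.log ‖y‖ - h →
      w (Real.log ‖y‖) < u (Real.exp (-h) • y) → ∃ h', h < h' ∧ (h', y) ∈ C := by
    intro h y h0 hy h1 hlt
    have hc : ContinuousAt (fun s : ℝ => u (Real.exp (-s) • y)) h :=
      Continuous.continuousAt (by fun_prop)
    have he : ∀ᶠ s in 𝓝[>] h, w (Real.log ‖y‖) < u (Real.exp (-s) • y) :=
      (hc.eventually_const_lt hlt).filter_mono nhdsWithin_le_nhds
    obtain ⟨s, hs1, hs2, hs3⟩ := (he.and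
      (Ioo_mem_nhdsGT (show h < Real.log ‖y‖ - T by linarith))).exists
    have hyI := log_norm_mem_Icc hy
    refine ⟨s, hs2, ⟨⟨⟨(h0.trans_lt hs2).le, by linarith [hyI.2]⟩, hy⟩, sub_nonneg.2 hs1.le⟩, ?_⟩
    change Real.exp T ≤ ‖Real.exp (-s) • y‖
    rw [exp_le_norm_iff _ (smul_ne_zero (Real.exp_pos _).ne' (hSne y hy)),
      log_norm_exp_smul _ (hSne y hy)]
    linarith
  have hx₀T : T < Real.log ‖x₀‖ := by
    refine lt_of_le_of_ne hx₀.1 fun e => ?_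
    have := hT x₀ ((norm_le_exp_iff _ hx₀').2 e.ge)
    rw [e] at this; linarith
  obtain ⟨h₁, hh₁, hC₁⟩ := hinc 0 x₀ le_rfl (hSmem _ hx₀' hx₀) (by simpa using hx₀T)
    (by simpa using hlt)
  obtain ⟨⟨h, y⟩, hyC, hmax⟩ := hCc.exists_isMaxOn ⟨_, hC₁⟩ continuousOn_fst
  have hh0 : 0 < h := hh₁.trans_le (hmax hC₁)
  obtain ⟨⟨⟨-, hyS⟩, hle⟩, hyh⟩ := hyC
  have hle' : w (Real.log ‖y‖) ≤ u (Real.exp (-h) • y) := sub_nonneg.1 hle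
  simp only [mem_ofPred_eq] at hyS hyh
  have hy0 := hSne y hyS
  have hyI := log_norm_mem_Icc hyS
  have hsm0 : ∀ s : ℝ, Real.exp s • y ≠ 0 := fun s => smul_ne_zero (Real.exp_pos s).ne' hy0
  rw [exp_le_norm_iff _ (hsm0 _), log_norm_exp_smul _ hy0] at hyh
  have hyT : T < Real.log ‖y‖ := by linarith
  have hyh' : T < Real.log ‖y‖ - h := by
    refine lt_of_le_of_ne (by linarith) fun e => ?_
    have h1 := hT (Real.exp (-h) • y) ((norm_le_exp_iff _ (hsm0 _)).2 (by
      rw [log_norm_exp_smul _ hy0]; linarith))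
    linarith [hlow _ ⟨hyT, hyI.2⟩]
  have hyN : Real.log ‖y‖ < N := by
    refine lt_of_le_of_ne hyI.2 fun e => ?_
    have := hN (Real.exp (-h) • y) ((norm_le_exp_iff _ (hsm0 _)).2 (by
      rw [log_norm_exp_smul _ hy0]; linarith))
    rw [← e] at this; linarith
  set x := Real.exp (-h) • y with hx
  have hx0 : x ≠ 0 := hsm0 _
  have hlx : Real.log ‖x‖ + h = Real.log ‖y‖ := by rw [hx, log_norm_exp_smul _ hy0]; ring
  have hnear : ∀ᶠ z in 𝓝 x, 0 ≤ w (Real.log ‖z‖ + h) - u z := by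
    filter_upwards [eventually_log_norm_add_mem hx0 (h := h) (a := T + h) (b := N)
      (by rw [hlx]; exact ⟨by linarith, hyN⟩)] with z ⟨hz0, hz⟩
    by_contra! hpos
    have hz' : Real.exp h • z ≠ 0 := smul_ne_zero (Real.exp_pos _).ne' hz0
    obtain ⟨h', hh', hm⟩ := hinc h (Real.exp h • z) hh0.le
      (hSmem _ hz' (by rw [log_norm_exp_smul _ hz0]; exact ⟨by linarith [hz.1], hz.2.le⟩))
      (by rw [log_norm_exp_smul _ hz0]; linarith [hz.1]) (by
        rw [smul_smul, ← Real.exp_add, log_norm_exp_smul _ hz0]; simp; linarith)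
    exact absurd (hmax hm) (not_le.2 hh')
  have hxe : w (Real.log ‖x‖ + h) = u x := by
    have := hnear.self_of_nhds
    rw [hlx] at this ⊢; linarith
  refine hu.not_isLocalMin (q := q) hγ hf (x := x) ?_ hh0 ?_ hxe ?_
  · rw [← Real.exp_zero, exp_le_norm_iff _ hx0]; linarith
  · rw [hlx]
    exact Filter.mem_of_superset (isOpen_Ioo.mem_nhds ⟨hyT, hyN⟩) hw
  · filter_upwards [hnear] with z hz
    rw [hxe, sub_self]; exact hz

/-- The three spheres inequality for subharmonic functions on the shell `1 ≤ ‖x‖ ≤ exp t₁`. -/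
lemma le_harmonic_of_laplacian_pos (hD : 3 ≤ D) (hu : ContDiff ℝ 2 u)
    (hpos : ∀ x, 0 < laplacian u x) {t₁ m₀ m₁ : ℝ} (ht₁ : 0 < t₁)
    (h0 : ∀ x, ‖x‖ = 1 → u x ≤ m₀) (h1 : ∀ x, ‖x‖ = Real.exp t₁ → u x ≤ m₁)
    {x₀ : EuclideanSpace ℝ (Fin D)} (hx₀ : Real.log ‖x₀‖ ∈ Icc 0 t₁) (hx₀' : x₀ ≠ 0) :
    u x₀ ≤ m₀ + (m₁ - m₀) * (1 - Real.exp (-(((D : ℝ) - 2) * Real.log ‖x₀‖)))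
      / (1 - Real.exp (-(((D : ℝ) - 2) * t₁))) := by
  set a : ℝ := (D : ℝ) - 2 with ha
  have ha0 : 0 < a := by
    have : (3 : ℝ) ≤ D := by exact_mod_cast hD
    linarith
  have hden : 0 < 1 - Real.exp (-(a * t₁)) := by
    have : Real.exp (-(a * t₁)) < 1 := Real.exp_lt_one_iff.2 (by nlinarith)
    linarith
  set c := (m₁ - m₀) / (1 - Real.exp (-(a * t₁))) with hc
  set W : ℝ → ℝ := fun t => m₀ + c * (1 - Real.exp (-(a * t))) with hW
  suffices h : u x₀ ≤ W (Real.log ‖x₀‖) by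
    refine h.trans (le_of_eq ?_)
    simp only [hW, hc]; ring
  have hexp : ∀ t, HasDerivAt (fun s => Real.exp (-(a * s))) (Real.exp (-(a * t)) * (-a)) t := by
    intro t
    simpa using (((hasDerivAt_id t).const_mul a).neg).exp
  have hW1 : ∀ t, HasDerivAt W (c * a * Real.exp (-(a * t))) t := fun t =>
    (((hexp t).const_sub 1).const_mul c |>.const_add m₀).congr_deriv (by ring)
  have hWc : Continuous W := by fun_prop
  have hW2 : ∀ t, HasDerivAt (fun s => c * a * Real.exp (-(a * s)))
      (c * a * (Real.exp (-(a * t)) * (-a))) t := fun t => (hexp t).const_mul _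
  by_contra! hlt
  have hS : x₀ ∈ {y : EuclideanSpace ℝ (Fin D) | Real.exp 0 ≤ ‖y‖ ∧ ‖y‖ ≤ Real.exp t₁} :=
    ⟨(exp_le_norm_iff _ hx₀').2 hx₀.1, (norm_le_exp_iff _ hx₀').2 hx₀.2⟩
  obtain ⟨x, hxS, hmax⟩ := (isCompact_shell (D := D) 0 t₁).exists_isMinOn ⟨x₀, hS⟩
    ((continuousOn_comp_log_norm (hWc.continuousOn (s := Icc 0 t₁))).sub
      hu.continuous.continuousOn)
  have hx0 : x ≠ 0 := norm_pos_iff.1 ((Real.exp_pos 0).trans_le hxS.1)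
  have hxI := log_norm_mem_Icc hxS
  have hneg : W (Real.log ‖x‖) < u x := by
    have : W (Real.log ‖x‖) - u x ≤ W (Real.log ‖x₀‖) - u x₀ := hmax hS
    linarith
  have hn : ‖x‖ = Real.exp (Real.log ‖x‖) := (Real.exp_log (norm_pos_iff.2 hx0)).symm
  have hxlt : 0 < Real.log ‖x‖ := by
    refine lt_of_le_of_ne hxI.1 fun e => ?_
    rw [← e] at hneg hn
    have := h0 x (by simpa using hn)
    simp [hW] at hneg
    linarith
  have hxlt' : Real.log ‖x‖ < t₁ := by
    refine lt_of_le_of_ne hxI.2 fun e => ?_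
    rw [e] at hneg hn
    have := h1 x hn
    have e2 : W t₁ = m₁ := by simp only [hW, hc]; field_simp; ring
    linarith
  have := laplacian_le_radial_of_isLocalMin (x := x) (h := 0) (W := W) hu hx0
    (Eventually.of_forall hW1) (hW2 _) ?_
  · have e : c * a * (Real.exp (-(a * (Real.log ‖x‖ + 0))) * (-a)) +
      ((D : ℝ) - 2) * (c * a * Real.exp (-(a * (Real.log ‖x‖ + 0)))) = 0 := by rw [← ha]; ring
    rw [e, zero_div] at this
    exact absurd (hpos x) (not_lt.2 this)
  · filter_upwards [eventually_log_norm_add_mem hx0 (h := 0) (a := 0) (b := t₁)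
      (by rw [add_zero]; exact ⟨hxlt, hxlt'⟩)] with z ⟨hz0, hz⟩
    rw [add_zero] at hz
    rw [add_zero, add_zero]
    exact hmax (a := z) ⟨(exp_le_norm_iff _ hz0).2 hz.1.le, (norm_le_exp_iff _ hz0).2 hz.2.le⟩

end Sliding

lemma monotoneOn_of_hasDerivAt_nonneg {S : Set ℝ} (hS : Convex ℝ S) {g g' : ℝ → ℝ}
    (h : ∀ t ∈ S, HasDerivAt g (g' t) t) (h0 : ∀ t ∈ S, 0 ≤ g' t) : MonotoneOn g S := by
  refine monotoneOn_of_deriv_nonneg hS (fun t ht => (h t ht).continuousAt.continuousWithinAt)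
    (fun t ht => (h t (interior_subset ht)).differentiableAt.differentiableWithinAt) fun t ht => ?_
  rw [(h t (interior_subset ht)).deriv]
  exact h0 t (interior_subset ht)

lemma strictMonoOn_of_hasDerivAt_pos {S : Set ℝ} (hS : Convex ℝ S) {g g' : ℝ → ℝ}
    (h : ∀ t ∈ S, HasDerivAt g (g' t) t) (h0 : ∀ t ∈ interior S, 0 < g' t) :
    StrictMonoOn g S := by
  refine strictMonoOn_of_deriv_pos hS (fun t ht => (h t ht).continuousAt.continuousWithinAt)
    fun t ht => ?_
  rw [(h t (interior_subset ht)).deriv]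
  exact h0 t ht

/-- A positive radial solution on the half line `[T, ∞)` which is nondecreasing at `T`. -/
structure IsGlobalRadialSol (a γ : ℝ) (f w q : ℝ → ℝ) (T : ℝ) : Prop where
  sol : ∀ t, T ≤ t → IsRadialSol a γ f w q t
  pos : ∀ t, T ≤ t → 0 < w t
  nonneg : 0 ≤ q T

section Comparison

variable {a γ : ℝ} {f w q : ℝ → ℝ} {T : ℝ}

namespace IsGlobalRadialSol

lemma strictMonoOn_q (h : IsGlobalRadialSol a γ f w q T) (hf : ∀ t, 0 < t → 0 < f t) :
    StrictMonoOn q (Ici T) :=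
  strictMonoOn_of_hasDerivAt_pos (convex_Ici T) (fun t ht => (h.sol t ht).2) fun t ht =>
    mul_pos (Real.exp_pos _) (hf _ (h.pos t (interior_subset ht)))

lemma q_pos (h : IsGlobalRadialSol a γ f w q T) (hf : ∀ t, 0 < t → 0 < f t) {t : ℝ}
    (ht : T < t) : 0 < q t :=
  h.nonneg.trans_lt (h.strictMonoOn_q hf self_mem_Ici ht.le ht)

lemma q_nonneg (h : IsGlobalRadialSol a γ f w q T) (hf : ∀ t, 0 < t → 0 < f t) {t : ℝ}
    (ht : T ≤ t) : 0 ≤ q t :=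
  h.nonneg.trans ((h.strictMonoOn_q hf).monotoneOn self_mem_Ici ht ht)

lemma strictMonoOn_w (h : IsGlobalRadialSol a γ f w q T) (hf : ∀ t, 0 < t → 0 < f t) :
    StrictMonoOn w (Ici T) := by
  refine strictMonoOn_of_hasDerivAt_pos (convex_Ici T) (fun t ht => (h.sol t ht).1) fun t ht => ?_
  rw [interior_Ici] at ht
  exact mul_pos (Real.exp_pos _) (h.q_pos hf ht)

lemma continuousOn_w (h : IsGlobalRadialSol a γ f w q T) : ContinuousOn w (Ici T) :=
  fun t ht => (h.sol t ht).1.continuousAt.continuousWithinAt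

lemma mono (h : IsGlobalRadialSol a γ f w q T) (hf : ∀ t, 0 < t → 0 < f t) {T' : ℝ}
    (hT : T ≤ T') : IsGlobalRadialSol a γ f w q T' :=
  ⟨fun t ht => h.sol t (hT.trans ht), fun t ht => h.pos t (hT.trans ht), h.q_nonneg hf hT⟩

lemma tendsto_q (h : IsGlobalRadialSol a γ f w q T) (hf : ∀ t, 0 < t → 0 < f t) (ha : 0 < a)
    (hw : Tendsto w atTop atTop) (B : ℝ) : ∃ t₀, ∀ t, t₀ ≤ t → B ≤ q t := by
  by_contra! hB
  have hB' : ∀ t, T ≤ t → q t ≤ B := by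
    intro t ht
    obtain ⟨s, hs, hs'⟩ := hB t
    exact ((h.strictMonoOn_q hf).monotoneOn ht (ht.trans hs) hs).trans hs'.le
  have hexp : ∀ t, HasDerivAt (fun s => Real.exp (-(a * s))) (Real.exp (-(a * t)) * (-a)) t := by
    intro t
    simpa using (((hasDerivAt_id t).const_mul a).neg).exp
  have hm := monotoneOn_of_hasDerivAt_nonneg (convex_Ici T)
    (g := fun t => -(w t + B / a * Real.exp (-(a * t))))
    (g' := fun t => Real.exp (-(a * t)) * (B - q t))
    (fun t ht => ((h.sol t ht).1.add ((hexp t).const_mul (B / a))).neg.congr_deriv (by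
      field_simp; ring))
    (fun t ht => mul_nonneg (Real.exp_pos _).le (sub_nonneg.2 (hB' t ht)))
  have hBn : 0 ≤ B := (h.q_nonneg hf le_rfl).trans (hB' T le_rfl)
  obtain ⟨t, ht, htT⟩ := ((hw.eventually_gt_atTop (w T + B / a * Real.exp (-(a * T)))).and
    (eventually_ge_atTop T)).exists
  have h1 := hm self_mem_Ici (show t ∈ Ici T from htT) htT
  have h2 : 0 ≤ B / a * Real.exp (-(a * t)) := by positivity
  simp only at h1
  linarith

end IsGlobalRadialSol

/-- `φ` is the time change with `w₁ (φ t) = w₂ t` for `t ≥ t₀`. -/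
structure IsTimeChange (a γ : ℝ) (f w₁ q₁ : ℝ → ℝ) (T₁ : ℝ) (w₂ q₂ : ℝ → ℝ) (T₂ : ℝ)
    (φ : ℝ → ℝ) (t₀ : ℝ) : Prop where
  sol₁ : IsGlobalRadialSol a γ f w₁ q₁ T₁
  sol₂ : IsGlobalRadialSol a γ f w₂ q₂ T₂
  le : T₂ ≤ t₀
  lt : ∀ t, t₀ ≤ t → T₁ < φ t
  eq : ∀ t, t₀ ≤ t → w₁ (φ t) = w₂ t
  deriv : ∀ t, t₀ ≤ t → HasDerivAt φ (Real.exp (a * (φ t - t)) * q₂ t / q₁ (φ t)) t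

variable {w₁ q₁ w₂ q₂ φ : ℝ → ℝ} {T₁ T₂ t₀ : ℝ}

lemma IsGlobalRadialSol.exists_isTimeChange (hf : ∀ t, 0 < t → 0 < f t)
    (h₁ : IsGlobalRadialSol a γ f w₁ q₁ T₁) (hw₁ : Tendsto w₁ atTop atTop)
    (h₂ : IsGlobalRadialSol a γ f w₂ q₂ T₂) (hT : T₂ ≤ t₀) (hlt : w₁ T₁ < w₂ t₀) :
    ∃ φ, IsTimeChange a γ f w₁ q₁ T₁ w₂ q₂ T₂ φ t₀ := by
  have hex : ∀ y, ∃ s, w₁ T₁ ≤ y → T₁ ≤ s ∧ w₁ s = y := by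
    intro y
    by_cases hy : w₁ T₁ ≤ y
    · obtain ⟨N, hN, hNT⟩ := ((hw₁.eventually_ge_atTop y).and (eventually_ge_atTop T₁)).exists
      obtain ⟨s, hs, hsy⟩ := intermediate_value_Icc hNT
        (h₁.continuousOn_w.mono Icc_subset_Ici_self) ⟨hy, hN⟩
      exact ⟨s, fun _ => ⟨hs.1, hsy⟩⟩
    · exact ⟨0, fun h => absurd h hy⟩
  choose ψ hψ using hex
  have hsm := h₁.strictMonoOn_w hf
  have hψmono : StrictMonoOn ψ (Ici (w₁ T₁)) := by
    intro y hy z hz hyz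
    have := hψ y hy
    have := hψ z hz
    by_contra! hle
    have := hsm.monotoneOn (hψ z hz).1 (hψ y hy).1 hle
    rw [(hψ z hz).2, (hψ y hy).2] at this
    linarith
  have hψlt : ∀ y, w₁ T₁ < y → T₁ < ψ y := by
    intro y hy
    refine lt_of_le_of_ne (hψ y hy.le).1 fun e => ?_
    have := (hψ y hy.le).2
    rw [← e] at this; linarith
  have hψimg : ∀ s, T₁ ≤ s → ψ (w₁ s) = s := by
    intro s hs
    have := hψ (w₁ s) (hsm.monotoneOn self_mem_Ici hs hs)
    exact hsm.injOn this.1 hs this.2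
  have hψd : ∀ y, w₁ T₁ < y →
      HasDerivAt ψ (Real.exp (-(a * ψ y)) * q₁ (ψ y))⁻¹ y := by
    intro y hy
    have hc : ContinuousAt ψ y := by
      refine hψmono.continuousAt_of_image_mem_nhds (Ici_mem_nhds hy) ?_
      refine mem_of_superset (Ici_mem_nhds (hψlt y hy)) fun s hs => ?_
      exact ⟨w₁ s, hsm.monotoneOn self_mem_Ici hs hs, hψimg s hs⟩
    refine HasDerivAt.of_local_left_inverse hc (h₁.sol _ (hψ y hy.le).1).1
      (mul_pos (Real.exp_pos _) (h₁.q_pos hf (hψlt y hy))).ne' ?_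
    filter_upwards [Ici_mem_nhds hy] with z hz using (hψ z hz).2
  have hlt' : ∀ t, t₀ ≤ t → w₁ T₁ < w₂ t := fun t ht =>
    hlt.trans_le ((h₂.strictMonoOn_w hf).monotoneOn hT (hT.trans ht) ht)
  refine ⟨fun t => ψ (w₂ t), h₁, h₂, hT, fun t ht => hψlt _ (hlt' t ht),
    fun t ht => (hψ _ (hlt' t ht).le).2, fun t ht => ?_⟩
  refine ((hψd _ (hlt' t ht)).comp t (h₂.sol t (hT.trans ht)).1).congr_deriv ?_
  have e : Real.exp (a * (ψ (w₂ t) - t)) = Real.exp (-(a * t)) * (Real.exp (-(a * ψ (w₂ t))))⁻¹ := by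
    rw [← Real.exp_neg, ← Real.exp_add]; congr 1; ring
  rw [e, mul_inv]; ring

namespace IsTimeChange

lemma mono (H : IsTimeChange a γ f w₁ q₁ T₁ w₂ q₂ T₂ φ t₀) {t₁ : ℝ}
    (ht : t₀ ≤ t₁) : IsTimeChange a γ f w₁ q₁ T₁ w₂ q₂ T₂ φ t₁ :=
  ⟨H.sol₁, H.sol₂, H.le.trans ht, fun t h => H.lt t (ht.trans h), fun t h => H.eq t (ht.trans h),
    fun t h => H.deriv t (ht.trans h)⟩

end IsTimeChange
end Comparison

/-- The energy difference of two radial solutions, taken at equal heights. -/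
noncomputable def energyGap (a : ℝ) (q₁ q₂ φ : ℝ → ℝ) (t : ℝ) : ℝ :=
  Real.exp (a * φ t - 2 * a * t) * (q₂ t ^ 2 / 2) - Real.exp (-(a * φ t)) * (q₁ (φ t) ^ 2 / 2)

section Comparison

variable {a γ : ℝ} {f w₁ q₁ w₂ q₂ φ : ℝ → ℝ} {T₁ T₂ t₀ : ℝ}

lemma energyGap_eq (t : ℝ) : energyGap a q₁ q₂ φ t = Real.exp (-(a * φ t)) / 2 *
    ((Real.exp (a * (φ t - t)) * q₂ t) ^ 2 - q₁ (φ t) ^ 2) := by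
  have e : Real.exp (a * φ t - 2 * a * t)
      = Real.exp (-(a * φ t)) * Real.exp (a * (φ t - t)) ^ 2 := by
    rw [sq, ← Real.exp_add, ← Real.exp_add]; congr 1; ring
  rw [energyGap, e]; ring

namespace IsTimeChange

lemma q₁_pos (H : IsTimeChange a γ f w₁ q₁ T₁ w₂ q₂ T₂ φ t₀) (hf : ∀ t, 0 < t → 0 < f t)
    {t : ℝ} (ht : t₀ ≤ t) : 0 < q₁ (φ t) := H.sol₁.q_pos hf (H.lt t ht)

lemma q₂_nonneg (H : IsTimeChange a γ f w₁ q₁ T₁ w₂ q₂ T₂ φ t₀) (hf : ∀ t, 0 < t → 0 < f t)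
    {t : ℝ} (ht : t₀ ≤ t) : 0 ≤ q₂ t := H.sol₂.q_nonneg hf (H.le.trans ht)

lemma f_pos (H : IsTimeChange a γ f w₁ q₁ T₁ w₂ q₂ T₂ φ t₀) (hf : ∀ t, 0 < t → 0 < f t)
    {t : ℝ} (ht : t₀ ≤ t) : 0 < f (w₂ t) := hf _ (H.sol₂.pos t (H.le.trans ht))

lemma hasDerivAt_energyGap (H : IsTimeChange a γ f w₁ q₁ T₁ w₂ q₂ T₂ φ t₀)
    (hf : ∀ t, 0 < t → 0 < f t) {t : ℝ} (ht : t₀ ≤ t) :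
    HasDerivAt (energyGap a q₁ q₂ φ)
      (a * Real.exp (-(a * φ t)) * (Real.exp (a * (φ t - t)) * q₂ t / (2 * q₁ (φ t)))
        * (Real.exp (a * (φ t - t)) * q₂ t - q₁ (φ t)) ^ 2
      + q₂ t * f (w₂ t) * Real.exp (a * φ t - a * t - γ * t)
        * (1 - Real.exp (-(γ * (φ t - t))))) t := by
  have hq := (H.q₁_pos hf ht).ne'
  have hφ := H.deriv t ht
  have h1 := (((hφ.const_mul a).sub ((hasDerivAt_id t).const_mul (2 * a))).exp).mul
    (((H.sol₂.sol t (H.le.trans ht)).2.pow 2).div_const 2)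
  have h2 := (((hφ.const_mul a).neg).exp).mul
    ((((H.sol₁.sol _ (H.lt t ht).le).2.comp t hφ).pow 2).div_const 2)
  refine (h1.sub h2).congr_deriv ?_
  simp only [Pi.pow_apply, Pi.sub_apply, Pi.neg_apply, Function.comp, id]
  rw [H.eq t ht]
  have e1 : Real.exp (a * φ t - 2 * a * t)
      = Real.exp (-(a * φ t)) * Real.exp (a * (φ t - t)) ^ 2 := by
    rw [sq, ← Real.exp_add, ← Real.exp_add]; congr 1; ring
  have e2 : Real.exp ((a - γ) * t) * Real.exp (-(a * φ t)) * Real.exp (a * (φ t - t)) ^ 2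
      = Real.exp (a * φ t - a * t - γ * t) := by
    rw [sq, ← Real.exp_add, ← Real.exp_add, ← Real.exp_add]; congr 1; ring
  have e3 : Real.exp ((a - γ) * φ t) * Real.exp (-(a * φ t)) * Real.exp (a * (φ t - t))
      = Real.exp (a * φ t - a * t - γ * t) * Real.exp (-(γ * (φ t - t))) := by
    rw [← Real.exp_add, ← Real.exp_add, ← Real.exp_add]; congr 1; ring
  rw [mul_sub _ 1, mul_assoc (q₂ t * f (w₂ t)) _ (Real.exp (-(γ * (φ t - t)))), ← e3, ← e2, e1]
  field_simp
  ring

/-- Where the time change exceeds the identity the energy gap is nondecreasing. -/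
lemma monotoneOn_energyGap (H : IsTimeChange a γ f w₁ q₁ T₁ w₂ q₂ T₂ φ t₀) (ha : 0 < a)
    (hγ : 0 < γ) (hf : ∀ t, 0 < t → 0 < f t) {S : Set ℝ} (hS : Convex ℝ S)
    (hS₀ : ∀ t ∈ S, t₀ ≤ t ∧ t ≤ φ t) : MonotoneOn (energyGap a q₁ q₂ φ) S := by
  refine monotoneOn_of_hasDerivAt_nonneg hS
    (fun t ht => H.hasDerivAt_energyGap hf (hS₀ t ht).1) fun t ht => ?_
  have h1 := H.q₁_pos hf (hS₀ t ht).1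
  have h2 := H.q₂_nonneg hf (hS₀ t ht).1
  have h3 := H.f_pos hf (hS₀ t ht).1
  have h4 : 0 ≤ 1 - Real.exp (-(γ * (φ t - t))) := by
    rw [sub_nonneg, Real.exp_le_one_iff]
    have := (hS₀ t ht).2
    nlinarith
  positivity

lemma hasDerivAt_delay (H : IsTimeChange a γ f w₁ q₁ T₁ w₂ q₂ T₂ φ t₀)
    {t : ℝ} (ht : t₀ ≤ t) : HasDerivAt (fun s => φ s - s)
      (Real.exp (a * (φ t - t)) * q₂ t / q₁ (φ t) - 1) t :=
  (H.deriv t ht).sub (hasDerivAt_id t)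

lemma le_of_energyGap_nonneg (H : IsTimeChange a γ f w₁ q₁ T₁ w₂ q₂ T₂ φ t₀)
    (hf : ∀ t, 0 < t → 0 < f t) {t : ℝ} (ht : t₀ ≤ t) (hG : 0 ≤ energyGap a q₁ q₂ φ t) :
    q₁ (φ t) ≤ Real.exp (a * (φ t - t)) * q₂ t := by
  rw [energyGap_eq] at hG
  have h1 : 0 ≤ (Real.exp (a * (φ t - t)) * q₂ t) ^ 2 - q₁ (φ t) ^ 2 :=
    nonneg_of_mul_nonneg_right hG (by positivity)
  exact (pow_le_pow_iff_left₀ (H.q₁_pos hf ht).le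
    (mul_nonneg (Real.exp_pos _).le (H.q₂_nonneg hf ht)) two_ne_zero).1 (sub_nonneg.1 h1)

lemma monotoneOn_delay (H : IsTimeChange a γ f w₁ q₁ T₁ w₂ q₂ T₂ φ t₀)
    (hf : ∀ t, 0 < t → 0 < f t) {S : Set ℝ} (hS : Convex ℝ S)
    (hS₀ : ∀ t ∈ S, t₀ ≤ t ∧ 0 ≤ energyGap a q₁ q₂ φ t) :
    MonotoneOn (fun s => φ s - s) S := by
  refine monotoneOn_of_hasDerivAt_nonneg hS (fun t ht => H.hasDerivAt_delay (hS₀ t ht).1)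
    fun t ht => ?_
  rw [sub_nonneg, one_le_div (H.q₁_pos hf (hS₀ t ht).1)]
  exact H.le_of_energyGap_nonneg hf (hS₀ t ht).1 (hS₀ t ht).2

lemma delay_pos (H : IsTimeChange a γ f w₁ q₁ T₁ w₂ q₂ T₂ φ t₀) (ha : 0 < a)
    (hγ : 0 < γ) (hf : ∀ t, 0 < t → 0 < f t) (hd : t₀ < φ t₀)
    (hG : 0 ≤ energyGap a q₁ q₂ φ t₀) {t : ℝ} (ht : t₀ ≤ t) :
    (φ t₀ - t₀) / 2 < φ t - t := by
  by_contra! hle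
  have hcont : ContinuousOn (fun s => φ s - s) (Icc t₀ t) := fun s hs =>
    (H.hasDerivAt_delay hs.1).continuousAt.continuousWithinAt
  have hcl : IsCompact (Icc t₀ t ∩ (fun s => φ s - s) ⁻¹' Iic ((φ t₀ - t₀) / 2)) :=
    isCompact_Icc.of_isClosed_subset
      (hcont.preimage_isClosed_of_isClosed isClosed_Icc isClosed_Iic) inter_subset_left
  obtain ⟨τ, ⟨hτ, hτ'⟩, hleast⟩ := hcl.exists_isLeast ⟨t, right_mem_Icc.2 ht, hle⟩
  have hτ'' : φ τ - τ ≤ (φ t₀ - t₀) / 2 := hτ'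
  have hlt : ∀ s ∈ Ico t₀ τ, (φ t₀ - t₀) / 2 < φ s - s := fun s hs => by
    by_contra! hcon
    exact absurd (hleast ⟨⟨hs.1, hs.2.le.trans hτ.2⟩, hcon⟩) (not_le.2 hs.2)
  have hne : t₀ < τ := by
    refine lt_of_le_of_ne hτ.1 fun e => ?_
    rw [← e] at hτ''; linarith
  have hge : ∀ s ∈ Icc t₀ τ, (φ t₀ - t₀) / 2 ≤ φ s - s := by
    have : closure (Ico t₀ τ) ⊆ {s | s ∈ Icc t₀ τ → (φ t₀ - t₀) / 2 ≤ φ s - s} := by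
      intro s hs hs'
      rw [closure_Ico hne.ne] at hs
      have hcs : ContinuousAt (fun s => φ s - s) s := (H.hasDerivAt_delay hs.1).continuousAt
      have : s ∈ closure (Ico t₀ τ) := by rw [closure_Ico hne.ne]; exact hs
      have hnb : (𝓝[Ico t₀ τ] s).NeBot := mem_closure_iff_nhdsWithin_neBot.1 this
      exact ge_of_tendsto (hcs.tendsto.mono_left nhdsWithin_le_nhds)
        (eventually_mem_nhdsWithin.mono fun z hz => (hlt z hz).le)
    intro s hs
    exact this (by rw [closure_Ico hne.ne]; exact hs) hs
  have hGm := H.monotoneOn_energyGap ha hγ hf (convex_Icc t₀ τ)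
    fun s hs => ⟨hs.1, by linarith [hge s hs]⟩
  have hdm := H.monotoneOn_delay hf (convex_Icc t₀ τ) fun s hs =>
    ⟨hs.1, hG.trans (hGm (left_mem_Icc.2 hτ.1) hs hs.1)⟩
  have := hdm (left_mem_Icc.2 hτ.1) (right_mem_Icc.2 hτ.1) hτ.1
  simp only at this
  linarith

/-- The kinetic energy of the first solution at equal heights, bounded by the second one. -/
lemma kinetic_le (H : IsTimeChange a γ f w₁ q₁ T₁ w₂ q₂ T₂ φ t₀)
    (hf : ∀ t, 0 < t → 0 < f t) (hd : ∀ t, t₀ ≤ t → 0 ≤ φ t - t)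
    (hm : ∀ t, t₀ ≤ t → q₁ (φ t) ≤ Real.exp (a * (φ t - t)) * q₂ t) {k : ℝ} (hk : 0 ≤ k)
    (hk' : 2 * a - γ ≤ k) {t : ℝ} (ht : t₀ ≤ t) :
    q₁ (φ t) ^ 2 ≤ q₁ (φ t₀) ^ 2 + Real.exp (k * (φ t - t)) * q₂ t ^ 2 := by
  have hderiv : ∀ t, t₀ ≤ t → HasDerivAt
      (fun s => Real.exp (k * (φ s - s)) * (q₂ s ^ 2 - q₂ t₀ ^ 2) - q₁ (φ s) ^ 2)
      (Real.exp (k * (φ t - t)) * (k * (Real.exp (a * (φ t - t)) * q₂ t / q₁ (φ t) - 1))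
        * (q₂ t ^ 2 - q₂ t₀ ^ 2) + 2 * q₂ t * f (w₂ t) * Real.exp ((a - γ) * t)
        * (Real.exp (k * (φ t - t)) - Real.exp ((2 * a - γ) * (φ t - t)))) t := by
    intro t ht
    have hq := (H.q₁_pos hf ht).ne'
    have h1 := (((H.hasDerivAt_delay ht).const_mul k).exp).mul
      (((H.sol₂.sol t (H.le.trans ht)).2.pow 2).sub_const (q₂ t₀ ^ 2))
    have h2 := (((H.sol₁.sol _ (H.lt t ht).le).2.comp t (H.deriv t ht)).pow 2)
    refine (h1.sub h2).congr_deriv ?_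
    simp only [Pi.pow_apply, Function.comp]
    rw [H.eq t ht]
    have e : Real.exp ((a - γ) * φ t) * Real.exp (a * (φ t - t))
        = Real.exp ((a - γ) * t) * Real.exp ((2 * a - γ) * (φ t - t)) := by
      rw [← Real.exp_add, ← Real.exp_add]; congr 1; ring
    rw [mul_sub (2 * q₂ t * f (w₂ t) * Real.exp ((a - γ) * t)),
      mul_assoc (2 * q₂ t * f (w₂ t)) (Real.exp ((a - γ) * t))
        (Real.exp ((2 * a - γ) * (φ t - t))), ← e]
    field_simp
    ring
  have hmono := monotoneOn_of_hasDerivAt_nonneg (convex_Ici t₀) hderiv fun t ht => by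
    have h1 := H.q₁_pos hf ht
    have h2 := H.q₂_nonneg hf ht
    have h3 := H.f_pos hf ht
    have h4 : 0 ≤ Real.exp (a * (φ t - t)) * q₂ t / q₁ (φ t) - 1 := by
      rw [sub_nonneg, one_le_div h1]; exact hm t ht
    have h5 : 0 ≤ q₂ t ^ 2 - q₂ t₀ ^ 2 := by
      rw [sub_nonneg]
      exact pow_le_pow_left₀ (H.q₂_nonneg hf le_rfl)
        ((H.sol₂.strictMonoOn_q hf).monotoneOn H.le (H.le.trans ht) ht) 2
    have h6 : 0 ≤ Real.exp (k * (φ t - t)) - Real.exp ((2 * a - γ) * (φ t - t)) := by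
      rw [sub_nonneg, Real.exp_le_exp]
      exact mul_le_mul_of_nonneg_right hk' (hd t ht)
    positivity
  have h := hmono self_mem_Ici (show t ∈ Ici t₀ from ht) ht
  simp only [sub_self, mul_zero, zero_sub] at h
  have : 0 ≤ Real.exp (k * (φ t - t)) * q₂ t₀ ^ 2 := by positivity
  linarith [mul_sub (Real.exp (k * (φ t - t))) (q₂ t ^ 2) (q₂ t₀ ^ 2)]

/-- A later solution cannot run faster at equal heights: it would blow up. -/
lemma delay_blowup (H : IsTimeChange a γ f w₁ q₁ T₁ w₂ q₂ T₂ φ t₀) (ha : 0 < a)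
    (hγ : 0 < γ) (hf : ∀ t, 0 < t → 0 < f t) (hw₁ : Tendsto w₁ atTop atTop)
    (hd : t₀ < φ t₀) (hq : q₁ (φ t₀) ≤ Real.exp (a * (φ t₀ - t₀)) * q₂ t₀) : False := by
  have hG : 0 ≤ energyGap a q₁ q₂ φ t₀ := by
    rw [energyGap_eq]
    refine mul_nonneg (by positivity) (sub_nonneg.2 ?_)
    exact pow_le_pow_left₀ (H.q₁_pos hf le_rfl).le hq 2
  have hpos : ∀ t, t₀ ≤ t → 0 < φ t - t := fun t ht => by
    have := H.delay_pos ha hγ hf hd hG ht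
    linarith
  have hGm := H.monotoneOn_energyGap ha hγ hf (convex_Ici t₀)
    fun s hs => ⟨hs, by linarith [hpos s hs]⟩
  have hG' : ∀ t, t₀ ≤ t → 0 ≤ energyGap a q₁ q₂ φ t := fun t ht =>
    hG.trans (hGm self_mem_Ici ht ht)
  have hdm := H.monotoneOn_delay hf (convex_Ici t₀) fun s hs => ⟨hs, hG' s hs⟩
  have hle : ∀ t, t₀ ≤ t → q₁ (φ t) ≤ Real.exp (a * (φ t - t)) * q₂ t := fun t ht =>
    H.le_of_energyGap_nonneg hf ht (hG' t ht)
  have hw₂ : Tendsto w₂ atTop atTop := by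
    refine tendsto_atTop_mono' _ ?_ hw₁
    filter_upwards [eventually_ge_atTop t₀, eventually_ge_atTop T₁] with t ht ht'
    rw [← H.eq t ht]
    exact (H.sol₁.strictMonoOn_w hf).monotoneOn ht' (H.lt t ht).le (by linarith [hpos t ht])
  set k := max (2 * a - γ) 0 with hk
  have hm : 0 < 2 * a - k := by
    rw [hk, sub_pos]; exact max_lt (by linarith) (by linarith)
  set m := 2 * a - k with hmdef
  set δ := φ t₀ - t₀ with hδ
  have hδ0 : 0 < δ := sub_pos.2 hd
  have hη : 0 < Real.exp (m * δ / 2) - 1 := by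
    rw [sub_pos, Real.one_lt_exp_iff]; positivity
  obtain ⟨t₁, ht₁⟩ := H.sol₂.tendsto_q hf ha hw₂
    (max 1 (q₁ (φ t₀) ^ 2 / (Real.exp (m * δ / 2) - 1)))
  set t₂ := max t₀ t₁ with ht₂
  have hrate : ∀ t, t₂ ≤ t → (m * (φ t - t) / 4) ^ 2 / 2
      ≤ Real.exp (a * (φ t - t)) * q₂ t / q₁ (φ t) - 1 := by
    intro t ht
    have ht0 : t₀ ≤ t := (le_max_left _ _).trans ht
    have hqb := ht₁ t ((le_max_right _ _).trans ht)
    have hq1 : 1 ≤ q₂ t := (le_max_left _ _).trans hqb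
    have hq2 : q₁ (φ t₀) ^ 2 ≤ (Real.exp (m * δ / 2) - 1) * q₂ t ^ 2 := by
      have := (div_le_iff₀ hη).1 ((le_max_right _ _).trans hqb)
      nlinarith
    have hdt : δ ≤ φ t - t := hdm self_mem_Ici (show t ∈ Ici t₀ from ht0) ht0
    have hkin := H.kinetic_le hf (fun s hs => (hpos s hs).le) hle
      (k := k) (le_max_right _ _) (le_max_left _ _) ht0
    have hq1p := H.q₁_pos hf ht0
    set d := φ t - t with hddef
    have hd0 : 0 < d := hpos t ht0
    have hek : 1 ≤ Real.exp (k * d) :=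
      Real.one_le_exp (mul_nonneg (le_max_right _ _) hd0.le)
    have hmd : Real.exp (m * δ / 2) ≤ Real.exp (m * d / 2) := by
      rw [Real.exp_le_exp]; nlinarith
    have hb : q₁ (φ t) ^ 2 ≤ Real.exp (k * d) * Real.exp (m * d / 2) * q₂ t ^ 2 := by
      have h1 : q₁ (φ t₀) ^ 2 ≤ Real.exp (k * d) * ((Real.exp (m * δ / 2) - 1) * q₂ t ^ 2) := by
        have : 0 ≤ (Real.exp (m * δ / 2) - 1) * q₂ t ^ 2 := by positivity
        nlinarith
      have h2 : Real.exp (k * d) * Real.exp (m * δ / 2) * q₂ t ^ 2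
          ≤ Real.exp (k * d) * Real.exp (m * d / 2) * q₂ t ^ 2 := by gcongr
      nlinarith
    have hb' : (Real.exp (m * d / 4) * q₁ (φ t)) ^ 2 ≤ (Real.exp (a * d) * q₂ t) ^ 2 := by
      have e : Real.exp (m * d / 4) ^ 2 * (Real.exp (k * d) * Real.exp (m * d / 2))
          = Real.exp (a * d) ^ 2 := by
        rw [sq, sq, ← Real.exp_add, ← Real.exp_add, ← Real.exp_add, ← Real.exp_add]
        congr 1; rw [hmdef]; ring
      rw [mul_pow, mul_pow, ← e, mul_assoc (Real.exp (m * d / 4) ^ 2)]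
      exact mul_le_mul_of_nonneg_left hb (by positivity)
    have hb'' : Real.exp (m * d / 4) * q₁ (φ t) ≤ Real.exp (a * d) * q₂ t :=
      (pow_le_pow_iff_left₀ (by positivity) (by positivity) two_ne_zero).1 hb'
    have h3 : Real.exp (m * d / 4) ≤ Real.exp (a * d) * q₂ t / q₁ (φ t) := (le_div_iff₀ hq1p).2 hb''
    have h4 := Real.quadratic_le_exp_of_nonneg (show 0 ≤ m * d / 4 by positivity)
    have h5 : 0 ≤ m * d / 4 := by positivity
    linarith
  have hanti := monotoneOn_of_hasDerivAt_nonneg (convex_Ici t₂)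
    (g := fun t => -((φ t - t)⁻¹ + m ^ 2 / 32 * t))
    (fun t ht => (((H.hasDerivAt_delay ((le_max_left t₀ t₁).trans ht)).inv
      (hpos t ((le_max_left t₀ t₁).trans ht)).ne').add
        ((hasDerivAt_id t).const_mul (m ^ 2 / 32))).neg) fun t ht => by
    have hp := hpos t ((le_max_left t₀ t₁).trans ht)
    have := hrate t ht
    have h1 : m ^ 2 / 32 ≤ (Real.exp (a * (φ t - t)) * q₂ t / q₁ (φ t) - 1) / (φ t - t) ^ 2 := by
      rw [le_div_iff₀ (by positivity)]
      nlinarith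
    rw [neg_div]
    linarith
  set s := t₂ + 32 / m ^ 2 * ((φ t₂ - t₂)⁻¹ + 1) with hs
  have hp2 := hpos t₂ (le_max_left _ _)
  have hs2 : t₂ ≤ s := by
    have : 0 ≤ 32 / m ^ 2 * ((φ t₂ - t₂)⁻¹ + 1) := by positivity
    linarith
  have h1 := hanti self_mem_Ici (show s ∈ Ici t₂ from hs2) hs2
  have h2 : 0 < (φ s - s)⁻¹ := inv_pos.2 (hpos s ((le_max_left t₀ t₁).trans hs2))
  have h3 : m ^ 2 / 32 * s = m ^ 2 / 32 * t₂ + ((φ t₂ - t₂)⁻¹ + 1) := by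
    rw [hs]; field_simp
  simp only at h1
  linarith

end IsTimeChange
end Comparison

section Comparison

variable {a γ : ℝ} {f w₁ q₁ w₂ q₂ : ℝ → ℝ} {T₁ T₂ : ℝ}

/-- Forward comparison of a radial solution with a delayed large one. -/
lemma IsGlobalRadialSol.le_shift (ha : 0 < a) (hγ : 0 < γ) (hf : ∀ t, 0 < t → 0 < f t)
    (h₁ : IsGlobalRadialSol a γ f w₁ q₁ T₁) (hw₁ : Tendsto w₁ atTop atTop)
    (h₂ : IsGlobalRadialSol a γ f w₂ q₂ T₂) {h : ℝ} (hh : 0 ≤ h) (hT : T₁ < T₂ + h)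
    (h0 : w₂ T₂ ≤ w₁ (T₂ + h)) {t : ℝ} (ht : T₂ ≤ t) : w₂ t ≤ w₁ (t + h) := by
  by_contra! hlt
  have hc₁ : ContinuousOn (fun s => w₁ (s + h)) (Icc T₂ t) := by
    refine h₁.continuousOn_w.comp (by fun_prop) fun s hs => ?_
    have := hs.1
    simp only [mem_Ici]; linarith
  have hc₂ : ContinuousOn w₂ (Icc T₂ t) := h₂.continuousOn_w.mono Icc_subset_Ici_self
  have hcpt : IsCompact (Icc T₂ t ∩ (fun s => w₂ s - w₁ (s + h)) ⁻¹' Iic 0) :=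
    isCompact_Icc.of_isClosed_subset
      ((hc₂.sub hc₁).preimage_isClosed_of_isClosed isClosed_Icc isClosed_Iic) inter_subset_left
  obtain ⟨σ, ⟨hσ, hσ'⟩, hgr⟩ := hcpt.exists_isGreatest
    ⟨T₂, left_mem_Icc.2 ht, sub_nonpos.2 h0⟩
  have hσle : w₂ σ ≤ w₁ (σ + h) := sub_nonpos.1 hσ'
  have hgt : ∀ s ∈ Ioc σ t, w₁ (s + h) < w₂ s := fun s hs => by
    by_contra! hcon
    exact absurd (hgr ⟨⟨hσ.1.trans hs.1.le, hs.2⟩, sub_nonpos.2 hcon⟩) (not_le.2 hs.1)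
  have hσt : σ < t := lt_of_le_of_ne hσ.2 fun e => by rw [e] at hσle; linarith
  have hσge : w₁ (σ + h) ≤ w₂ σ := by
    have hlim : Tendsto (fun s => w₂ s - w₁ (s + h)) (𝓝[>] σ) (𝓝 (w₂ σ - w₁ (σ + h))) := by
      refine ((hc₂.sub hc₁) σ hσ).mono_left ?_
      rw [← nhdsWithin_Ioc_eq_nhdsGT hσt]
      exact nhdsWithin_mono _ fun s hs => ⟨hσ.1.trans hs.1.le, hs.2⟩
    refine sub_nonneg.1 (ge_of_tendsto hlim ?_)
    filter_upwards [Ioc_mem_nhdsGT hσt] with s hs using (sub_pos.2 (hgt s hs)).le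
  have hsm := h₁.strictMonoOn_w hf
  have hTσ : T₁ < σ + h := by linarith [hσ.1]
  obtain ⟨φ, hφ⟩ := h₁.exists_isTimeChange hf hw₁ h₂ hσ.1
    ((hsm self_mem_Ici hTσ.le hTσ).trans_le hσge)
  have hφσ : φ σ ≤ σ + h := by
    by_contra! hcon
    have := hsm hTσ.le (hφ.lt σ le_rfl).le hcon
    rw [hφ.eq σ le_rfl] at this
    linarith
  have hφgt : ∀ s ∈ Ioc σ t, s + h < φ s := fun s hs => by
    by_contra! hcon
    have := hsm.monotoneOn (hφ.lt s hs.1.le).le (by simp only [mem_Ici]; linarith [hs.1]) hcon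
    rw [hφ.eq s hs.1.le] at this
    linarith [hgt s hs]
  obtain ⟨c, hc, hc'⟩ := exists_hasDerivAt_eq_slope (fun s => φ s - s) _ hσt
    (fun s hs => (hφ.hasDerivAt_delay hs.1).continuousAt.continuousWithinAt)
    fun s hs => hφ.hasDerivAt_delay hs.1.le
  have hcpos : 0 < (φ t - t - (φ σ - σ)) / (t - σ) := by
    refine div_pos ?_ (sub_pos.2 hσt)
    linarith [hφgt t ⟨hσt, le_rfl⟩]
  rw [← hc', sub_pos, one_lt_div (hφ.q₁_pos hf hc.1.le)] at hcpos
  exact (hφ.mono hc.1.le).delay_blowup ha hγ hf hw₁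
    (by linarith [hφgt c ⟨hc.1, hc.2.le⟩]) hcpos.le

lemma IsTimeChange.sub_le_of_delay_pos {φ : ℝ → ℝ} {t₀ : ℝ}
    (H : IsTimeChange a γ f w₁ q₁ T₁ w₂ q₂ T₂ φ t₀) (ha : 0 < a) (hγ : 0 < γ)
    (hf : ∀ t, 0 < t → 0 < f t) (ht₀ : 0 ≤ t₀) (hT₁ : T₁ ≤ t₀) (hd : ∀ t, t₀ ≤ t → t < φ t)
    (hq : ∀ t, t₀ ≤ t → Real.exp (a * (φ t - t)) * q₂ t < q₁ (φ t)) :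
    ∃ K, ∀ t, t₀ ≤ t → (w₂ t - w₁ t) ^ 2 ≤ K * Real.exp (-(a * t)) := by
  have hdanti : ∀ t, t₀ ≤ t → φ t - t ≤ φ t₀ - t₀ := fun t ht => by
    have := monotoneOn_of_hasDerivAt_nonneg (convex_Ici t₀)
      (fun s hs => (H.hasDerivAt_delay hs).neg) (fun s hs => by
        rw [neg_sub, sub_nonneg, div_le_one (H.q₁_pos hf hs)]; exact (hq s hs).le)
      self_mem_Ici (show t ∈ Ici t₀ from ht) ht
    simp only [Pi.neg_apply] at this
    linarith
  set d₀ := φ t₀ - t₀ with hd₀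
  have hd₀0 : 0 < d₀ := sub_pos.2 (hd t₀ le_rfl)
  have hGm := H.monotoneOn_energyGap ha hγ hf (convex_Ici t₀) fun s hs => ⟨hs, (hd s hs).le⟩
  have hGneg : ∀ t, t₀ ≤ t → energyGap a q₁ q₂ φ t ≤ 0 := fun t ht => by
    by_contra! hcon
    exact absurd (H.le_of_energyGap_nonneg hf ht hcon.le) (not_le.2 (hq t ht))
  set C := -energyGap a q₁ q₂ φ t₀ with hC
  have hC0 : 0 ≤ C := neg_nonneg.2 (hGneg t₀ le_rfl)
  have hX : ∀ t, t₀ ≤ t → HasDerivAt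
      (fun s => Real.exp (-(a * s)) * (1 - Real.exp (-(γ * (φ s - s)))))
      (Real.exp (-(a * t)) * (-a) * (1 - Real.exp (-(γ * (φ t - t)))) +
        Real.exp (-(a * t)) * (Real.exp (-(γ * (φ t - t))) *
          (γ * (Real.exp (a * (φ t - t)) * q₂ t / q₁ (φ t) - 1)))) t := fun t ht => by
    have h1 := (((hasDerivAt_id t).const_mul a).neg).exp
    have h2 := ((((H.hasDerivAt_delay ht).const_mul γ).neg).exp).const_sub 1
    refine (h1.mul h2).congr_deriv ?_
    simp only [id, Pi.neg_apply]; ring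
  have hmono := monotoneOn_of_hasDerivAt_nonneg (convex_Ici t₀)
    (g := fun s => energyGap a q₁ q₂ φ s - Real.exp (-(a * s)) *
      (1 - Real.exp (-(γ * (φ s - s)))) * ((q₂ s ^ 2 - q₂ t₀ ^ 2) / 2))
    (fun t ht => (H.hasDerivAt_energyGap hf ht).sub ((hX t ht).mul
      (((((H.sol₂.sol t (H.le.trans ht)).2.pow 2).sub_const (q₂ t₀ ^ 2)).div_const 2))))
    fun t ht => by
      have h1 := H.q₁_pos hf ht
      have h2 := H.q₂_nonneg hf ht
      have h3 := H.f_pos hf ht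
      have hdt := hd t ht
      have h4 : 0 ≤ 1 - Real.exp (-(γ * (φ t - t))) := by
        rw [sub_nonneg, Real.exp_le_one_iff]; nlinarith
      have h5 : 0 ≤ 1 - Real.exp (a * (φ t - t)) * q₂ t / q₁ (φ t) := by
        rw [sub_nonneg, div_le_one h1]; exact (hq t ht).le
      have h6 : 0 ≤ q₂ t ^ 2 - q₂ t₀ ^ 2 := by
        rw [sub_nonneg]
        exact pow_le_pow_left₀ (H.q₂_nonneg hf le_rfl)
          ((H.sol₂.strictMonoOn_q hf).monotoneOn H.le (H.le.trans ht) ht) 2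
      have h7 : 0 ≤ Real.exp (a * φ t - a * t - γ * t)
          - Real.exp (-(a * t)) * Real.exp ((a - γ) * t) := by
        rw [← Real.exp_add, sub_nonneg, Real.exp_le_exp]
        nlinarith
      have e1 : 0 ≤ a * Real.exp (-(a * φ t)) * (Real.exp (a * (φ t - t)) * q₂ t / (2 * q₁ (φ t)))
        * (Real.exp (a * (φ t - t)) * q₂ t - q₁ (φ t)) ^ 2 := by positivity
      have e2 : 0 ≤ q₂ t * f (w₂ t) * (1 - Real.exp (-(γ * (φ t - t)))) *
        (Real.exp (a * φ t - a * t - γ * t)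
          - Real.exp (-(a * t)) * Real.exp ((a - γ) * t)) := by positivity
      have e3 : 0 ≤ (Real.exp (-(a * t)) * a * (1 - Real.exp (-(γ * (φ t - t)))) +
        Real.exp (-(a * t)) * (Real.exp (-(γ * (φ t - t))) *
          (γ * (1 - Real.exp (a * (φ t - t)) * q₂ t / q₁ (φ t)))))
          * ((q₂ t ^ 2 - q₂ t₀ ^ 2) / 2) := by positivity
      simp only [Pi.pow_apply]
      push_cast
      linarith
  have hXQ : ∀ t, t₀ ≤ t → Real.exp (-(a * t)) * (1 - Real.exp (-(γ * (φ t - t)))) *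
      (q₂ t ^ 2 / 2) ≤ C + q₂ t₀ ^ 2 / 2 := fun t ht => by
    have h := hmono self_mem_Ici (show t ∈ Ici t₀ from ht) ht
    simp only [sub_self, zero_div, mul_zero, sub_zero] at h
    have h1 : Real.exp (-(a * t)) * (1 - Real.exp (-(γ * (φ t - t)))) ≤ 1 := by
      have : Real.exp (-(a * t)) ≤ 1 := Real.exp_le_one_iff.2 (by nlinarith)
      have h2 := Real.exp_pos (-(γ * (φ t - t)))
      have h3 := Real.exp_pos (-(a * t))
      nlinarith
    have h2 : 0 ≤ q₂ t₀ ^ 2 / 2 := by positivity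
    have h3 := mul_le_mul_of_nonneg_right h1 h2
    have := hGneg t ht
    rw [sub_div, mul_sub] at h
    linarith
  have hlin : ∀ t, t₀ ≤ t → Real.exp (-(a * t)) * (φ t - t) * q₂ t ^ 2 ≤
      2 * (C + q₂ t₀ ^ 2 / 2) * Real.exp (γ * d₀) / γ := fun t ht => by
    have hdp : 0 < φ t - t := sub_pos.2 (hd t ht)
    have h1 : γ * (φ t - t) ≤ Real.exp (γ * d₀) * (1 - Real.exp (-(γ * (φ t - t)))) := by
      have h2 : γ * (φ t - t) + 1 ≤ Real.exp (γ * (φ t - t)) := Real.add_one_le_exp _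
      have h3 : Real.exp (γ * (φ t - t)) ≤ Real.exp (γ * d₀) := by
        rw [Real.exp_le_exp]; exact mul_le_mul_of_nonneg_left (hdanti t ht) hγ.le
      have h4 : Real.exp (γ * (φ t - t)) * Real.exp (-(γ * (φ t - t))) = 1 := by
        rw [← Real.exp_add]; simp
      have h5 : Real.exp (-(γ * (φ t - t))) ≤ 1 := Real.exp_le_one_iff.2 (by nlinarith)
      nlinarith
    rw [le_div_iff₀ hγ]
    have h6 := hXQ t ht
    have h7 : 0 ≤ Real.exp (-(a * t)) * q₂ t ^ 2 := by positivity
    have h8 := mul_le_mul_of_nonneg_left h1 h7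
    have h9 := mul_le_mul_of_nonneg_left h6 (Real.exp_pos (γ * d₀)).le
    nlinarith
  have hq₁ : ∀ t, t₀ ≤ t → q₁ (φ t) ^ 2 ≤
      Real.exp (2 * a * d₀) * q₂ t ^ 2 + 2 * C * Real.exp (a * d₀) * Real.exp (a * t) :=
      fun t ht => by
    have hG : -C ≤ energyGap a q₁ q₂ φ t := by
      rw [hC, neg_neg]; exact hGm self_mem_Ici ht ht
    rw [energyGap_eq] at hG
    have e : Real.exp (a * φ t) * Real.exp (-(a * φ t)) = 1 := by rw [← Real.exp_add]; simp
    have h1 := mul_le_mul_of_nonneg_left hG (Real.exp_pos (a * φ t)).le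
    rw [← mul_assoc, ← mul_div_assoc, e] at h1
    have h2 : Real.exp (a * φ t) ≤ Real.exp (a * d₀) * Real.exp (a * t) := by
      rw [← Real.exp_add, Real.exp_le_exp]; nlinarith [hdanti t ht]
    have h3 : Real.exp (a * (φ t - t)) ^ 2 ≤ Real.exp (2 * a * d₀) := by
      rw [sq, ← Real.exp_add, Real.exp_le_exp]; nlinarith [hdanti t ht]
    have h4 := mul_le_mul_of_nonneg_right h3 (sq_nonneg (q₂ t))
    have h5 := mul_le_mul_of_nonneg_left h2 hC0
    rw [mul_pow] at h1
    linarith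
  refine ⟨d₀ * Real.exp (2 * a * d₀) * (2 * (C + q₂ t₀ ^ 2 / 2) * Real.exp (γ * d₀) / γ)
    + d₀ ^ 2 * (2 * C * Real.exp (a * d₀)), fun t ht => ?_⟩
  have hdp : 0 < φ t - t := sub_pos.2 (hd t ht)
  have hTt : T₁ ≤ t := hT₁.trans ht
  obtain ⟨ξ, hξ, hξ'⟩ := exists_hasDerivAt_eq_slope w₁ _ (hd t ht)
    (fun s hs => (H.sol₁.sol s (hTt.trans hs.1)).1.continuousAt.continuousWithinAt)
    fun s hs => (H.sol₁.sol s (hTt.trans hs.1.le)).1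
  have hw : w₂ t - w₁ t = Real.exp (-(a * ξ)) * q₁ ξ * (φ t - t) := by
    rw [hξ', H.eq t ht, div_mul_cancel₀ _ hdp.ne']
  have hξq : 0 ≤ q₁ ξ := H.sol₁.q_nonneg hf (hTt.trans hξ.1.le)
  have hξe : Real.exp (-(a * ξ)) ≤ Real.exp (-(a * t)) := by
    rw [Real.exp_le_exp]; nlinarith [hξ.1]
  have hξq' : q₁ ξ ≤ q₁ (φ t) := (H.sol₁.strictMonoOn_q hf).monotoneOn (hTt.trans hξ.1.le)
    (H.lt t ht).le hξ.2.le
  have hbd : w₂ t - w₁ t ≤ Real.exp (-(a * t)) * q₁ (φ t) * (φ t - t) := by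
    rw [hw]; gcongr
  have hnn : 0 ≤ w₂ t - w₁ t := by rw [hw]; positivity
  calc (w₂ t - w₁ t) ^ 2 ≤ (Real.exp (-(a * t)) * q₁ (φ t) * (φ t - t)) ^ 2 :=
        pow_le_pow_left₀ hnn hbd 2
    _ = (Real.exp (-(a * t)) * (φ t - t)) ^ 2 * q₁ (φ t) ^ 2 := by ring
    _ ≤ (Real.exp (-(a * t)) * (φ t - t)) ^ 2 * (Real.exp (2 * a * d₀) * q₂ t ^ 2
        + 2 * C * Real.exp (a * d₀) * Real.exp (a * t)) :=
        mul_le_mul_of_nonneg_left (hq₁ t ht) (sq_nonneg _)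
    _ = ((φ t - t) * Real.exp (2 * a * d₀) * (Real.exp (-(a * t)) * (φ t - t) * q₂ t ^ 2)
        + (φ t - t) ^ 2 * (2 * C * Real.exp (a * d₀)) * (Real.exp (-(a * t)) * Real.exp (a * t)))
        * Real.exp (-(a * t)) := by ring
    _ = ((φ t - t) * Real.exp (2 * a * d₀) * (Real.exp (-(a * t)) * (φ t - t) * q₂ t ^ 2)
        + (φ t - t) ^ 2 * (2 * C * Real.exp (a * d₀))) * Real.exp (-(a * t)) := by
        rw [← Real.exp_add]; simp
    _ ≤ _ := by
        have := hdanti t ht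
        have h1 := hlin t ht
        have : 0 ≤ Real.exp (-(a * t)) * (φ t - t) * q₂ t ^ 2 := by positivity
        gcongr

/-- Two large radial solutions are asymptotic to each other (one-sided version). -/
lemma IsGlobalRadialSol.eventually_sub_lt (ha : 0 < a) (hγ : 0 < γ)
    (hf : ∀ t, 0 < t → 0 < f t)
    (h₁ : IsGlobalRadialSol a γ f w₁ q₁ T₁) (hw₁ : Tendsto w₁ atTop atTop)
    (h₂ : IsGlobalRadialSol a γ f w₂ q₂ T₂) (hw₂ : Tendsto w₂ atTop atTop) {ε : ℝ} (hε : 0 < ε) :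
    ∀ᶠ t in atTop, w₂ t - w₁ t < ε := by
  obtain ⟨t₀, ⟨⟨h0, hT₂⟩, hT₁⟩, hlt⟩ := (((eventually_ge_atTop (0 : ℝ)).and
    (eventually_ge_atTop T₂)).and (eventually_gt_atTop T₁)).and
      (hw₂.eventually_gt_atTop (w₁ T₁)) |>.exists
  by_cases hcase : ∃ t, t₀ ≤ t ∧ w₂ t ≤ w₁ t
  · obtain ⟨t₁, ht₁, hle⟩ := hcase
    filter_upwards [eventually_ge_atTop t₁] with t ht
    have := IsGlobalRadialSol.le_shift ha hγ hf h₁ hw₁ (h₂.mono hf (hT₂.trans ht₁)) (h := 0) le_rfl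
      (by linarith) (by simpa using hle) ht
    rw [add_zero] at this
    linarith
  · push Not at hcase
    obtain ⟨φ, hφ⟩ := h₁.exists_isTimeChange hf hw₁ h₂ hT₂ hlt
    have hd : ∀ t, t₀ ≤ t → t < φ t := fun t ht => by
      by_contra! hcon
      have := (h₁.strictMonoOn_w hf).monotoneOn (hφ.lt t ht).le
        (show t ∈ Ici T₁ from hT₁.le.trans ht) hcon
      rw [hφ.eq t ht] at this
      linarith [hcase t ht]
    have hq : ∀ t, t₀ ≤ t → Real.exp (a * (φ t - t)) * q₂ t < q₁ (φ t) := fun t ht => by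
      by_contra! hcon
      exact (hφ.mono ht).delay_blowup ha hγ hf hw₁ (hd t ht) hcon
    obtain ⟨K, hK⟩ := hφ.sub_le_of_delay_pos ha hγ hf h0 hT₁.le hd hq
    have hlim : Tendsto (fun t : ℝ => K * Real.exp (-(a * t))) atTop (𝓝 (K * 0)) :=
      (Real.tendsto_exp_neg_atTop_nhds_zero.comp (tendsto_id.const_mul_atTop ha)).const_mul K
    rw [mul_zero] at hlim
    filter_upwards [hlim.eventually_lt_const (show 0 < ε ^ 2 by positivity),
      eventually_ge_atTop t₀] with t ht ht'
    exact lt_of_pow_lt_pow_left₀ 2 hε.le ((hK t ht').trans_lt ht)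

end Comparison

section Flow

variable {E : Type*} [NormedAddCommGroup E] [NormedSpace ℝ E]

lemma exists_global_solution [CompleteSpace E] {Z : ℝ → E → E}
    (hc : ∀ x, Continuous fun t => Z t x)
    (hZ : ∀ N : ℝ, ∃ L K : NNReal, ∀ t ∈ Icc (-N) N, (∀ x, ‖Z t x‖ ≤ L) ∧ LipschitzWith K (Z t))
    (T : ℝ) (x₀ : E) : ∃ φ : ℝ → E, φ T = x₀ ∧ ∀ t, HasDerivAt φ (Z t (φ t)) t := by
  have hsub : ∀ n : ℕ, Icc (T - n) (T + n) ⊆ Icc (-(|T| + n)) (|T| + n) := fun n =>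
    Icc_subset_Icc (by linarith [neg_abs_le T]) (by linarith [le_abs_self T])
  have hloc : ∀ n : ℕ, ∃ φ : ℝ → E, φ T = x₀ ∧
      ∀ t ∈ Icc (T - n) (T + n), HasDerivWithinAt φ (Z t (φ t)) (Icc (T - n) (T + n)) t := by
    intro n
    obtain ⟨L, K, hLK⟩ := hZ (|T| + n)
    have hn : (0 : ℝ) ≤ n := n.cast_nonneg
    let t₀ : Icc (T - (n : ℝ)) (T + n) := ⟨T, by constructor <;> linarith⟩
    have hP : IsPicardLindelof Z t₀ x₀ (L * n) 0 L K :=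
      { lipschitzOnWith := fun t ht => (hLK t (hsub n ht)).2.lipschitzOnWith
        continuousOn := fun x _ => (hc x).continuousOn
        norm_le := fun t ht x _ => (hLK t (hsub n ht)).1 x
        mul_max_le := by simp [t₀] }
    exact hP.exists_eq_forall_mem_Icc_hasDerivWithinAt₀
  choose ψ hψ0 hψ using hloc
  have hder : ∀ n : ℕ, ∀ t ∈ Ioo (T - (n : ℝ)) (T + n), HasDerivAt (ψ n) (Z t (ψ n t)) t :=
    fun n t ht => (hψ n t (Ioo_subset_Icc_self ht)).hasDerivAt (Icc_mem_nhds ht.1 ht.2)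
  have hagree : ∀ n m : ℕ, n ≤ m → EqOn (ψ n) (ψ m) (Icc (T - n) (T + n)) := by
    intro n m hnm
    rcases Nat.eq_zero_or_pos n with rfl | hn
    · intro t ht
      have : t = T := by
        have := ht.1; have := ht.2
        push_cast at *
        linarith
      rw [this, hψ0, hψ0]
    have hn' : (0 : ℝ) < n := by exact_mod_cast hn
    have hnm' : (n : ℝ) ≤ m := by exact_mod_cast hnm
    obtain ⟨L, K, hLK⟩ := hZ (|T| + n)
    have hs : Icc (T - (n : ℝ)) (T + n) ⊆ Icc (T - m) (T + m) :=
      Icc_subset_Icc (by linarith) (by linarith)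
    refine ODE_solution_unique_of_mem_Icc (v := Z) (s := fun _ => univ) (K := K) (t₀ := T)
      (fun t ht => (hLK t (hsub n (Ioo_subset_Icc_self ht))).2.lipschitzOnWith)
      ⟨by linarith, by linarith⟩ (fun t ht => (hψ n t ht).continuousWithinAt)
      (hder n) (fun _ _ => trivial) (fun t ht => ((hψ m t (hs ht)).mono hs).continuousWithinAt)
      (fun t ht => hder m t ⟨by linarith [ht.1], by linarith [ht.2]⟩) (fun _ _ => trivial) ?_
    rw [hψ0, hψ0]
  refine ⟨fun t => ψ ⌈|t - T|⌉₊ t, by simp [hψ0], fun t => ?_⟩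
  obtain ⟨n, hn⟩ := exists_nat_gt |t - T|
  have hnn : ∀ s, |s - T| < n → ψ ⌈|s - T|⌉₊ s = ψ n s := by
    intro s hs
    refine hagree _ _ (Nat.ceil_le.2 hs.le) ?_
    have := abs_le.1 (Nat.le_ceil |s - T|)
    constructor <;> linarith [this.1, this.2]
  have h1 := hder n t (by have := abs_lt.1 hn; constructor <;> linarith [this.1, this.2])
  rw [← hnn t hn] at h1
  refine h1.congr_of_eventuallyEq ?_
  have : ∀ᶠ s in 𝓝 t, |s - T| < n :=
    (continuous_abs.comp (continuous_id.sub continuous_const)).continuousAt.eventually_lt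
      continuousAt_const hn
  exact this.mono hnn

/-- The field of the radial system, with the argument of `f` truncated to `[0, c t]`, in the
variables `(w + q exp (-a t) / a, q)`. -/
noncomputable def capField (a γ : ℝ) (f c : ℝ → ℝ) (t : ℝ) (p : ℝ × ℝ) : ℝ × ℝ :=
  (Real.exp (-(γ * t)) / a * f (max 0 (min (p.1 - Real.exp (-(a * t)) / a * p.2) (c t))),
    Real.exp ((a - γ) * t) * f (max 0 (min (p.1 - Real.exp (-(a * t)) / a * p.2) (c t))))

lemma continuous_capField {a γ : ℝ} {f c : ℝ → ℝ} (hf : ContinuousOn f (Ici 0))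
    (hc : Continuous c) (p : ℝ × ℝ) : Continuous fun t => capField a γ f c t p := by
  have h : Continuous fun t =>
      f (max 0 (min (p.1 - Real.exp (-(a * t)) / a * p.2) (c t))) :=
    hf.comp_continuous (by fun_prop) fun t => mem_Ici.2 (le_max_left _ _)
  unfold capField
  exact Continuous.prodMk (Continuous.mul (by fun_prop) h) (Continuous.mul (by fun_prop) h)

lemma capField_bounds {a γ : ℝ} {f c : ℝ → ℝ} (hf : ContDiffOn ℝ 1 f (Ici 0))
    (hc : Continuous c) (N : ℝ) : ∃ L K : NNReal, ∀ t ∈ Icc (-N) N,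
      (∀ p, ‖capField a γ f c t p‖ ≤ L) ∧ LipschitzWith K (capField a γ f c t) := by
  obtain ⟨C, hC⟩ := isCompact_Icc.exists_bound_of_continuousOn (s := Icc (-N) N) hc.continuousOn
  set C' := max C 0
  have hsub : Icc 0 C' ⊆ Ici (0 : ℝ) := fun x hx => hx.1
  obtain ⟨K₀, hK₀⟩ := (hf.mono hsub).exists_lipschitzOnWith one_ne_zero (convex_Icc _ _)
    isCompact_Icc
  obtain ⟨B, hB⟩ := isCompact_Icc.exists_bound_of_continuousOn (hf.continuousOn.mono hsub)
  have hB0 : 0 ≤ B := (norm_nonneg _).trans (hB 0 ⟨le_rfl, le_max_right _ _⟩)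
  obtain ⟨P₁, hP₁⟩ := isCompact_Icc.exists_bound_of_continuousOn (s := Icc (-N) N)
    (f := fun t => Real.exp (-(γ * t)) / a) (by fun_prop)
  obtain ⟨P₂, hP₂⟩ := isCompact_Icc.exists_bound_of_continuousOn (s := Icc (-N) N)
    (f := fun t => Real.exp ((a - γ) * t)) (by fun_prop)
  obtain ⟨P₃, hP₃⟩ := isCompact_Icc.exists_bound_of_continuousOn (s := Icc (-N) N)
    (f := fun t => Real.exp (-(a * t)) / a) (by fun_prop)
  set P := max (max P₁ P₂) (max P₃ 0)
  have hP0 : 0 ≤ P := by simp [P]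
  have hmem : ∀ t ∈ Icc (-N) N, ∀ y, max 0 (min y (c t)) ∈ Icc 0 C' := fun t ht y =>
    ⟨le_max_left _ _, max_le (le_max_right _ _) ((min_le_right _ _).trans
      (((le_abs_self _).trans (hC t ht)).trans (le_max_left _ _)))⟩
  have hlip : ∀ t ∈ Icc (-N) N, ∀ p r : ℝ × ℝ,
      |f (max 0 (min (p.1 - Real.exp (-(a * t)) / a * p.2) (c t)))
        - f (max 0 (min (r.1 - Real.exp (-(a * t)) / a * r.2) (c t)))|
        ≤ K₀ * ((1 + P) * dist p r) := by
    intro t ht p r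
    have h1 := hK₀.dist_le_mul _ (hmem t ht (p.1 - Real.exp (-(a * t)) / a * p.2)) _
      (hmem t ht (r.1 - Real.exp (-(a * t)) / a * r.2))
    rw [Real.dist_eq, Real.dist_eq] at h1
    refine h1.trans (mul_le_mul_of_nonneg_left ?_ K₀.2)
    have h2 : |max 0 (min (p.1 - Real.exp (-(a * t)) / a * p.2) (c t))
        - max 0 (min (r.1 - Real.exp (-(a * t)) / a * r.2) (c t))|
        ≤ |(p.1 - Real.exp (-(a * t)) / a * p.2) - (r.1 - Real.exp (-(a * t)) / a * r.2)| := by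
      refine (abs_max_sub_max_le_max _ _ _ _).trans (max_le (by simp) ?_)
      exact (abs_min_sub_min_le_max _ _ _ _).trans (max_le le_rfl (by simp))
    refine h2.trans ?_
    have h3 : (p.1 - Real.exp (-(a * t)) / a * p.2) - (r.1 - Real.exp (-(a * t)) / a * r.2)
      = (p.1 - r.1) - Real.exp (-(a * t)) / a * (p.2 - r.2) := by ring
    have h4 : |p.1 - r.1| ≤ dist p r := le_max_left _ _
    have h5 : |p.2 - r.2| ≤ dist p r := le_max_right _ _
    have h6 : |Real.exp (-(a * t)) / a| ≤ P :=
      (hP₃ t ht).trans ((le_max_left _ _).trans (le_max_right _ _))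
    rw [h3]
    refine (abs_sub _ _).trans ?_
    rw [abs_mul, add_mul, one_mul]
    exact add_le_add h4 (mul_le_mul h6 h5 (abs_nonneg _) hP0)
  refine ⟨⟨P * B, mul_nonneg hP0 hB0⟩, ⟨P * (K₀ * (1 + P)), by positivity⟩, fun t ht => ⟨?_, ?_⟩⟩
  · intro p
    have h1 : |Real.exp (-(γ * t)) / a| ≤ P :=
      (hP₁ t ht).trans ((le_max_left _ _).trans (le_max_left _ _))
    have h2 : |Real.exp ((a - γ) * t)| ≤ P :=
      (hP₂ t ht).trans ((le_max_right _ _).trans (le_max_left _ _))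
    have hb := hB _ (hmem t ht (p.1 - Real.exp (-(a * t)) / a * p.2))
    refine max_le ?_ ?_
    · exact (norm_mul_le _ _).trans (mul_le_mul h1 hb (norm_nonneg _) hP0)
    · exact (norm_mul_le _ _).trans (mul_le_mul h2 hb (norm_nonneg _) hP0)
  · refine LipschitzWith.of_dist_le_mul fun p r => ?_
    have h1 : |Real.exp (-(γ * t)) / a| ≤ P :=
      (hP₁ t ht).trans ((le_max_left _ _).trans (le_max_left _ _))
    have h2 : |Real.exp ((a - γ) * t)| ≤ P :=
      (hP₂ t ht).trans ((le_max_right _ _).trans (le_max_left _ _))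
    have hl := hlip t ht p r
    have h3 : ∀ y, |y| ≤ P → |y * f (max 0 (min (p.1 - Real.exp (-(a * t)) / a * p.2) (c t)))
        - y * f (max 0 (min (r.1 - Real.exp (-(a * t)) / a * r.2) (c t)))|
        ≤ P * (K₀ * (1 + P)) * dist p r := by
      intro y hy
      rw [← mul_sub, abs_mul]
      refine (mul_le_mul hy hl (abs_nonneg _) hP0).trans_eq ?_
      ring
    exact max_le (h3 _ h1) (h3 _ h2)

end Flow

/-- The solutions `W s` of the truncated radial system with `W s T = A`, `Q s T = s`, with Lipschitz
dependence on the parameter `s`. -/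
structure IsCapFlow (a γ : ℝ) (f c : ℝ → ℝ) (T A : ℝ) (W Q : ℝ → ℝ → ℝ) : Prop where
  hasDerivAt_W : ∀ s t, HasDerivAt (W s) (Real.exp (-(a * t)) * Q s t) t
  hasDerivAt_Q : ∀ s t,
    HasDerivAt (Q s) (Real.exp ((a - γ) * t) * f (max 0 (min (W s t) (c t)))) t
  W_init : ∀ s, W s T = A
  Q_init : ∀ s, Q s T = s
  lipschitz : ∀ N, ∃ C, ∀ s s' t, t ∈ Icc T N →
    |W s t - W s' t| ≤ C * |s - s'| ∧ |Q s t - Q s' t| ≤ C * |s - s'|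

section CapFlow

variable {a γ : ℝ} {f c : ℝ → ℝ} {T A : ℝ}

lemma hasDerivAt_exp_neg_mul (b x : ℝ) :
    HasDerivAt (fun t => Real.exp (-(b * t))) (-b * Real.exp (-(b * x))) x := by
  have : HasDerivAt (fun t : ℝ => -(b * t)) (-b) x :=
    ((hasDerivAt_id x).const_mul b).neg.congr_deriv (by simp)
  exact this.exp.congr_deriv (mul_comm _ _)

lemma exists_isCapFlow (ha : 0 < a) (hf : ContDiffOn ℝ 1 f (Ici 0)) (hc : Continuous c) :
    ∃ W Q, IsCapFlow a γ f c T A W Q := by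
  choose φ hφ0 hφ using fun s : ℝ => exists_global_solution
    (continuous_capField (a := a) (γ := γ) hf.continuousOn hc) (capField_bounds hf hc) T
    (A + Real.exp (-(a * T)) / a * s, s)
  have hE : ∀ s t, HasDerivAt (fun t => (φ s t).1) (capField a γ f c t (φ s t)).1 t := fun s t =>
    (hasFDerivAt_fst (𝕜 := ℝ) (p := φ s t)).comp_hasDerivAt t (hφ s t)
  have hQ : ∀ s t, HasDerivAt (fun t => (φ s t).2) (capField a γ f c t (φ s t)).2 t := fun s t =>
    (hasFDerivAt_snd (𝕜 := ℝ) (p := φ s t)).comp_hasDerivAt t (hφ s t)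
  refine ⟨fun s t => (φ s t).1 - Real.exp (-(a * t)) / a * (φ s t).2, fun s t => (φ s t).2,
    ?_, hQ, ?_, ?_, ?_⟩
  · intro s t
    have h1 : HasDerivAt (fun t => Real.exp (-(a * t)) / a) (-Real.exp (-(a * t))) t := by
      refine ((hasDerivAt_exp_neg_mul a t).div_const a).congr_deriv ?_
      field_simp
    refine ((hE s t).sub (h1.mul (hQ s t))).congr_deriv ?_
    have : Real.exp (-(γ * t)) = Real.exp (-(a * t)) * Real.exp ((a - γ) * t) := by
      rw [← Real.exp_add]; congr 1; ring
    simp only [capField, this]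
    ring
  · intro s
    simp [hφ0]
  · intro s
    simp [hφ0]
  · intro N
    obtain ⟨L, K, hLK⟩ := capField_bounds (a := a) (γ := γ) hf hc (max |T| |N|)
    set R := Real.exp (-(a * T)) / a
    have hR : 0 < R := by positivity
    refine ⟨(1 + R) * ((1 + R) * Real.exp (K * (N - T))), fun s s' t ht => ?_⟩
    have hd : dist (φ s T) (φ s' T) ≤ (1 + R) * |s - s'| := by
      rw [hφ0, hφ0]
      refine max_le ?_ ?_
      · simp only [Real.dist_eq]
        rw [show A + R * s - (A + R * s') = R * (s - s') by ring, abs_mul, abs_of_pos hR]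
        nlinarith [abs_nonneg (s - s')]
      · simp only [Real.dist_eq]
        nlinarith [abs_nonneg (s - s')]
    have h1 := dist_le_of_trajectories_ODE_of_mem (v := capField a γ f c) (s := fun _ => univ)
      (K := K) (a := T) (b := N)
      (fun t ht => (hLK t ⟨by
        linarith [neg_abs_le T, le_max_left |T| |N|, ht.1], by
        linarith [le_abs_self N, le_max_right |T| |N|, ht.2]⟩).2.lipschitzOnWith)
      (fun t _ => (hφ s t).continuousAt.continuousWithinAt) (fun t _ => (hφ s t).hasDerivWithinAt)
      (fun _ _ => trivial) (fun t _ => (hφ s' t).continuousAt.continuousWithinAt)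
      (fun t _ => (hφ s' t).hasDerivWithinAt) (fun _ _ => trivial) hd t ht
    have h2 : dist (φ s t) (φ s' t) ≤ (1 + R) * Real.exp (K * (N - T)) * |s - s'| := by
      refine h1.trans ?_
      have : Real.exp (K * (t - T)) ≤ Real.exp (K * (N - T)) := by
        gcongr
        exact ht.2
      calc _ ≤ (1 + R) * |s - s'| * Real.exp (K * (N - T)) := by gcongr
        _ = _ := by ring
    have h3 : |(φ s t).1 - (φ s' t).1| ≤ dist (φ s t) (φ s' t) := le_max_left _ _
    have h4 : |(φ s t).2 - (φ s' t).2| ≤ dist (φ s t) (φ s' t) := le_max_right _ _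
    have h5 : Real.exp (-(a * t)) / a ≤ R := by
      simp only [R]
      gcongr
      exact ht.1
    have h6 : 0 < Real.exp (-(a * t)) / a := by positivity
    have h7 := dist_nonneg (x := φ s t) (y := φ s' t)
    constructor
    · have : (φ s t).1 - Real.exp (-(a * t)) / a * (φ s t).2
          - ((φ s' t).1 - Real.exp (-(a * t)) / a * (φ s' t).2)
          = ((φ s t).1 - (φ s' t).1) - Real.exp (-(a * t)) / a * ((φ s t).2 - (φ s' t).2) := by
        ring
      rw [this]
      refine (abs_sub _ _).trans ?_
      rw [abs_mul, abs_of_pos h6]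
      have h8 := mul_le_mul h5 h4 (abs_nonneg _) hR.le
      have h9 := mul_le_mul_of_nonneg_left h2 (by positivity : 0 ≤ 1 + R)
      linarith
    · have h9 := mul_nonneg hR.le (h7.trans h2)
      linarith

namespace IsCapFlow

variable {W Q : ℝ → ℝ → ℝ} {s t : ℝ}

lemma le_Q (h : IsCapFlow a γ f c T A W Q) (hf : ∀ t, 0 ≤ t → 0 ≤ f t) (ht : T ≤ t) :
    s ≤ Q s t := by
  have := monotoneOn_of_hasDerivAt_nonneg (convex_Ici T) (fun t _ => h.hasDerivAt_Q s t)
    (fun t _ => mul_nonneg (Real.exp_pos _).le (hf _ (le_max_left _ _))) self_mem_Ici ht ht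
  rwa [h.Q_init] at this

lemma monotoneOn_W (h : IsCapFlow a γ f c T A W Q) (hf : ∀ t, 0 ≤ t → 0 ≤ f t) (hs : 0 ≤ s) :
    MonotoneOn (W s) (Ici T) :=
  monotoneOn_of_hasDerivAt_nonneg (convex_Ici T) (fun t _ => h.hasDerivAt_W s t)
    fun _ ht => mul_nonneg (Real.exp_pos _).le (hs.trans (h.le_Q hf ht))

lemma le_W (h : IsCapFlow a γ f c T A W Q) (hf : ∀ t, 0 ≤ t → 0 ≤ f t) (hs : 0 ≤ s)
    (ht : T ≤ t) : A ≤ W s t := by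
  have := h.monotoneOn_W hf hs self_mem_Ici ht ht
  rwa [h.W_init] at this

lemma strictMonoOn_W (h : IsCapFlow a γ f c T A W Q) (hf : ∀ t, 0 ≤ t → 0 ≤ f t)
    (hf' : ∀ t, 0 < t → 0 < f t) (hA : 0 < A) (hc : ∀ t, T ≤ t → 0 < c t) (hs : 0 ≤ s) :
    StrictMonoOn (W s) (Ici T) := by
  refine strictMonoOn_of_hasDerivAt_pos (convex_Ici T) (fun t _ => h.hasDerivAt_W s t)
    fun t ht => mul_pos (Real.exp_pos _) ?_
  rw [interior_Ici] at ht
  have := strictMonoOn_of_hasDerivAt_pos (convex_Ici T) (fun t _ => h.hasDerivAt_Q s t)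
    (fun t ht => mul_pos (Real.exp_pos _) (hf' _ (lt_max_of_lt_right (lt_min
      (hA.trans_le (h.le_W hf hs (interior_subset ht))) (hc t (interior_subset ht))))))
    self_mem_Ici (mem_Ici.2 (le_of_lt ht)) ht
  rw [h.Q_init] at this
  exact hs.trans_lt this

lemma slope_le (h : IsCapFlow a γ f c T A W Q) (hf : ∀ t, 0 ≤ t → 0 ≤ f t) (ha : 0 ≤ a)
    (hs : 0 ≤ s) : A + Real.exp (-(a * (T + 1))) * s ≤ W s (T + 1) := by
  have := monotoneOn_of_hasDerivAt_nonneg (convex_Icc T (T + 1))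
    (fun t _ => (h.hasDerivAt_W s t).sub
      ((hasDerivAt_id t).const_mul (Real.exp (-(a * (T + 1))) * s))) (fun t ht => by
        have h1 := h.le_Q hf ht.1 (s := s)
        have h2 : Real.exp (-(a * (T + 1))) ≤ Real.exp (-(a * t)) := by
          gcongr
          exact ht.2
        have := mul_le_mul h2 h1 hs (Real.exp_pos _).le
        linarith) (left_mem_Icc.2 (by linarith)) (right_mem_Icc.2 (by linarith)) (by linarith)
  simp only [Pi.sub_apply, id, h.W_init] at this
  linarith

lemma isRadialSol (h : IsCapFlow a γ f c T A W Q) (h0 : 0 ≤ W s t) (hc : W s t ≤ c t) :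
    IsRadialSol a γ f (W s) (Q s) t := by
  refine ⟨h.hasDerivAt_W s t, ?_⟩
  have := h.hasDerivAt_Q s t
  rwa [min_eq_left hc, max_eq_right h0] at this

lemma isGlobalRadialSol (h : IsCapFlow a γ f c T A W Q) (hf : ∀ t, 0 ≤ t → 0 ≤ f t) (hA : 0 < A)
    (hs : 0 ≤ s) (hc : ∀ t, T ≤ t → W s t ≤ c t) : IsGlobalRadialSol a γ f (W s) (Q s) T where
  sol t ht := h.isRadialSol (hA.le.trans (h.le_W hf hs ht)) (hc t ht)
  pos t ht := hA.trans_le (h.le_W hf hs ht)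
  nonneg := by rwa [h.Q_init]

/-- Solutions with small energy at a late time stay bounded. -/
lemma le_of_energy_le (h : IsCapFlow a γ f c T A W Q) (hf : ∀ t, 0 ≤ t → 0 ≤ f t) (ha : 0 < a)
    (hγ : 0 < γ) {T₁ K B : ℝ} (hB : 0 < B) (hK : 0 ≤ K) (hfB : ∀ y ∈ Icc 0 (K + 1), f y ≤ B)
    (hs : 0 ≤ s) (hT : T ≤ T₁) (hsmall : 2 * B / (a * γ) * Real.exp (-(γ * T₁)) ≤ 1 / 2)
    (hE : W s T₁ + Real.exp (-(a * T₁)) / a * Q s T₁ ≤ K + 1 / 2) (ht : T₁ ≤ t) :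
    W s t ≤ K + 1 := by
  have hEd : ∀ x, HasDerivAt (fun t => W s t + Real.exp (-(a * t)) / a * Q s t)
      (Real.exp (-(γ * x)) / a * f (max 0 (min (W s x) (c x)))) x := fun x => by
    refine ((h.hasDerivAt_W s x).add
      (((hasDerivAt_exp_neg_mul a x).div_const a).mul (h.hasDerivAt_Q s x))).congr_deriv ?_
    have : Real.exp (-(γ * x)) = Real.exp (-(a * x)) * Real.exp ((a - γ) * x) := by
      rw [← Real.exp_add]; congr 1; ring
    rw [this]
    field_simp
    ring
  have hQ : ∀ x, T ≤ x → 0 ≤ Real.exp (-(a * x)) / a * Q s x := fun x hx =>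
    mul_nonneg (by positivity) (hs.trans (h.le_Q hf hx))
  have hle := image_le_of_deriv_right_lt_deriv_boundary (a := T₁) (b := t)
    (f := fun t => W s t + Real.exp (-(a * t)) / a * Q s t)
    (fun x _ => (hEd x).continuousAt.continuousWithinAt) (fun x _ => (hEd x).hasDerivWithinAt)
    (B := fun x => K + 1 - 2 * B / (a * γ) * Real.exp (-(γ * x)))
    (B' := fun x => 2 * B / a * Real.exp (-(γ * x))) (by linarith)
    (fun x => (((hasDerivAt_exp_neg_mul γ x).const_mul (2 * B / (a * γ))).const_sub (K + 1)).congr_deriv (by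
      field_simp)) (fun x hx hx' => by
        have hTx := hT.trans hx.1
        have h1 : 0 < 2 * B / (a * γ) * Real.exp (-(γ * x)) := by positivity
        have h2 := hQ x hTx
        have hx'' : W s x + Real.exp (-(a * x)) / a * Q s x
          = K + 1 - 2 * B / (a * γ) * Real.exp (-(γ * x)) := hx'
        have h3 : f (max 0 (min (W s x) (c x))) ≤ B := hfB _ ⟨le_max_left _ _,
          max_le (by linarith) ((min_le_left _ _).trans (by linarith))⟩
        have h4 : 0 < Real.exp (-(γ * x)) / a := by positivity
        have h5 : 2 * B / a * Real.exp (-(γ * x)) = 2 * (Real.exp (-(γ * x)) / a * B) := by ring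
        rw [h5]
        have h6 := mul_pos h4 hB
        have h7 := mul_le_mul_of_nonneg_left h3 h4.le
        linarith) (right_mem_Icc.2 ht)
  have h1 : 0 < 2 * B / (a * γ) * Real.exp (-(γ * t)) := by positivity
  have h2 := hQ t (hT.trans ht)
  linarith

end IsCapFlow

end CapFlow

section BallMax

variable {D : ℕ} {u : EuclideanSpace ℝ (Fin D) → ℝ}

/-- The maximum of `u` over the closed ball of radius `exp t`. -/
noncomputable def ballMax (u : EuclideanSpace ℝ (Fin D) → ℝ) (t : ℝ) : ℝ :=
  sSup ((fun y => u (Real.exp t • y)) '' Metric.closedBall 0 1)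

lemma continuous_ballMax (hu : Continuous u) : Continuous (ballMax u) :=
  (isCompact_closedBall (0 : EuclideanSpace ℝ (Fin D)) 1).continuous_sSup
    (f := fun t y => u (Real.exp t • y)) (by fun_prop)

lemma le_ballMax (hu : Continuous u) {t : ℝ} {x : EuclideanSpace ℝ (Fin D)}
    (hx : ‖x‖ ≤ Real.exp t) : u x ≤ ballMax u t := by
  have hc : IsCompact ((fun y => u (Real.exp t • y)) ''
      Metric.closedBall (0 : EuclideanSpace ℝ (Fin D)) 1) :=
    (isCompact_closedBall _ _).image (by fun_prop)
  refine le_csSup hc.bddAbove ⟨Real.exp (-t) • x, ?_, ?_⟩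
  · rw [mem_closedBall_zero_iff, norm_smul, Real.norm_eq_abs, abs_of_pos (Real.exp_pos _),
      Real.exp_neg, inv_mul_le_iff₀ (Real.exp_pos _)]
    simpa using hx
  · simp [smul_smul, ← Real.exp_add]

lemma exists_eq_ballMax (hu : Continuous u) (t : ℝ) : ∃ x, ‖x‖ ≤ Real.exp t ∧ u x = ballMax u t := by
  have hc : IsCompact ((fun y => u (Real.exp t • y)) ''
      Metric.closedBall (0 : EuclideanSpace ℝ (Fin D)) 1) :=
    (isCompact_closedBall _ _).image (by fun_prop)
  obtain ⟨y, hy, hy'⟩ := hc.sSup_mem ((Metric.nonempty_closedBall.2 zero_le_one).image _)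
  refine ⟨Real.exp t • y, ?_, hy'⟩
  rw [mem_closedBall_zero_iff] at hy
  rw [norm_smul, Real.norm_eq_abs, abs_of_pos (Real.exp_pos _)]
  nlinarith [Real.exp_pos t]

lemma exists_norm_eq_exp (hD : 3 ≤ D) (t : ℝ) :
    ∃ x : EuclideanSpace ℝ (Fin D), x ≠ 0 ∧ ‖x‖ = Real.exp t := by
  have : NeZero D := ⟨by omega⟩
  have h : ‖EuclideanSpace.single (0 : Fin D) (Real.exp t)‖ = Real.exp t := by
    rw [PiLp.norm_single, Real.norm_eq_abs, abs_of_pos (Real.exp_pos _)]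
  exact ⟨_, norm_pos_iff.1 (by rw [h]; exact Real.exp_pos t), h⟩

end BallMax

lemma exists_small_exp {γ B : ℝ} (hγ : 0 < γ) (T₀ : ℝ) :
    ∃ T, T₀ ≤ T ∧ B * Real.exp (-(γ * T)) ≤ 1 / 2 := by
  have h : Tendsto (fun T : ℝ => B * Real.exp (-(γ * T))) atTop (𝓝 (B * 0)) :=
    (Real.tendsto_exp_neg_atTop_nhds_zero.comp (tendsto_id.const_mul_atTop hγ)).const_mul B
  rw [mul_zero] at h
  obtain ⟨T, h1, h2⟩ :=
    ((h.eventually_le_const (by norm_num : (0 : ℝ) < 1 / 2)).and (eventually_ge_atTop T₀)).exists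
  exact ⟨T, h2, h1⟩

lemma exists_pos_bound {f : ℝ → ℝ} (hf : ContinuousOn f (Ici 0)) (K : ℝ) :
    ∃ B, 0 < B ∧ ∀ y ∈ Icc 0 K, f y ≤ B := by
  obtain ⟨B, hB⟩ := isCompact_Icc.exists_bound_of_continuousOn
    (hf.mono (fun x hx => hx.1 : Icc 0 K ⊆ Ici (0 : ℝ)))
  exact ⟨max B 1, by positivity,
    fun y hy => ((le_abs_self _).trans (hB y hy)).trans (le_max_left _ _)⟩

lemma IsCapFlow.continuous_W {a γ : ℝ} {f c : ℝ → ℝ} {T A : ℝ} {W Q : ℝ → ℝ → ℝ}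
    (h : IsCapFlow a γ f c T A W Q) {t : ℝ} (ht : T ≤ t) : Continuous fun s => W s t := by
  obtain ⟨C, hC⟩ := h.lipschitz t
  exact (LipschitzWith.of_dist_le' (K := C) fun s s' => (hC s s' t ⟨ht, le_rfl⟩).1).continuous

/-- The energy of a bounded solution does not exceed any upper bound of the solution. -/
lemma IsGlobalRadialSol.energy_le {a γ : ℝ} {f w q : ℝ → ℝ} {T K : ℝ} (ha : 0 < a)
    (hf : ∀ t, 0 < t → 0 < f t) (h : IsGlobalRadialSol a γ f w q T) (hK : ∀ t, T ≤ t → w t ≤ K) :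
    w T + Real.exp (-(a * T)) / a * q T ≤ K := by
  have hmono : ∀ t, T ≤ t →
      w T + Real.exp (-(a * T)) / a * q T - Real.exp (-(a * t)) / a * q T ≤ K := by
    intro t ht
    have hm := monotoneOn_of_hasDerivAt_nonneg (convex_Ici T)
      (fun x hx => (h.sol x hx).1.add (((hasDerivAt_exp_neg_mul a x).div_const a).mul_const (q T)))
      (fun x hx => by
        have h1 := (h.strictMonoOn_q hf).monotoneOn self_mem_Ici hx hx
        have h2 := mul_le_mul_of_nonneg_left h1 (Real.exp_pos (-(a * x))).le
        have h3 : -a * Real.exp (-(a * x)) / a = -Real.exp (-(a * x)) := by field_simp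
        rw [h3]
        linarith) self_mem_Ici (mem_Ici.2 ht) ht
    simp only [Pi.add_apply] at hm
    linarith [hK t ht]
  have hlim : Tendsto (fun t : ℝ => w T + Real.exp (-(a * T)) / a * q T
      - Real.exp (-(a * t)) / a * q T) atTop
      (𝓝 (w T + Real.exp (-(a * T)) / a * q T - 0 / a * q T)) :=
    (((Real.tendsto_exp_neg_atTop_nhds_zero.comp
      (tendsto_id.const_mul_atTop ha)).div_const a).mul_const _).const_sub _
  have := le_of_tendsto hlim ((eventually_ge_atTop T).mono hmono)
  simpa using this

section Lower

variable {D : ℕ} {u : EuclideanSpace ℝ (Fin D) → ℝ} {γ : ℝ} {f : ℝ → ℝ}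

/-- Below every large solution there is a large radial solution on an exterior domain. -/
theorem IsLargeSol.exists_lower (hu : IsLargeSol γ f u) (hD : 3 ≤ D) (hγ : 0 < γ)
    (hf1 : ContDiffOn ℝ 1 f (Ici 0)) (hf0 : ∀ t, 0 ≤ t → 0 ≤ f t) (hf : ∀ t, 0 < t → 0 < f t) :
    ∃ v q T, 0 ≤ T ∧ IsGlobalRadialSol ((D : ℝ) - 2) γ f v q T ∧ Continuous v ∧
      Tendsto v atTop atTop ∧ ∀ x, Real.exp T ≤ ‖x‖ → v (Real.log ‖x‖) ≤ u x := by
  set a : ℝ := (D : ℝ) - 2 with ha_def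
  have ha : 0 < a := by
    have : (3 : ℝ) ≤ D := by exact_mod_cast hD
    linarith
  have huc := hu.smooth.continuous
  obtain ⟨B, hB, hfB⟩ := exists_pos_bound hf1.continuousOn (1 + 1)
  obtain ⟨T₀, hT₀⟩ := hu.exists_lt 2
  obtain ⟨T, hTT, hTs⟩ := exists_small_exp (B := 2 * B / (a * γ)) hγ (max T₀ 0)
  have hT0 : 0 ≤ T := (le_max_right _ _).trans hTT
  have hTu : ∀ x, Real.exp T ≤ ‖x‖ → 2 < u x := fun x hx =>
    hT₀ x ((Real.exp_le_exp.2 ((le_max_left _ _).trans hTT)).trans hx)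
  have hM : ∀ K T', (∀ x, Real.exp T' ≤ ‖x‖ → K < u x) → ∀ t, T' ≤ t → K < ballMax u t := by
    intro K T' h t ht
    obtain ⟨x, -, hx⟩ := exists_norm_eq_exp hD t
    exact (h x (by rw [hx]; gcongr)).trans_le (le_ballMax huc hx.le)
  set c : ℝ → ℝ := fun t => ballMax u t + 1 with hc_def
  obtain ⟨W, Q, h⟩ := exists_isCapFlow (γ := γ) (T := T) (A := 1) ha hf1
    (show Continuous c from (continuous_ballMax huc).add continuous_const)
  set S := {s | 0 ≤ s ∧ (∃ C, ∀ t, T ≤ t → W s t ≤ C) ∧ ∀ t, T ≤ t → W s t ≤ c t} with hS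
  have h0S : (0 : ℝ) ∈ S := by
    have h2 : ∀ t, T ≤ t → W 0 t ≤ 1 + 1 := fun t ht =>
      h.le_of_energy_le hf0 ha hγ hB zero_le_one hfB le_rfl le_rfl hTs
        (by rw [h.W_init, h.Q_init]; norm_num) ht
    exact ⟨le_rfl, ⟨_, h2⟩, fun t ht => by simp only [hc_def]; linarith [h2 t ht, hM _ _ hTu t ht]⟩
  have hSu : ∀ s ∈ S, ∀ x, Real.exp T ≤ ‖x‖ → W s (Real.log ‖x‖) ≤ u x := by
    rintro s ⟨hs, ⟨C, hC⟩, hsc⟩ x hx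
    have hx0 : x ≠ 0 := norm_pos_iff.1 ((Real.exp_pos T).trans_le hx)
    obtain ⟨T₂, hT₂⟩ := hu.exists_lt C
    have hTN : T ≤ max T₂ (max T (Real.log ‖x‖)) := (le_max_left _ _).trans (le_max_right _ _)
    have hg := h.isGlobalRadialSol hf0 one_pos hs hsc
    refine hu.radial_le hγ hf hT0 hTN (hg.continuousOn_w.mono fun t ht => ht.1)
      (fun t ht => hg.sol t ht.1.le) (fun y hy => by rw [h.W_init]; linarith [hTu y hy])
      (fun y hy => ?_)
      ⟨(exp_le_norm_iff T hx0).1 hx, (le_max_right _ _).trans (le_max_right _ _)⟩ hx0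
    exact (hC _ hTN).trans_lt (hT₂ y ((Real.exp_le_exp.2 (le_max_left _ _)).trans hy))
  have hSb : BddAbove S := by
    refine ⟨c (T + 1) / Real.exp (-(a * (T + 1))), fun s hs => ?_⟩
    rw [le_div_iff₀ (Real.exp_pos _)]
    have := h.slope_le hf0 ha.le hs.1
    have := hs.2.2 (T + 1) (by linarith)
    linarith
  set s₀ := sSup S with hs₀
  have hs₀0 : 0 ≤ s₀ := le_csSup hSb h0S
  have hs₀u : ∀ x, Real.exp T ≤ ‖x‖ → W s₀ (Real.log ‖x‖) ≤ u x := by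
    intro x hx
    have hx0 : x ≠ 0 := norm_pos_iff.1 ((Real.exp_pos T).trans_le hx)
    exact closure_minimal (fun s hs => hSu s hs x hx) (isClosed_le
      (h.continuous_W ((exp_le_norm_iff T hx0).1 hx)) continuous_const)
      (csSup_mem_closure ⟨_, h0S⟩ hSb)
  have hs₀M : ∀ t, T ≤ t → W s₀ t ≤ ballMax u t := by
    intro t ht
    obtain ⟨x, -, hx⟩ := exists_norm_eq_exp hD t
    have := hs₀u x (by rw [hx]; gcongr)
    rw [hx, Real.log_exp] at this
    exact this.trans (le_ballMax huc hx.le)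
  have hg : IsGlobalRadialSol a γ f (W s₀) (Q s₀) T :=
    h.isGlobalRadialSol hf0 one_pos hs₀0 fun t ht => by
      simp only [hc_def]; linarith [hs₀M t ht]
  refine ⟨W s₀, Q s₀, T, hT0, hg,
    continuous_iff_continuousAt.2 fun t => (h.hasDerivAt_W s₀ t).continuousAt, ?_, hs₀u⟩
  have hunb : ∀ K, ∃ t, T ≤ t ∧ K < W s₀ t := by
    intro K
    by_contra! hK
    have hK0 : 0 ≤ K := (hg.pos T le_rfl).le.trans (hK T le_rfl)
    obtain ⟨B', hB', hfB'⟩ := exists_pos_bound hf1.continuousOn (K + 1)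
    obtain ⟨T₂, hT₂⟩ := hu.exists_lt K
    obtain ⟨T₁, hT₁, hT₁s⟩ := exists_small_exp (B := 2 * B' / (a * γ)) hγ (max T₂ T)
    have hTT₁ : T ≤ T₁ := (le_max_right _ _).trans hT₁
    have hE := (hg.mono hf hTT₁).energy_le ha hf fun t ht => hK t (hTT₁.trans ht)
    obtain ⟨C, hC⟩ := h.lipschitz T₁
    set R := Real.exp (-(a * T₁)) / a with hR
    have hR0 : 0 < R := by positivity
    set δ := 1 / (2 * ((1 + R) * (|C| + 1))) with hδ
    have hδ0 : 0 < δ := by positivity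
    have hδC : (1 + R) * (|C| * δ) ≤ 1 / 2 := by
      have : (1 + R) * ((|C| + 1) * δ) = 1 / 2 := by rw [hδ]; field_simp
      nlinarith
    have hCδ : C * |s₀ + δ - s₀| ≤ |C| * δ := by
      rw [add_sub_cancel_left, abs_of_pos hδ0]
      gcongr
      exact le_abs_self C
    have hCδ0 : 0 ≤ |C| * δ := by positivity
    have hs0 : 0 ≤ s₀ + δ := by linarith
    have hnear : ∀ t ∈ Icc T T₁, W (s₀ + δ) t ≤ W s₀ t + 1 / 2 := fun t ht => by
      have := (le_abs_self _).trans ((hC (s₀ + δ) s₀ t ht).1.trans hCδ)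
      nlinarith
    have hlate : ∀ t, T₁ ≤ t → W (s₀ + δ) t ≤ K + 1 := fun t ht => by
      refine h.le_of_energy_le hf0 ha hγ hB' hK0 hfB' hs0 hTT₁ hT₁s ?_ ht
      have h1 := (le_abs_self _).trans ((hC (s₀ + δ) s₀ T₁ ⟨hTT₁, le_rfl⟩).1.trans hCδ)
      have h2 := (le_abs_self _).trans ((hC (s₀ + δ) s₀ T₁ ⟨hTT₁, le_rfl⟩).2.trans hCδ)
      have h3 := mul_le_mul_of_nonneg_left h2 hR0.le
      linarith
    have hmem : s₀ + δ ∈ S := by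
      refine ⟨hs0, ⟨K + 1, fun t ht => ?_⟩, fun t ht => ?_⟩
      · rcases le_total t T₁ with h1 | h1
        · linarith [hnear t ⟨ht, h1⟩, hK t ht]
        · exact hlate t h1
      · simp only [hc_def]
        rcases le_total t T₁ with h1 | h1
        · linarith [hnear t ⟨ht, h1⟩, hs₀M t ht]
        · linarith [hlate t h1, hM K T₂ hT₂ t (((le_max_left _ _).trans hT₁).trans h1)]
    linarith [le_csSup hSb hmem]
  refine tendsto_atTop.2 fun K => ?_
  obtain ⟨t, ht, hKt⟩ := hunb K
  filter_upwards [eventually_ge_atTop t] with r hr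
  exact hKt.le.trans ((hg.strictMonoOn_w hf).monotoneOn ht (ht.trans hr) hr)

end Lower

section Upper

variable {D : ℕ} {u : EuclideanSpace ℝ (Fin D) → ℝ} {γ : ℝ} {f : ℝ → ℝ}

/-- Above every large solution there is a radial solution on an exterior domain. -/
theorem IsLargeSol.exists_upper (hu : IsLargeSol γ f u) (hD : 3 ≤ D) (hγ : 0 < γ)
    (hf1 : ContDiffOn ℝ 1 f (Ici 0)) (hf0 : ∀ t, 0 ≤ t → 0 ≤ f t) (hf : ∀ t, 0 < t → 0 < f t)
    {v q : ℝ → ℝ} {T₀ : ℝ} (hT₀ : 0 ≤ T₀) (hv : IsGlobalRadialSol ((D : ℝ) - 2) γ f v q T₀)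
    (hvc : Continuous v) (hvlim : Tendsto v atTop atTop) :
    ∃ V p T, IsGlobalRadialSol ((D : ℝ) - 2) γ f V p T ∧
      ∀ x, Real.exp T ≤ ‖x‖ → u x ≤ V (Real.log ‖x‖) := by
  set a : ℝ := (D : ℝ) - 2 with ha_def
  have ha : 0 < a := by
    have : (3 : ℝ) ≤ D := by exact_mod_cast hD
    linarith
  have huc := hu.smooth.continuous
  obtain ⟨T₁, hT₁⟩ := hu.exists_lt (ballMax u 0)
  set T := max T₁ T₀ + 1 with hT_def
  have hT₀T : T₀ < T := by linarith [le_max_right T₁ T₀]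
  have hT0 : 0 < T := hT₀.trans_lt hT₀T
  have hM0 : ∀ t, T ≤ t → ballMax u 0 < ballMax u t := by
    intro t ht
    obtain ⟨x, -, hx⟩ := exists_norm_eq_exp hD t
    refine (hT₁ x ?_).trans_le (le_ballMax huc hx.le)
    rw [hx]
    gcongr
    linarith [le_max_left T₁ T₀]
  have hMpos : ∀ t, 0 < ballMax u t := fun t =>
    (hu.pos 0).trans_le (le_ballMax huc (by simp [Real.exp_nonneg]))
  set A := ballMax u T with hA
  have hApos : 0 < A := hMpos T
  obtain ⟨H, hH0, hH⟩ : ∃ H, 0 ≤ H ∧ A ≤ v (T + H) := by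
    obtain ⟨r, h1, h2⟩ := ((hvlim.eventually_ge_atTop A).and (eventually_ge_atTop T)).exists
    exact ⟨r - T, by linarith, by simpa using h1⟩
  set c : ℝ → ℝ := fun t => max (v (t + H)) (ballMax u t) + 1 with hc_def
  have hMc : ∀ t, ballMax u t + 1 ≤ c t := fun t => by
    simp only [hc_def]; linarith [le_max_right (v (t + H)) (ballMax u t)]
  have hvc' : ∀ t, v (t + H) + 1 ≤ c t := fun t => by
    simp only [hc_def]; linarith [le_max_left (v (t + H)) (ballMax u t)]
  have hc0 : ∀ t, 0 < c t := fun t => by linarith [hMc t, hMpos t]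
  have hcc : Continuous c :=
    ((hvc.comp (continuous_id.add continuous_const)).max (continuous_ballMax huc)).add
      continuous_const
  obtain ⟨W, Q, h⟩ := exists_isCapFlow (γ := γ) (T := T) (A := A) ha hf1 hcc
  have hWc : ∀ s, Continuous (W s) := fun s =>
    continuous_iff_continuousAt.2 fun t => (h.hasDerivAt_W s t).continuousAt
  set S := {s | 0 ≤ s ∧ ∀ t, T ≤ t → W s t ≤ c t} with hS
  have hhit : ∀ s, 0 ≤ s → s ∉ S → ∃ N, T < N ∧ c N ≤ W s N ∧
      ∀ x, T ≤ Real.log ‖x‖ → Real.log ‖x‖ ≤ N → x ≠ 0 → u x ≤ W s (Real.log ‖x‖) := by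
    intro s hs hsS
    have : ∃ t, T ≤ t ∧ c t < W s t := by
      by_contra! hcon
      exact hsS ⟨hs, hcon⟩
    obtain ⟨t, ht, hct⟩ := this
    obtain ⟨N, ⟨⟨hTN, -⟩, hN⟩, hleast⟩ := (isCompact_Icc.inter_right
      (isClosed_le hcc (hWc s))).exists_isLeast (s := Icc T t ∩ {t | c t ≤ W s t})
        ⟨t, ⟨ht, le_rfl⟩, hct.le⟩
    have hN : c N ≤ W s N := hN
    have hlt : ∀ r, T ≤ r → r < N → W s r < c r := fun r hr hrN => by
      by_contra! hcon
      rcases le_total r t with h1 | h1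
      · exact absurd (hleast ⟨⟨hr, h1⟩, hcon⟩) (not_le.2 hrN)
      · exact absurd (hleast ⟨⟨ht, le_rfl⟩, hct.le⟩) (not_le.2 (h1.trans_lt hrN))
    have hTN' : T < N := by
      refine lt_of_le_of_ne hTN fun e => ?_
      rw [← e, h.W_init] at hN
      linarith [hMc T]
    refine ⟨N, hTN', hN, fun x h1 h2 hx0 => ?_⟩
    have hmono := h.strictMonoOn_W hf0 hf hApos (fun t _ => hc0 t) hs
    refine hu.le_radial hγ hf hT0.le (hWc s).continuousOn (q := Q s)
      (fun r hr => h.isRadialSol (hApos.le.trans (h.le_W hf0 hs hr.1.le)) (hlt r hr.1.le hr.2).le)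
      (fun r hr => hmono self_mem_Ici (mem_Ici.2 hr.1.le) hr.1) (fun y hy => ?_) (fun y hy => ?_)
      ⟨h1, h2⟩ hx0
    · rw [h.W_init]
      exact le_ballMax huc hy
    · linarith [le_ballMax huc hy, hMc N]
  have h0S : (0 : ℝ) ∈ S := by
    by_contra h0
    obtain ⟨N, hTN, -, hN⟩ := hhit 0 le_rfl h0
    obtain ⟨x₀, hx₀, hux₀⟩ := exists_eq_ballMax huc T
    have hx₁ : 1 < ‖x₀‖ := by
      by_contra! hcon
      have := le_ballMax (t := 0) huc (by simpa using hcon)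
      linarith [hM0 T le_rfl]
    have hx₀0 : x₀ ≠ 0 := norm_pos_iff.1 (one_pos.trans hx₁)
    have hlog0 : 0 ≤ Real.log ‖x₀‖ := Real.log_nonneg hx₁.le
    have hlogT : Real.log ‖x₀‖ ≤ T := (norm_le_exp_iff T hx₀0).1 hx₀
    have hM : ∀ t ∈ Ioc T N, ballMax u t ≤ W 0 t := by
      intro t ht
      obtain ⟨y, hy, huy⟩ := exists_eq_ballMax huc t
      rw [← huy]
      by_cases hyT : ‖y‖ ≤ Real.exp T
      · exact (le_ballMax huc hyT).trans (h.le_W hf0 le_rfl ht.1.le)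
      · push Not at hyT
        have hy0 : y ≠ 0 := norm_pos_iff.1 ((Real.exp_pos T).trans hyT)
        have hyt := (norm_le_exp_iff t hy0).1 hy
        have hyT' := (exp_le_norm_iff T hy0).1 hyT.le
        exact (hN y hyT' (hyt.trans ht.2) hy0).trans
          (h.monotoneOn_W hf0 le_rfl hyT' (mem_Ici.2 ht.1.le) hyt)
    set κ := A - ballMax u 0 with hκ
    have hκ0 : 0 < κ := sub_pos.2 (hM0 T le_rfl)
    have hexp : ∀ t, 0 < t → Real.exp (-(a * t)) < 1 := fun t ht =>
      Real.exp_lt_one_iff.2 (by nlinarith)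
    have hkey : ∀ t ∈ Ioc T N, A + κ * Real.exp (-(a * T)) ≤ W 0 t + κ * Real.exp (-(a * t)) := by
      intro t ht
      have ht0 : 0 < t := hT0.trans ht.1
      have hh := le_harmonic_of_laplacian_pos hD hu.smooth hu.lap_pos (t₁ := t) ht0
        (fun x hx => le_ballMax (t := 0) huc (by simp [hx])) (fun x hx => le_ballMax huc hx.le)
        ⟨hlog0, hlogT.trans ht.1.le⟩ hx₀0
      rw [← ha_def, hux₀, ← hA] at hh
      have hden : 0 < 1 - Real.exp (-(a * t)) := by linarith [hexp t ht0]
      have h1 : Real.exp (-(a * T)) ≤ Real.exp (-(a * Real.log ‖x₀‖)) := by gcongr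
      have hm : 0 < ballMax u t - ballMax u 0 := sub_pos.2 (hM0 t ht.1.le)
      rw [← sub_le_iff_le_add', le_div_iff₀ hden] at hh
      have h2 := mul_le_mul_of_nonneg_left h1 hm.le
      have h3 := hM t ht
      have h4 : A ≤ W 0 t := h.le_W hf0 le_rfl ht.1.le
      have h5 := hexp T hT0
      have h6 : (ballMax u t - A) * (1 - Real.exp (-(a * T)))
          ≤ (W 0 t - A) * (1 - Real.exp (-(a * T))) :=
        mul_le_mul_of_nonneg_right (by linarith) (by linarith)
      have h7 : 0 ≤ (W 0 t - A) * Real.exp (-(a * T)) :=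
        mul_nonneg (by linarith) (Real.exp_pos _).le
      simp only [hκ]
      linarith
    have hd : HasDerivAt (fun t => W 0 t + κ * Real.exp (-(a * t)))
        (Real.exp (-(a * T)) * Q 0 T + κ * (-a * Real.exp (-(a * T)))) T :=
      (h.hasDerivAt_W 0 T).add ((hasDerivAt_exp_neg_mul a T).const_mul κ)
    have hge := ge_of_tendsto
      ((hasDerivWithinAt_iff_tendsto_slope' self_notMem_Ioi).1 (hd.hasDerivWithinAt (s := Ioi T)))
      (b := 0) (by
        filter_upwards [Ioc_mem_nhdsGT hTN] with t ht
        rw [slope_def_field]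
        refine div_nonneg (sub_nonneg.2 ?_) (by linarith [ht.1])
        simp only [h.W_init]
        exact hkey t ht)
    rw [h.Q_init, mul_zero, zero_add] at hge
    have : 0 < κ * (a * Real.exp (-(a * T))) := by positivity
    linarith
  have hSb : BddAbove S := by
    refine ⟨c (T + 1) / Real.exp (-(a * (T + 1))), fun s hs => ?_⟩
    rw [le_div_iff₀ (Real.exp_pos _)]
    have := h.slope_le hf0 ha.le hs.1
    have := hs.2 (T + 1) (by linarith)
    linarith
  set s₀ := sSup S with hs₀
  have hs₀0 : 0 ≤ s₀ := le_csSup hSb h0S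
  have hg : IsGlobalRadialSol a γ f (W s₀) (Q s₀) T :=
    h.isGlobalRadialSol hf0 hApos hs₀0 fun t ht =>
      closure_minimal (fun s hs => hs.2 t ht) (isClosed_le (h.continuous_W ht) continuous_const)
        (csSup_mem_closure ⟨_, h0S⟩ hSb)
  have hgap : ∀ t, T ≤ t → W s₀ t + 1 ≤ c t := fun t ht => by
    have := IsGlobalRadialSol.le_shift ha hγ hf hv hvlim hg hH0 (by linarith)
      (by rwa [h.W_init]) ht
    linarith [hvc' t]
  refine ⟨W s₀, Q s₀, T, hg, fun x hx => ?_⟩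
  have hx0 : x ≠ 0 := norm_pos_iff.1 ((Real.exp_pos T).trans_le hx)
  set t := Real.log ‖x‖ with ht
  have hTt : T ≤ t := (exp_le_norm_iff T hx0).1 hx
  obtain ⟨C, hC⟩ := h.lipschitz t
  have hsmall : ∀ᶠ s in 𝓝[>] s₀, C * |s - s₀| < 1 :=
    ((continuous_const.mul (continuous_abs.comp
      (continuous_id.sub continuous_const))).continuousAt.eventually_lt
        continuousAt_const (by simp [hs₀])).filter_mono nhdsWithin_le_nhds
  refine ge_of_tendsto ((h.continuous_W hTt).continuousAt.tendsto.mono_left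
    (nhdsWithin_le_nhds (s := Ioi s₀))) ?_
  filter_upwards [hsmall, self_mem_nhdsWithin] with s hs hss₀
  have hss₀ : s₀ < s := hss₀
  obtain ⟨N, hTN, hcN, hN⟩ := hhit s (hs₀0.trans hss₀.le) fun hmem =>
    absurd (le_csSup hSb hmem) (not_le.2 hss₀)
  refine hN x hTt ?_ hx0
  by_contra! hNt
  have h1 := (le_abs_self _).trans (hC s s₀ N ⟨hTN.le, hNt.le⟩).1
  linarith [hgap N hTN.le]

end Upper

lemma tendsto_log_norm_cocompact {D : ℕ} :
    Tendsto (fun x : EuclideanSpace ℝ (Fin D) => Real.log ‖x‖) (cocompact _) atTop :=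
  Real.tendsto_log_atTop.comp (tendsto_norm_cocompact_atTop (E := EuclideanSpace ℝ (Fin D)))

/-- Two large solutions with the same weight are asymptotically ordered, up to any `ε > 0`. -/
theorem IsLargeSol.eventually_sub_lt {D : ℕ} {u₁ u₂ : EuclideanSpace ℝ (Fin D) → ℝ} {γ : ℝ}
    {f : ℝ → ℝ} (hu₁ : IsLargeSol γ f u₁) (hu₂ : IsLargeSol γ f u₂) (hD : 3 ≤ D) (hγ : 0 < γ)
    (hf1 : ContDiffOn ℝ 1 f (Ici 0)) (hf0 : ∀ t, 0 ≤ t → 0 ≤ f t) (hf : ∀ t, 0 < t → 0 < f t)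
    {ε : ℝ} (hε : 0 < ε) : ∀ᶠ x in cocompact _, u₁ x - u₂ x < ε := by
  have ha : (0 : ℝ) < D - 2 := by
    have : (3 : ℝ) ≤ D := by exact_mod_cast hD
    linarith
  obtain ⟨v, q, T, hT, hv, hvc, hvlim, hvu⟩ := hu₂.exists_lower hD hγ hf1 hf0 hf
  obtain ⟨V, p, T', hV, hVu⟩ := hu₁.exists_upper hD hγ hf1 hf0 hf hT hv hvc hvlim
  have hVlim : Tendsto V atTop atTop := by
    refine tendsto_atTop.2 fun K => ?_
    obtain ⟨R, hR⟩ := hu₁.exists_lt K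
    filter_upwards [eventually_ge_atTop (max R T')] with t ht
    obtain ⟨x, -, hx⟩ := exists_norm_eq_exp hD t
    have h1 := hR x (by rw [hx]; gcongr; exact (le_max_left _ _).trans ht)
    have h2 := hVu x (by rw [hx]; gcongr; exact (le_max_right _ _).trans ht)
    rw [hx, Real.log_exp] at h2
    linarith
  filter_upwards [tendsto_log_norm_cocompact.eventually
    (IsGlobalRadialSol.eventually_sub_lt ha hγ hf hv hvlim hV hVlim hε),
    tendsto_norm_cocompact_atTop.eventually_ge_atTop (Real.exp T),
    tendsto_norm_cocompact_atTop.eventually_ge_atTop (Real.exp T')] with x h1 h2 h3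
  linarith [hvu x h2, hVu x h3]

/-- Under (SA), if `ρ(x) = |x|^{-α}` for `|x| ≥ 1` with `α > 2`, then
any two entire large solutions differ by `o(1)` at infinity. -/
theorem stmt4 (D : ℕ) (hD : 3 ≤ D)
    (f : ℝ → ℝ) (ρ : EuclideanSpace ℝ (Fin D) → ℝ)
    (hf : ContDiffOn ℝ 1 f (Ici 0)) (hf0 : f 0 = 0)
    (hfpos : ∀ t : ℝ, 0 < t → 0 < f t)
    (hKO : ∃ b : ℝ, 0 < b ∧
      IntegrableOn (fun s => 1 / Real.sqrt (∫ t in (0:ℝ)..s, f t)) (Ici b))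
    (hρ : ContDiff ℝ 1 ρ) (hρpos : ∀ x, 0 < ρ x)
    (hHρ : Tendsto (fun x : EuclideanSpace ℝ (Fin D) =>
      ∫ y : EuclideanSpace ℝ (Fin D), ‖x - y‖ ^ (2 - (D:ℝ)) * ρ y) (cocompact _) (nhds 0))
    (α : ℝ) (hα : 2 < α)
    (hρpow : ∀ x : EuclideanSpace ℝ (Fin D), 1 ≤ ‖x‖ → ρ x = ‖x‖ ^ (-α))
    (u₁ u₂ : EuclideanSpace ℝ (Fin D) → ℝ)
    (hu₁ : ContDiff ℝ 2 u₁) (hu₁pos : ∀ x, 0 < u₁ x)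
    (hu₁eq : ∀ x, laplacian u₁ x = ρ x * f (u₁ x))
    (hu₁lim : Tendsto u₁ (cocompact _) atTop)
    (hu₂ : ContDiff ℝ 2 u₂) (hu₂pos : ∀ x, 0 < u₂ x)
    (hu₂eq : ∀ x, laplacian u₂ x = ρ x * f (u₂ x))
    (hu₂lim : Tendsto u₂ (cocompact _) atTop) :
    Tendsto (fun x => u₁ x - u₂ x) (cocompact _) (nhds 0) := by
  have hlarge : ∀ u : EuclideanSpace ℝ (Fin D) → ℝ, ContDiff ℝ 2 u → (∀ x, 0 < u x) →
      (∀ x, laplacian u x = ρ x * f (u x)) → Tendsto u (cocompact _) atTop →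
      IsLargeSol (α - 2) f u := fun u h1 h2 h3 h4 =>
    { smooth := h1
      pos := h2
      lap_pos := fun x => by rw [h3]; exact mul_pos (hρpos x) (hfpos _ (h2 x))
      eq := fun x hx => by rw [h3, hρpow x hx, sub_add_cancel]
      lim := h4 }
  have h1 := hlarge u₁ hu₁ hu₁pos hu₁eq hu₁lim
  have h2 := hlarge u₂ hu₂ hu₂pos hu₂eq hu₂lim
  have hf0' : ∀ t, 0 ≤ t → 0 ≤ f t := fun t ht => by
    rcases ht.eq_or_lt with rfl | ht
    · exact hf0.ge
    · exact (hfpos t ht).le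
  refine Metric.tendsto_nhds.2 fun ε hε => ?_
  filter_upwards [h1.eventually_sub_lt h2 hD (sub_pos.2 hα) hf hf0' hfpos hε,
    h2.eventually_sub_lt h1 hD (sub_pos.2 hα) hf hf0' hfpos hε] with x hx1 hx2
  rw [Real.dist_eq, sub_zero, abs_lt]
  constructor <;> linarith
end
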